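/- arXiv:1705.02066 — 2 statements merged into one kernel-verified Lean document; each statement's English description precedes it below -/
import Mathlib

section
/- A strongly regular graph with parameters v = 266, k = 45, λ = 0, μ = 9 (for which e⁺ = 3, e⁻ = −12 and m⁻ = 56) has at most 56 distinct cocliques of size 56 (i.e., at most m⁻ Delsarte cocliques, not m⁻ + 1). -/
/-- `Y` is a coclique (independent set) in the graph `G`. -/
def IsCoclique {V : Type*} (G : SimpleGraph V) (Y : Finset V) : Prop :=
  ∀ x ∈ Y, ∀ y ∈ Y, ¬ G.Adj x y

namespace SRG324

open Finset

section

variable {W : Type*} [Fintype W] [DecidableEq W]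

/-- The integer adjacency matrix of a strongly regular graph with parameters
`(324, 57, 0, 12)`, described entrywise. -/
structure IsSRGMatrix (A : W → W → ℤ) : Prop where
  symm : ∀ u v, A u v = A v u
  zero_or_one : ∀ u v, A u v = 0 ∨ A u v = 1
  loopless : ∀ u, A u u = 0
  triangle_free : ∀ u v w, A u v = 1 → A v w = 1 → A u w = 0
  sum_mul : ∀ u v, ∑ t, A u t * A v t = 12 - 12 * A u v + if u = v then 45 else 0
  card : Fintype.card W = 324

/-- The action of the matrix `A` on functions: the sum of `φ` over the neighbours of a vertex. -/
def nbrSum (A : W → W → ℤ) (φ : W → ℤ) (u : W) : ℤ := ∑ t, A u t * φ t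

namespace IsSRGMatrix

variable {A : W → W → ℤ}

theorem sq (h : IsSRGMatrix A) (u v : W) : A u v * A u v = A u v := by
  rcases h.zero_or_one u v with e | e <;> simp [e]

theorem nonneg (h : IsSRGMatrix A) (u v : W) : 0 ≤ A u v := by
  rcases h.zero_or_one u v with e | e <;> simp [e]

theorem le_one (h : IsSRGMatrix A) (u v : W) : A u v ≤ 1 := by
  rcases h.zero_or_one u v with e | e <;> simp [e]

theorem sum_row (h : IsSRGMatrix A) (u : W) : ∑ t, A u t = 57 := by
  have := h.sum_mul u u
  simpa [h.sq, h.loopless] using this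

theorem mul_triangle (h : IsSRGMatrix A) (u v w : W) : A u v * A v w * A u w = 0 := by
  rcases h.zero_or_one u v with e | e
  · simp [e]
  · rcases h.zero_or_one v w with e' | e'
    · simp [e']
    · simp [h.triangle_free u v w e e']

theorem ne_of_adj (h : IsSRGMatrix A) {u v : W} (huv : A u v = 1) : u ≠ v := by
  rintro rfl
  simp [h.loopless] at huv

theorem sum_const (h : IsSRGMatrix A) (c : ℤ) : ∑ _t : W, c = 324 * c := by
  simp [h.card]

/-- Self-adjointness of the neighbour sum. -/
theorem sum_nbrSum_mul (h : IsSRGMatrix A) (φ ψ : W → ℤ) :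
    ∑ t, nbrSum A φ t * ψ t = ∑ t, φ t * nbrSum A ψ t := by
  simp only [nbrSum, Finset.sum_mul, Finset.mul_sum]
  rw [Finset.sum_comm]
  refine Finset.sum_congr rfl fun u _ => Finset.sum_congr rfl fun v _ => ?_
  rw [h.symm v u]; ring

theorem sum_nbrSum (h : IsSRGMatrix A) (φ : W → ℤ) :
    ∑ t, nbrSum A φ t = 57 * ∑ t, φ t := by
  have := h.sum_nbrSum_mul φ (fun _ => 1)
  simpa [nbrSum, h.sum_row, Finset.sum_mul, Finset.mul_sum, mul_comm] using this

theorem nbrSum_nbrSum (h : IsSRGMatrix A) (φ : W → ℤ) (u : W) :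
    nbrSum A (nbrSum A φ) u = 12 * ∑ t, φ t - 12 * nbrSum A φ u + 45 * φ u := by
  have : nbrSum A (nbrSum A φ) u = ∑ v, (∑ t, A u t * A v t) * φ v := by
    simp only [nbrSum, Finset.sum_mul, Finset.mul_sum]
    rw [Finset.sum_comm]
    refine Finset.sum_congr rfl fun u _ => Finset.sum_congr rfl fun v _ => ?_
    rw [h.symm v u]; ring
  rw [this]
  simp only [h.sum_mul, nbrSum, add_mul, sub_mul, Finset.sum_add_distrib, Finset.sum_sub_distrib,
    Finset.mul_sum, ite_mul, zero_mul, Finset.sum_ite_eq, Finset.mem_univ, if_true, mul_assoc]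

/-- The sum of squares of `(A - 3) φ`. -/
theorem sum_sq_nbrSum_sub (h : IsSRGMatrix A) (φ : W → ℤ) :
    ∑ t, (nbrSum A φ t - 3 * φ t) ^ 2 =
      18 * ∑ t, φ t * (3 * φ t - nbrSum A φ t) + 12 * (∑ t, φ t) ^ 2 := by
  have h1 : ∑ t, nbrSum A φ t * nbrSum A φ t =
      12 * (∑ t, φ t) ^ 2 - 12 * ∑ t, φ t * nbrSum A φ t + 45 * ∑ t, φ t * φ t := by
    rw [h.sum_nbrSum_mul]
    have : ∀ t, φ t * nbrSum A (nbrSum A φ) t = 12 * (∑ t, φ t) * φ t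
        - 12 * (φ t * nbrSum A φ t) + 45 * (φ t * φ t) := fun t => by
      rw [h.nbrSum_nbrSum]; ring
    simp only [this, Finset.sum_add_distrib, Finset.sum_sub_distrib, ← Finset.mul_sum]
    ring
  have h2 : ∑ t, (nbrSum A φ t - 3 * φ t) ^ 2 = ∑ t, nbrSum A φ t * nbrSum A φ t
      - 6 * ∑ t, φ t * nbrSum A φ t + 9 * ∑ t, φ t * φ t := by
    simp only [Finset.mul_sum, ← Finset.sum_add_distrib, ← Finset.sum_sub_distrib]
    exact Finset.sum_congr rfl fun _ _ => by ring
  have h3 : ∑ t, φ t * (3 * φ t - nbrSum A φ t) =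
      3 * ∑ t, φ t * φ t - ∑ t, φ t * nbrSum A φ t := by
    simp only [Finset.mul_sum, ← Finset.sum_sub_distrib]
    exact Finset.sum_congr rfl fun _ _ => by ring
  rw [h2, h1, h3]; ring

/-- Counting common neighbours of three vertices, two of which are distinct and nonadjacent. -/
theorem sum_mul_mul (h : IsSRGMatrix A) {x y : W} (hxy : x ≠ y) (hA : A x y = 0) (z : W) :
    ∑ t, A x t * A y t * A z t = 3 * (1 - A x z) * (1 - A y z) +
      (if z = x then 9 else 0) + (if z = y then 9 else 0) := by
  set T : W → ℤ := nbrSum A fun t => A x t * A y t with hT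
  have hTe : ∀ z, ∑ t, A x t * A y t * A z t = T z := fun z =>
    Finset.sum_congr rfl fun _ _ => by ring
  rw [hTe]
  set B : W → ℤ := fun z => (1 - A x z) * (1 - A y z) with hB
  have hS : ∑ t, A x t * A y t = 12 := by rw [h.sum_mul, hA]; simp [hxy]
  have hTx : T x = 12 := by
    rw [← hTe, ← hS]
    exact Finset.sum_congr rfl fun t _ => by linear_combination A y t * h.sq x t
  have hTy : T y = 12 := by
    rw [← hTe, ← hS]
    exact Finset.sum_congr rfl fun t _ => by linear_combination A x t * h.sq y t
  have hsT : ∑ z, T z = 684 := by rw [hT, h.sum_nbrSum, hS]; norm_num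
  have hTT : ∑ z, T z * T z = 2268 := by
    rw [hT, h.sum_nbrSum_mul]
    simp only [h.nbrSum_nbrSum, hS]
    have : ∀ t, A x t * A y t * (12 * 12 - 12 * nbrSum A (fun t => A x t * A y t) t +
        45 * (A x t * A y t)) = 189 * (A x t * A y t) := by
      intro t
      have h0 : A x t * nbrSum A (fun t => A x t * A y t) t = 0 := by
        simp only [nbrSum, Finset.mul_sum]
        exact Finset.sum_eq_zero fun s _ => by linear_combination A y s * h.mul_triangle x t s
      linear_combination -12 * A y t * h0 + 45 * A y t * A y t * h.sq x t +
        45 * A x t * h.sq y t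
    simp only [this, ← Finset.mul_sum, hS]; norm_num
  have hTB : ∀ z, T z * B z = T z := by
    intro z
    have hx : A x z * T z = 0 := by
      simp only [hT, nbrSum, Finset.mul_sum]
      exact Finset.sum_eq_zero fun s _ => by linear_combination A y s * h.mul_triangle x z s
    have hy : A y z * T z = 0 := by
      simp only [hT, nbrSum, Finset.mul_sum]
      exact Finset.sum_eq_zero fun s _ => by linear_combination A x s * h.mul_triangle y z s
    simp only [hB]
    linear_combination (A y z - 1) * hx - hy
  have hsB : ∑ z, B z = 222 := by
    have : ∀ z, B z = 1 - A x z - A y z + A x z * A y z := fun z => by simp only [hB]; ring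
    simp only [this, Finset.sum_add_distrib, Finset.sum_sub_distrib, h.sum_row, hS, h.sum_const]
    norm_num
  have hBB : ∀ z, B z * B z = B z := by
    intro z
    simp only [hB]
    rcases h.zero_or_one x z with e | e <;> rcases h.zero_or_one y z with e' | e' <;> simp [e, e']
  have hBx : B x = 1 := by simp [hB, h.loopless, h.symm y x, hA]
  have hBy : B y = 1 := by simp [hB, h.loopless, hA]
  have key : ∑ z, (T z - 3 * B z - (if z = x then 9 else 0) - (if z = y then 9 else 0)) ^ 2
      = 0 := by
    have : ∀ z, (T z - 3 * B z - (if z = x then 9 else 0) - (if z = y then 9 else 0)) ^ 2 =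
        T z * T z - 6 * T z + 9 * B z + (if z = x then 81 - 18 * T z + 54 * B z else 0) +
        (if z = y then 81 - 18 * T z + 54 * B z else 0) := by
      intro z
      have e1 := hTB z
      have e2 := hBB z
      by_cases c1 : z = x
      · have c2 : z ≠ y := fun c => hxy (c1 ▸ c)
        simp only [c1, hxy, if_true, if_false]
        subst c1
        linear_combination -6 * e1 + 9 * e2
      · by_cases c2 : z = y
        · simp only [c2, hxy.symm, if_true, if_false]
          subst c2
          linear_combination -6 * e1 + 9 * e2
        · simp only [c1, c2, if_false]
          linear_combination -6 * e1 + 9 * e2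
    simp only [this, Finset.sum_add_distrib, Finset.sum_sub_distrib, ← Finset.mul_sum,
      Finset.sum_ite_eq', Finset.mem_univ, if_true, hTT, hsT, hsB, hTx, hTy, hBx, hBy]
    norm_num
  rw [Finset.sum_eq_zero_iff_of_nonneg fun _ _ => sq_nonneg _] at key
  have := pow_eq_zero_iff (two_ne_zero) |>.1 (key z (Finset.mem_univ z))
  simp only [hB] at this
  linear_combination this

end IsSRGMatrix

end

section

variable {W : Type*} [Fintype W] [DecidableEq W]

/-- A function with values in `{-1, 0, 1}` whose sums over common neighbourhoods are those of the
function attached to a complete bipartite subgraph `K₃,₃`. -/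
structure IsBalanced (A : W → W → ℤ) (γ : W → ℤ) : Prop where
  values : ∀ u, γ u = -1 ∨ γ u = 0 ∨ γ u = 1
  sum_pair : ∀ u v, ∑ t, A u t * A v t * γ t =
    -3 * (γ u + γ v) * (1 - A u v) - if u = v then 9 * γ u else 0
  sum_sq : ∀ u, ∑ t, A u t * γ t ^ 2 = 18 + 3 * γ u ^ 2

/-- The set `C` lies in the level set `γ = 1` and is a union of connected components of the
subgraph induced there. -/
structure IsComponentUnion (A : W → W → ℤ) (γ : W → ℤ) (C : Finset W) : Prop where
  eq_one : ∀ p ∈ C, γ p = 1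
  closed : ∀ p ∈ C, ∀ q, γ q = 1 → A p q = 1 → q ∈ C

/-- `φ` is supported on `γ = 1` and is an eigenvector there for the eigenvalue `c`. -/
structure IsLocalEigen (A : W → W → ℤ) (γ : W → ℤ) (c : ℤ) (φ : W → ℤ) : Prop where
  support : ∀ t, γ t ≠ 1 → φ t = 0
  nbrSum_eq : ∀ t, γ t = 1 → nbrSum A φ t = c * φ t

/-- The restriction of the neighbour sum of `σ` to the level set `γ = -1`. -/
def transfer (A : W → W → ℤ) (γ σ : W → ℤ) (t : W) : ℤ := if γ t = -1 then nbrSum A σ t else 0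

namespace IsBalanced

variable {A : W → W → ℤ} {γ : W → ℤ}

theorem neg (hγ : IsBalanced A γ) : IsBalanced A fun t => -γ t where
  values u := by have := hγ.values u; omega
  sum_pair u v := by
    have := hγ.sum_pair u v
    simp only [mul_neg, Finset.sum_neg_distrib, this]
    split_ifs <;> ring
  sum_sq u := by simpa using hγ.sum_sq u

theorem two_mul_ite (hγ : IsBalanced A γ) (t : W) :
    2 * (if γ t = 1 then (1 : ℤ) else 0) = γ t ^ 2 + γ t := by
  rcases hγ.values t with e | e | e <;> simp [e]

theorem nbrSum_self (hA : IsSRGMatrix A) (hγ : IsBalanced A γ) (u : W) :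
    nbrSum A γ u = -15 * γ u := by
  have := hγ.sum_pair u u
  simp only [hA.sq, hA.loopless, if_true] at this
  rw [nbrSum, this]; ring

theorem sum_eq_zero (hA : IsSRGMatrix A) (hγ : IsBalanced A γ) : ∑ t, γ t = 0 := by
  have := hA.sum_nbrSum γ
  simp only [hγ.nbrSum_self hA, ← Finset.mul_sum] at this
  linarith

theorem sum_sq_eq (hA : IsSRGMatrix A) (hγ : IsBalanced A γ) : ∑ t, γ t ^ 2 = 108 := by
  have h1 := hA.sum_nbrSum fun t => γ t ^ 2
  have h2 : ∀ u, nbrSum A (fun t => γ t ^ 2) u = 18 + 3 * γ u ^ 2 := hγ.sum_sq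
  simp only [h2, Finset.sum_add_distrib, ← Finset.mul_sum, hA.sum_const] at h1
  linarith

theorem two_mul_degree (hA : IsSRGMatrix A) (hγ : IsBalanced A γ) (u : W) :
    2 * ∑ t, A u t * (if γ t = 1 then 1 else 0) = 18 + 3 * γ u ^ 2 - 15 * γ u := by
  have h1 := hγ.sum_sq u
  have h2 := hγ.nbrSum_self hA u
  rw [nbrSum] at h2
  rw [Finset.mul_sum, Finset.sum_congr rfl fun t _ => show
    2 * (A u t * (if γ t = 1 then 1 else 0)) = A u t * γ t ^ 2 + A u t * γ t by
      linear_combination A u t * hγ.two_mul_ite t, Finset.sum_add_distrib, h1, h2]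
  ring

theorem degree (hA : IsSRGMatrix A) (hγ : IsBalanced A γ) {u : W} (hu : γ u = 1) :
    ∑ t, A u t * (if γ t = 1 then 1 else 0) = 3 := by
  have := hγ.two_mul_degree hA u
  rw [hu] at this
  linarith

/-- The bilinear identity satisfied by a balanced function. -/
theorem sum_mul_nbrSum_mul_nbrSum (hA : IsSRGMatrix A) (hγ : IsBalanced A γ) (φ ψ : W → ℤ) :
    ∑ t, γ t * ((nbrSum A φ t - 3 * φ t) * (nbrSum A ψ t - 3 * ψ t)) =
      -3 * ((∑ t, γ t * φ t) * ∑ t, ψ t + (∑ t, φ t) * ∑ t, γ t * ψ t) := by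
  have h1 : ∑ t, γ t * (nbrSum A φ t * nbrSum A ψ t) =
      ∑ u, ∑ v, φ u * ψ v * ∑ t, A u t * A v t * γ t := by
    conv_rhs => rw [Finset.sum_comm]
    simp only [nbrSum, Finset.sum_mul, Finset.mul_sum]
    rw [Finset.sum_comm' (t' := univ) (s' := fun _ => univ) (by simp)]
    refine Finset.sum_congr rfl fun u _ => ?_
    rw [Finset.sum_comm' (t' := univ) (s' := fun _ => univ) (by simp)]
    refine Finset.sum_congr rfl fun v _ => Finset.sum_congr rfl fun t _ => ?_
    rw [hA.symm u t, hA.symm v t]; ring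
  have h2 : ∑ u, ∑ v, φ u * ψ v * ∑ t, A u t * A v t * γ t =
      -3 * ((∑ t, γ t * φ t) * ∑ t, ψ t + (∑ t, φ t) * ∑ t, γ t * ψ t)
      + 3 * ∑ u, γ u * φ u * nbrSum A ψ u + 3 * ∑ u, φ u * nbrSum A (fun v => γ v * ψ v) u
      - 9 * ∑ u, γ u * φ u * ψ u := by
    have : ∀ u, ∑ v, φ u * ψ v * ∑ t, A u t * A v t * γ t =
        -3 * (γ u * φ u * ∑ t, ψ t + φ u * ∑ t, γ t * ψ t) + 3 * (γ u * φ u * nbrSum A ψ u)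
        + 3 * (φ u * nbrSum A (fun v => γ v * ψ v) u) - 9 * (γ u * φ u * ψ u) := by
      intro u
      have e : ∀ v, φ u * ψ v * ∑ t, A u t * A v t * γ t =
          -3 * (γ u * φ u * ψ v + φ u * (γ v * ψ v)) + 3 * (γ u * φ u * (A u v * ψ v))
          + 3 * (φ u * (A u v * (γ v * ψ v))) - if u = v then 9 * (γ u * φ u * ψ v) else 0 := by
        intro v
        rw [hγ.sum_pair]
        split_ifs <;> ring
      simp only [e, Finset.sum_add_distrib, Finset.sum_sub_distrib, ← Finset.mul_sum,
        Finset.sum_ite_eq, Finset.mem_univ, if_true, nbrSum]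
    simp only [this, Finset.sum_add_distrib, Finset.sum_sub_distrib, ← Finset.mul_sum,
      ← Finset.sum_mul]
  have h3 : ∑ u, φ u * nbrSum A (fun v => γ v * ψ v) u = ∑ u, γ u * ψ u * nbrSum A φ u := by
    rw [← hA.sum_nbrSum_mul]
    exact Finset.sum_congr rfl fun _ _ => by ring
  rw [Finset.sum_congr rfl fun t _ => show
    γ t * ((nbrSum A φ t - 3 * φ t) * (nbrSum A ψ t - 3 * ψ t)) =
      γ t * (nbrSum A φ t * nbrSum A ψ t) - 3 * (γ t * φ t * nbrSum A ψ t)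
      - 3 * (γ t * ψ t * nbrSum A φ t) + 9 * (γ t * φ t * ψ t) by ring]
  simp only [Finset.sum_add_distrib, Finset.sum_sub_distrib, ← Finset.mul_sum]
  rw [h1, h2, h3]; ring

/-- A function which behaves on average like an eigenvector on `γ = 1` for the eigenvalue `3` has
neighbour sums determined by its total. -/
theorem nbrSum_of_sum_eq_zero (hA : IsSRGMatrix A) (hγ : IsBalanced A γ) {φ : W → ℤ}
    (h1 : ∀ t, γ t ≠ 1 → φ t = 0) (h2 : ∑ t, φ t * (3 * φ t - nbrSum A φ t) = 0) (u : W) :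
    6 * (nbrSum A φ u - 3 * φ u) = (∑ t, φ t) * (1 - γ u) := by
  set s := ∑ t, φ t with hs
  have hγφ : ∑ t, γ t * φ t = s := Finset.sum_congr rfl fun t _ => by
    by_cases c : γ t = 1
    · rw [c, one_mul]
    · rw [h1 t c, mul_zero]
  have hQ := hA.sum_sq_nbrSum_sub φ
  rw [h2] at hQ
  have hL : ∑ t, γ t * nbrSum A φ t = -15 * s := by
    have := hA.sum_nbrSum_mul γ φ
    rw [← this, ← hγφ, Finset.mul_sum]
    exact Finset.sum_congr rfl fun t _ => by rw [hγ.nbrSum_self hA]; ring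
  have key : ∑ t, (6 * (nbrSum A φ t - 3 * φ t) - s * (1 - γ t)) ^ 2 = 0 := by
    have : ∀ t, (6 * (nbrSum A φ t - 3 * φ t) - s * (1 - γ t)) ^ 2 =
        36 * (nbrSum A φ t - 3 * φ t) ^ 2 - 12 * s * nbrSum A φ t + 36 * s * φ t
        + 12 * s * (γ t * nbrSum A φ t) - 36 * s * (γ t * φ t) + s ^ 2 * γ t ^ 2
        - 2 * s ^ 2 * γ t + s ^ 2 := fun t => by ring
    simp only [this, Finset.sum_add_distrib, Finset.sum_sub_distrib, ← Finset.mul_sum,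
      hA.sum_const, hQ, hL, hγφ, hA.sum_nbrSum, hγ.sum_eq_zero hA, hγ.sum_sq_eq hA, ← hs]
    ring
  rw [Finset.sum_eq_zero_iff_of_nonneg fun _ _ => sq_nonneg _] at key
  have := pow_eq_zero_iff (two_ne_zero) |>.1 (key u (Finset.mem_univ u))
  linarith

theorem nbrSum_localEigen (hA : IsSRGMatrix A) (hγ : IsBalanced A γ) {φ : W → ℤ}
    (hφ : IsLocalEigen A γ 3 φ) (u : W) :
    6 * (nbrSum A φ u - 3 * φ u) = (∑ t, φ t) * (1 - γ u) := by
  refine hγ.nbrSum_of_sum_eq_zero hA hφ.support (Finset.sum_eq_zero fun t _ => ?_) u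
  by_cases c : γ t = 1
  · rw [hφ.nbrSum_eq t c]; ring
  · rw [hφ.support t c]; ring

/-- An eigenvector for `±3` on the cubic graph `γ = 1` is constant, respectively alternating, along
edges. -/
theorem localEigen_adj (hA : IsSRGMatrix A) (hγ : IsBalanced A γ) {φ : W → ℤ} {e : ℤ}
    (he : e ^ 2 = 1) (hφ : IsLocalEigen A γ (3 * e) φ) {p q : W} (hp : γ p = 1) (hq : γ q = 1)
    (hpq : A p q = 1) : φ p = e * φ q := by
  set i : W → ℤ := fun t => if γ t = 1 then 1 else 0 with hi
  have hii : ∀ t, i t * φ t = φ t := fun t => by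
    by_cases c : γ t = 1
    · simp [hi, c]
    · simp [hφ.support t c]
  have hi0 : ∀ t, 0 ≤ i t := fun t => by simp only [hi]; split_ifs <;> norm_num
  have hdeg : ∀ t, φ t ^ 2 * ∑ s, A t s * i s = 3 * φ t ^ 2 := fun t => by
    by_cases c : γ t = 1
    · rw [hγ.degree hA c]; ring
    · simp [hφ.support t c]
  have hev : ∀ t, φ t * nbrSum A φ t = 3 * e * φ t ^ 2 := fun t => by
    by_cases c : γ t = 1
    · rw [hφ.nbrSum_eq t c]; ring
    · simp [hφ.support t c]
  have h1 : ∑ t, ∑ s, A t s * i t * i s * (φ t - e * φ s) ^ 2 = 0 := by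
    have e1 : ∀ t s, A t s * i t * i s * (φ t - e * φ s) ^ 2 =
        φ t ^ 2 * (A t s * i s) - 2 * e * (φ t * (A t s * φ s)) + φ s ^ 2 * (A s t * i t) := by
      intro t s
      rw [hA.symm s t]
      linear_combination (A t s * i s * φ t - 2 * e * A t s * i s * φ s) * hii t +
        (A t s * i t * φ s - 2 * e * A t s * φ t) * hii s + A t s * i t * i s * φ s ^ 2 * he
    have e2 : ∑ t, ∑ s, φ s ^ 2 * (A s t * i t) = ∑ s, φ s ^ 2 * ∑ t, A s t * i t := by
      rw [Finset.sum_comm]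
      simp only [Finset.mul_sum]
    simp only [e1, Finset.sum_add_distrib, Finset.sum_sub_distrib, e2, ← Finset.mul_sum, hdeg]
    have e3 : ∑ t, φ t * ∑ s, A t s * φ s = 3 * e * ∑ t, φ t ^ 2 := by
      rw [Finset.mul_sum]
      exact Finset.sum_congr rfl fun t _ => hev t
    rw [e3]
    linear_combination -6 * (∑ t, φ t ^ 2) * he
  have hnn : ∀ t s, 0 ≤ A t s * i t * i s * (φ t - e * φ s) ^ 2 := fun t s =>
    mul_nonneg (mul_nonneg (mul_nonneg (hA.nonneg t s) (hi0 t)) (hi0 s)) (sq_nonneg _)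
  rw [Finset.sum_eq_zero_iff_of_nonneg fun t _ => Finset.sum_nonneg fun s _ => hnn t s] at h1
  have h2 := h1 p (Finset.mem_univ p)
  rw [Finset.sum_eq_zero_iff_of_nonneg fun s _ => hnn p s] at h2
  have h3 := h2 q (Finset.mem_univ q)
  simp only [hi, hp, hq, hpq, if_true, mul_one, one_mul] at h3
  have := pow_eq_zero_iff (two_ne_zero) |>.1 h3
  linarith

/-- An alternating function on the cubic graph `γ = 1` is an eigenvector for `-3`. -/
theorem isLocalEigen_of_adj (hA : IsSRGMatrix A) (hγ : IsBalanced A γ) {φ : W → ℤ} {e : ℤ}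
    (h0 : ∀ t, γ t ≠ 1 → φ t = 0)
    (h1 : ∀ p q, γ p = 1 → γ q = 1 → A p q = 1 → φ q = e * φ p) :
    IsLocalEigen A γ (3 * e) φ where
  support := h0
  nbrSum_eq p hp := by
    have : ∀ q, A p q * φ q = A p q * (if γ q = 1 then 1 else 0) * (e * φ p) := fun q => by
      rcases hA.zero_or_one p q with c | c
      · simp [c]
      · by_cases d : γ q = 1
        · simp [d, h1 p q hp d c]
        · simp [d, h0 q d]
    rw [nbrSum, Finset.sum_congr rfl fun q _ => this q, ← Finset.sum_mul, hγ.degree hA hp]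
    ring

theorem sum_localEigen_neg (hA : IsSRGMatrix A) (hγ : IsBalanced A γ) {σ : W → ℤ}
    (hσ : IsLocalEigen A γ (-3) σ) : ∑ t, σ t = 0 := by
  have h1 : ∑ t, nbrSum A σ t * (if γ t = 1 then 1 else 0) = -3 * ∑ t, σ t := by
    rw [Finset.mul_sum]
    refine Finset.sum_congr rfl fun t _ => ?_
    by_cases c : γ t = 1
    · simp [c, hσ.nbrSum_eq t c]
    · simp [c, hσ.support t c]
  have h2 : ∑ t, σ t * nbrSum A (fun t => if γ t = 1 then 1 else 0) t = 3 * ∑ t, σ t := by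
    rw [Finset.mul_sum]
    refine Finset.sum_congr rfl fun t _ => ?_
    by_cases c : γ t = 1
    · rw [nbrSum, hγ.degree hA c]; ring
    · simp [hσ.support t c]
  rw [hA.sum_nbrSum_mul] at h1
  linarith

theorem nbrSum_transfer (hA : IsSRGMatrix A) (hγ : IsBalanced A γ) {σ : W → ℤ}
    (hσ : IsLocalEigen A γ (-3) σ) (u : W) :
    nbrSum A (transfer A γ σ) u = 18 * σ u - 6 * nbrSum A σ u + 3 * transfer A γ σ u := by
  have hs := hγ.sum_localEigen_neg hA hσ
  have hγσ : ∑ t, γ t * σ t = 0 := by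
    rw [← hs]
    refine Finset.sum_congr rfl fun t _ => ?_
    by_cases c : γ t = 1
    · rw [c, one_mul]
    · rw [hσ.support t c, mul_zero]
  have hB := hγ.sum_mul_nbrSum_mul_nbrSum hA σ fun t => if t = u then 1 else 0
  rw [hs, hγσ] at hB
  have h1 : ∀ t, nbrSum A (fun t => if t = u then 1 else 0) t = A u t := fun t => by
    simp [nbrSum, hA.symm u t]
  have h2 : ∀ t, γ t * (nbrSum A σ t - 3 * σ t) = -6 * σ t - transfer A γ σ t := fun t => by
    rcases hγ.values t with e | e | e
    · simp [transfer, e, hσ.support t (by omega)]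
    · simp [transfer, e, hσ.support t (by omega)]
    · simp only [transfer, e, hσ.nbrSum_eq t e]; norm_num; ring
  have h3 : ∀ t, γ t * ((nbrSum A σ t - 3 * σ t) *
      (nbrSum A (fun t => if t = u then 1 else 0) t - 3 * if t = u then 1 else 0)) =
      -6 * (A u t * σ t) - A u t * transfer A γ σ t +
        if t = u then 18 * σ t + 3 * transfer A γ σ t else 0 := fun t => by
    rw [← mul_assoc, h2, h1]
    split_ifs <;> ring
  simp only [h3, Finset.sum_add_distrib, Finset.sum_sub_distrib, ← Finset.mul_sum,
    Finset.sum_ite_eq', Finset.mem_univ, if_true] at hB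
  simp only [nbrSum] at hB ⊢
  linarith

theorem isLocalEigen_transfer (hA : IsSRGMatrix A) (hγ : IsBalanced A γ) {σ : W → ℤ}
    (hσ : IsLocalEigen A γ (-3) σ) :
    IsLocalEigen A (fun t => -γ t) (-3) (transfer A γ σ) where
  support t ht := by simp only [transfer]; rw [if_neg (by omega)]
  nbrSum_eq t ht := by
    have ht' : γ t = -1 := by omega
    rw [hγ.nbrSum_transfer hA hσ, hσ.support t (by omega)]
    simp only [transfer, ht', if_true]; ring

theorem sum_sq_transfer (hA : IsSRGMatrix A) (hγ : IsBalanced A γ) {σ : W → ℤ}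
    (hσ : IsLocalEigen A γ (-3) σ) :
    ∑ t, transfer A γ σ t ^ 2 = 36 * ∑ t, σ t ^ 2 := by
  have h1 : ∑ t, transfer A γ σ t ^ 2 = ∑ t, transfer A γ σ t * nbrSum A σ t :=
    Finset.sum_congr rfl fun t _ => by simp only [transfer]; split_ifs <;> ring
  rw [h1, ← hA.sum_nbrSum_mul, Finset.mul_sum]
  refine Finset.sum_congr rfl fun t _ => ?_
  by_cases c : γ t = 1
  · rw [hγ.nbrSum_transfer hA hσ, hσ.nbrSum_eq t c]
    simp only [transfer, c]; norm_num; ring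
  · simp [hσ.support t c]

end IsBalanced

namespace IsComponentUnion

variable {A : W → W → ℤ} {γ : W → ℤ} {C : Finset W}

theorem six_mul_sum (hA : IsSRGMatrix A) (hγ : IsBalanced A γ) (hC : IsComponentUnion A γ C)
    (u : W) : 6 * ∑ t ∈ C, A u t = (if u ∈ C then 18 else 0) + (C.card : ℤ) * (1 - γ u) := by
  have hL : ∀ u, nbrSum A (fun t => if t ∈ C then 1 else 0) u = ∑ t ∈ C, A u t := fun u => by
    simp [nbrSum]
  have := hγ.nbrSum_of_sum_eq_zero hA (φ := fun t => if t ∈ C then 1 else 0)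
    (fun t ht => if_neg fun c => ht (hC.eq_one t c)) (Finset.sum_eq_zero fun p _ => by
      by_cases c : p ∈ C
      · have : ∀ q, A p q * (if q ∈ C then 1 else 0) = A p q * if γ q = 1 then 1 else 0 := by
          intro q
          rcases hA.zero_or_one p q with e | e
          · simp [e]
          · by_cases d : γ q = 1
            · simp [d, hC.closed p c q d e]
            · simp [d, show q ∉ C from fun c => d (hC.eq_one q c)]
        rw [nbrSum, Finset.sum_congr rfl fun q _ => this q, hγ.degree hA (hC.eq_one p c)]
        simp [c]
      · simp [c]) u
  rw [hL] at this
  simp only [Finset.sum_boole, Finset.filter_univ_mem] at this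
  split_ifs at this ⊢ <;> linarith

theorem mono (hC : IsComponentUnion A γ C) {C' : Finset W} (hsub : C' ⊆ C)
    (h : ∀ p ∈ C', ∀ q ∈ C, γ p = 1 → γ q = 1 → A p q = 1 → q ∈ C') :
    IsComponentUnion A γ C' where
  eq_one p hp := hC.eq_one p (hsub hp)
  closed p hp q hq hpq := h p hp q (hC.closed p (hsub hp) q hq hpq) (hC.eq_one p (hsub hp)) hq hpq

theorem restrict (hA : IsSRGMatrix A) (hC : IsComponentUnion A γ C) {c : ℤ} {σ : W → ℤ}
    (hσ : IsLocalEigen A γ c σ) : IsLocalEigen A γ c fun t => if t ∈ C then σ t else 0 where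
  support t ht := if_neg fun d => ht (hC.eq_one t d)
  nbrSum_eq p hp := by
    have h := hσ.nbrSum_eq p hp
    by_cases d : p ∈ C
    · simp only [d, if_true]
      rw [← h]
      refine Finset.sum_congr rfl fun q _ => ?_
      rcases hA.zero_or_one p q with e | e
      · simp [e]
      · by_cases f : γ q = 1
        · simp [hC.closed p d q f e]
        · simp [hσ.support q f]
    · simp only [d, if_false, mul_zero]
      refine Finset.sum_eq_zero fun q _ => ?_
      by_cases f : q ∈ C
      · rcases hA.zero_or_one p q with e | e
        · simp [e]
        · exact absurd (hC.closed q f p hp (by rw [hA.symm, e])) d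
      · simp [f]

end IsComponentUnion

end

section

variable {W : Type*} [Fintype W] [DecidableEq W]

theorem IsBalanced.localEigen_adj_three {A : W → W → ℤ} {γ : W → ℤ} (hA : IsSRGMatrix A)
    (hγ : IsBalanced A γ) {φ : W → ℤ} (hφ : IsLocalEigen A γ 3 φ) {p q : W} (hp : γ p = 1)
    (hq : γ q = 1) (hpq : A p q = 1) : φ p = φ q := by
  simpa using hγ.localEigen_adj hA (e := 1) (φ := φ) (by norm_num) (by simpa using hφ) hp hq hpq

theorem IsBalanced.localEigen_adj_neg {A : W → W → ℤ} {γ : W → ℤ} (hA : IsSRGMatrix A)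
    (hγ : IsBalanced A γ) {φ : W → ℤ} (hφ : IsLocalEigen A γ (-3) φ) {p q : W} (hp : γ p = 1)
    (hq : γ q = 1) (hpq : A p q = 1) : φ p = -φ q := by
  simpa using hγ.localEigen_adj hA (e := -1) (φ := φ) (by norm_num) (by simpa using hφ) hp hq hpq

theorem sum_subtype_of_support (P : W → Prop) [DecidablePred P] {f : W → ℤ}
    (hf : ∀ t, ¬ P t → f t = 0) : ∑ i : {t // P t}, f i = ∑ t, f t := by
  rw [← Finset.sum_subtype (univ.filter P) (by simp) f]
  refine Finset.sum_subset (Finset.subset_univ _) fun t _ ht => hf t ?_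
  simpa using ht

namespace IsComponentUnion

variable {A : W → W → ℤ} {γ : W → ℤ} {C : Finset W}

theorem filter_eq (hA : IsSRGMatrix A) (hγ : IsBalanced A γ) (hC : IsComponentUnion A γ C)
    {φ : W → ℤ} (hφ : IsLocalEigen A γ 3 φ) (c : ℤ) :
    IsComponentUnion A γ (C.filter fun p => φ p = c) :=
  hC.mono (Finset.filter_subset _ _) fun p hp q hq h1 h2 h3 => by
    rw [Finset.mem_filter] at hp ⊢
    refine ⟨hq, ?_⟩
    rw [← hp.2, hγ.localEigen_adj_three hA hφ h1 h2 h3]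

theorem filter_ne (hA : IsSRGMatrix A) (hγ : IsBalanced A γ) (hC : IsComponentUnion A γ C)
    {φ : W → ℤ} (hφ : IsLocalEigen A γ 3 φ) (c : ℤ) :
    IsComponentUnion A γ (C.filter fun p => ¬ φ p = c) :=
  hC.mono (Finset.filter_subset _ _) fun p hp q hq h1 h2 h3 => by
    rw [Finset.mem_filter] at hp ⊢
    refine ⟨hq, ?_⟩
    rw [hγ.localEigen_adj_three hA hφ h1 h2 h3] at hp
    exact hp.2

theorem univ_filter (A : W → W → ℤ) (γ : W → ℤ) :
    IsComponentUnion A γ (univ.filter fun p => γ p = 1) where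
  eq_one p hp := by simpa using hp
  closed p _ q hq _ := by simpa using hq

end IsComponentUnion

namespace IsBalanced

variable {A : W → W → ℤ} {γ : W → ℤ}

theorem exists_eq_zero (hA : IsSRGMatrix A) (hγ : IsBalanced A γ) : ∃ w, γ w = 0 := by
  by_contra! hne
  have : ∑ t, γ t ^ 2 = ∑ _t : W, 1 := Finset.sum_congr rfl fun t _ => by
    rcases hγ.values t with e | e | e
    · simp [e]
    · exact absurd e (hne t)
    · simp [e]
  rw [hγ.sum_sq_eq hA, hA.sum_const] at this
  norm_num at this

theorem card_filter_eq_one (hA : IsSRGMatrix A) (hγ : IsBalanced A γ) :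
    (univ.filter fun p => γ p = 1).card = 54 := by
  have h1 : ∑ t, 2 * (if γ t = 1 then (1 : ℤ) else 0) = 108 := by
    simp only [hγ.two_mul_ite, Finset.sum_add_distrib, hγ.sum_sq_eq hA, hγ.sum_eq_zero hA]
    norm_num
  rw [← Finset.mul_sum, Finset.sum_boole] at h1
  have : (((univ.filter fun p => γ p = 1).card : ℕ) : ℤ) = 54 := by linarith
  exact_mod_cast this

theorem six_dvd_card (hA : IsSRGMatrix A) (hγ : IsBalanced A γ) {C : Finset W}
    (hC : IsComponentUnion A γ C) : 6 ∣ C.card := by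
  obtain ⟨w, hw⟩ := hγ.exists_eq_zero hA
  have h := hC.six_mul_sum hA hγ w
  have hwC : w ∉ C := fun c => by have := hC.eq_one w c; omega
  simp only [hw, hwC, if_false, sub_zero, mul_one, zero_add] at h
  omega

/-- If some nonzero function on `γ = -1` has vanishing neighbour sums on `γ = 1`, then there is a
nonzero eigenvector of total zero for the eigenvalue `3` on `γ = 1`. -/
theorem exists_localEigen (hA : IsSRGMatrix A) (hγ : IsBalanced A γ) {η : W → ℤ}
    (h0 : ∀ t, γ t ≠ -1 → η t = 0) (hη : η ≠ 0) (h1 : ∀ u, γ u = 1 → nbrSum A η u = 0) :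
    ∃ φ : W → ℤ, φ ≠ 0 ∧ IsLocalEigen A γ 3 φ ∧ ∑ t, φ t = 0 := by
  have hcard : Fintype.card {u // γ u = 1} = Fintype.card {u // γ u = -1} := by
    rw [Fintype.card_subtype, Fintype.card_subtype, hγ.card_filter_eq_one hA,
      ← hγ.neg.card_filter_eq_one hA]
    congr 1
    ext t
    simp only [Finset.mem_filter, Finset.mem_univ, true_and]
    omega
  let e := Fintype.equivOfCardEq hcard
  let M : Matrix {u // γ u = 1} {u // γ u = 1} ℤ := Matrix.of fun p q => A p (e q)
  have hdet : M.det = 0 := by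
    rw [← Matrix.exists_mulVec_eq_zero_iff]
    refine ⟨fun q => η (e q), ?_, ?_⟩
    · intro h
      apply hη
      ext t
      by_cases c : γ t = -1
      · have := congrFun h (e.symm ⟨t, c⟩)
        simpa using this
      · simpa using h0 t c
    · ext p
      have h2 := h1 p p.2
      simp only [Matrix.mulVec, dotProduct, M, Matrix.of_apply, Pi.zero_apply]
      rw [e.sum_comp (fun r : {u // γ u = -1} => A p r * η r), ← h2, nbrSum]
      exact sum_subtype_of_support (fun t => γ t = -1) (f := fun t => A p t * η t)
        fun t ht => by rw [h0 t ht, mul_zero]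
  rw [← Matrix.exists_vecMul_eq_zero_iff] at hdet
  obtain ⟨f, hf0, hf⟩ := hdet
  let φ : W → ℤ := fun t => if c : γ t = 1 then f ⟨t, c⟩ else 0
  have hφ0 : ∀ t, γ t ≠ 1 → φ t = 0 := fun t ht => dif_neg ht
  have hφ1 : ∀ u, γ u = -1 → nbrSum A φ u = 0 := by
    intro u hu
    have h2 := congrFun hf (e.symm ⟨u, hu⟩)
    simp only [Matrix.vecMul, dotProduct, M, Matrix.of_apply, Pi.zero_apply,
      Equiv.apply_symm_apply] at h2
    rw [nbrSum, ← sum_subtype_of_support (fun t => γ t = 1) (f := fun t => A u t * φ t)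
      fun t ht => by rw [hφ0 t ht, mul_zero], ← h2]
    refine Finset.sum_congr rfl fun i _ => ?_
    simp only [φ, i.2, dif_pos, hA.symm u i]
    ring
  have hB := hγ.sum_mul_nbrSum_mul_nbrSum hA φ φ
  have hγφ : ∑ t, γ t * φ t = ∑ t, φ t := Finset.sum_congr rfl fun t _ => by
    by_cases c : γ t = 1
    · rw [c, one_mul]
    · rw [hφ0 t c, mul_zero]
  have hnn : ∀ t, γ t * ((nbrSum A φ t - 3 * φ t) * (nbrSum A φ t - 3 * φ t)) =
      if γ t = 1 then (nbrSum A φ t - 3 * φ t) ^ 2 else 0 := by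
    intro t
    rcases hγ.values t with c | c | c
    · simp [c, hφ1 t c, hφ0 t (by omega)]
    · simp [c]
    · simp [c]; ring
  simp only [hnn, hγφ] at hB
  have hge : ∀ t, 0 ≤ if γ t = 1 then (nbrSum A φ t - 3 * φ t) ^ 2 else 0 := fun t => by
    split_ifs <;> positivity
  have hge' := Finset.sum_nonneg fun t (_ : t ∈ univ) => hge t
  have hsum : ∑ t, φ t = 0 := by nlinarith
  refine ⟨φ, ?_, ⟨hφ0, fun t ht => ?_⟩, hsum⟩
  · intro h
    apply hf0
    ext ⟨t, ht⟩
    have := congrFun h t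
    simpa [φ, ht] using this
  · rw [hsum] at hB
    simp only [mul_zero, add_zero] at hB
    rw [Finset.sum_eq_zero_iff_of_nonneg fun t _ => hge t] at hB
    have := hB t (Finset.mem_univ t)
    rw [if_pos ht] at this
    have := pow_eq_zero_iff (two_ne_zero) |>.1 this
    linarith

theorem exists_odd_componentUnion (hA : IsSRGMatrix A) (hγ : IsBalanced A γ) {η : W → ℤ}
    (h0 : ∀ t, γ t ≠ -1 → η t = 0) (hη : η ≠ 0) (h1 : ∀ u, γ u = 1 → nbrSum A η u = 0) :
    ∃ C k, IsComponentUnion A γ C ∧ C.card = 6 * k ∧ Odd k ∧ k < 9 := by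
  obtain ⟨φ, hφ0, hφ, hsum⟩ := hγ.exists_localEigen hA h0 hη h1
  obtain ⟨p, hp⟩ := Function.ne_iff.1 hφ0
  have hp1 : γ p = 1 := by
    by_contra c
    exact hp (hφ.support p c)
  have hD := IsComponentUnion.univ_filter A γ
  have hC1 := hD.filter_eq hA hγ hφ (φ p)
  have hC2 := hD.filter_ne hA hγ hφ (φ p)
  have hcard := Finset.card_filter_add_card_filter_not (s := univ.filter fun t => γ t = 1)
    (fun t => φ t = φ p)
  rw [hγ.card_filter_eq_one hA] at hcard
  obtain ⟨k1, hk1⟩ := hγ.six_dvd_card hA hC1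
  obtain ⟨k2, hk2⟩ := hγ.six_dvd_card hA hC2
  have hk1' : k1 ≠ 0 := by
    rintro rfl
    rw [mul_zero, Finset.card_eq_zero] at hk1
    have : p ∈ (univ.filter fun t => γ t = 1).filter fun t => φ t = φ p := by simp [hp1]
    rw [hk1] at this
    simp at this
  have hk2' : k2 ≠ 0 := by
    rintro rfl
    rw [mul_zero, Finset.card_eq_zero] at hk2
    have hall : ∀ t, γ t = 1 → φ t = φ p := by
      intro t ht
      by_contra c
      have : t ∈ (univ.filter fun t => γ t = 1).filter fun t => ¬ φ t = φ p := by simp [ht, c]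
      rw [hk2] at this
      simp at this
    have : ∑ t, φ t = ∑ t, φ p * if γ t = 1 then 1 else 0 := Finset.sum_congr rfl fun t _ => by
      by_cases c : γ t = 1
      · simp [c, hall t c]
      · simp [c, hφ.support t c]
    rw [hsum, ← Finset.mul_sum, Finset.sum_boole, hγ.card_filter_eq_one hA] at this
    exact hp (by simpa using this)
  rw [hk1, hk2] at hcard
  rcases Nat.even_or_odd k1 with h | h
  · refine ⟨_, k2, hC2, hk2, ?_, by omega⟩
    rw [Nat.odd_iff]
    rw [Nat.even_iff] at h
    omega
  · exact ⟨_, k1, hC1, hk1, h, by omega⟩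

end IsBalanced

/-- The vertices `x 0, x 1, x 2` and `a 0, a 1, a 2` are the two sides of a `K₃,₃`. -/
structure IsK33 (A : W → W → ℤ) (x a : Fin 3 → W) : Prop where
  inj_left : Function.Injective x
  inj_right : Function.Injective a
  adj : ∀ i j, A (x i) (a j) = 1

/-- The number of adjacencies to `z`, corrected by `-3` at `z` itself. -/
def shifted (A : W → W → ℤ) (z u : W) : ℤ := A z u - if u = z then 3 else 0

/-- The function attached to a `K₃,₃`. -/
def k33Fun (A : W → W → ℤ) (x a : Fin 3 → W) (u : W) : ℤ :=
  ∑ i, shifted A (x i) u + ∑ j, shifted A (a j) u - 1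

theorem k33Fun_swap (A : W → W → ℤ) (x a : Fin 3 → W) : k33Fun A x a = k33Fun A a x := by
  ext u
  simp only [k33Fun]; ring

/-- The number of neighbours of a vertex among `x 0, x 1, x 2`. -/
def sideDeg (A : W → W → ℤ) (x : Fin 3 → W) (u : W) : ℤ := ∑ i, A (x i) u

theorem IsSRGMatrix.sum_mul_shifted {A : W → W → ℤ} (hA : IsSRGMatrix A) (u v z : W) :
    ∑ t, A u t * A v t * shifted A z t =
      (3 - 3 * shifted A z u - 3 * shifted A z v) * (1 - A u v) +
        if u = v then 9 - 9 * shifted A z u else 0 := by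
  have e : ∑ t, A u t * A v t * shifted A z t =
      ∑ t, A u t * A v t * A z t - 3 * (A u z * A v z) := by
    simp only [shifted, mul_sub, Finset.sum_sub_distrib, mul_ite, mul_zero, Finset.sum_ite_eq',
      Finset.mem_univ, if_true]
    ring
  rw [e]
  by_cases huv : u = v
  · subst huv
    simp only [hA.sq, hA.sum_mul, shifted, hA.loopless, hA.symm z u, if_true]
    split_ifs <;> ring
  · rcases hA.zero_or_one u v with c | c
    · rw [hA.sum_mul_mul huv c, if_neg huv, c]
      simp only [shifted, hA.symm z u, hA.symm z v, eq_comm (a := z)]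
      split_ifs <;> ring
    · have h0 : ∀ t, A u t * A v t = 0 := fun t => by
        linear_combination (-A u t * A v t) * c + hA.mul_triangle u v t
      simp [h0, huv, c]

namespace IsK33

variable {A : W → W → ℤ} {x a : Fin 3 → W}

theorem swap (hA : IsSRGMatrix A) (hK : IsK33 A x a) : IsK33 A a x where
  inj_left := hK.inj_right
  inj_right := hK.inj_left
  adj i j := by rw [hA.symm, hK.adj]

theorem nonadj (hA : IsSRGMatrix A) (hK : IsK33 A x a) (i j : Fin 3) : A (x i) (x j) = 0 :=
  hA.triangle_free _ _ _ (hK.adj i 0) (by rw [hA.symm, hK.adj])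

theorem ne (hA : IsSRGMatrix A) (hK : IsK33 A x a) (i j : Fin 3) : x i ≠ a j :=
  hA.ne_of_adj (hK.adj i j)

/-- The only common neighbours of one side are the vertices of the other side. -/
theorem eq_of_adj (hA : IsSRGMatrix A) (hK : IsK33 A x a) {u : W} (hu : ∀ i, A (x i) u = 1) :
    ∃ j, u = a j := by
  by_contra! hne
  have h1 := hA.sum_mul_mul (hK.inj_left.ne (show (0 : Fin 3) ≠ 1 by decide))
    (hK.nonadj hA 0 1) (x 2)
  rw [if_neg (hK.inj_left.ne (by decide)), if_neg (hK.inj_left.ne (by decide)),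
    hK.nonadj hA, hK.nonadj hA] at h1
  have h2 : ∑ t ∈ insert u (univ.image a), A (x 0) t * A (x 1) t * A (x 2) t ≤
      ∑ t, A (x 0) t * A (x 1) t * A (x 2) t :=
    Finset.sum_le_sum_of_subset_of_nonneg (Finset.subset_univ _) fun t _ _ =>
      mul_nonneg (mul_nonneg (hA.nonneg _ _) (hA.nonneg _ _)) (hA.nonneg _ _)
  rw [Finset.sum_insert (by simpa using fun j => (hne j).symm),
    Finset.sum_image fun _ _ _ _ h => hK.inj_right h, h1] at h2
  simp [hu, hK.adj] at h2

theorem sideDeg_left (hA : IsSRGMatrix A) (hK : IsK33 A x a) (i : Fin 3) :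
    sideDeg A x (x i) = 0 := by simp [sideDeg, hK.nonadj hA]

theorem sideDeg_right (hK : IsK33 A x a) (j : Fin 3) : sideDeg A x (a j) = 3 := by
  simp [sideDeg, hK.adj]

theorem fun_left (hA : IsSRGMatrix A) (hK : IsK33 A x a) (i : Fin 3) :
    k33Fun A x a (x i) = -1 := by
  have h1 := hK.sideDeg_left hA i
  have h2 := (hK.swap hA).sideDeg_right i
  simp only [sideDeg] at h1 h2
  simp [k33Fun, shifted, h1, h2, hK.ne hA, hK.inj_left.eq_iff, Finset.sum_sub_distrib]

theorem fun_right (hA : IsSRGMatrix A) (hK : IsK33 A x a) (j : Fin 3) :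
    k33Fun A x a (a j) = -1 := by
  rw [k33Fun_swap, (hK.swap hA).fun_left hA]

theorem fun_of_ne (hx : ∀ i, u ≠ x i) (ha : ∀ j, u ≠ a j) :
    k33Fun A x a u = sideDeg A x u + sideDeg A a u - 1 := by
  simp [k33Fun, shifted, sideDeg, hx, ha]

theorem sideDeg_mul (hA : IsSRGMatrix A) (hK : IsK33 A x a) (u : W) :
    sideDeg A x u = 0 ∨ sideDeg A a u = 0 := by
  by_cases h : ∃ i, A (x i) u = 1
  · right
    obtain ⟨i, hi⟩ := h
    refine Finset.sum_eq_zero fun j _ => ?_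
    rw [hA.symm]
    exact hA.triangle_free u (x i) (a j) (by rw [hA.symm, hi]) (hK.adj i j)
  · left
    push Not at h
    exact Finset.sum_eq_zero fun i _ => (hA.zero_or_one _ _).resolve_right (h i)

theorem sideDeg_nonneg (hA : IsSRGMatrix A) (x : Fin 3 → W) (u : W) : 0 ≤ sideDeg A x u :=
  Finset.sum_nonneg fun _ _ => hA.nonneg _ _

theorem sideDeg_le (hA : IsSRGMatrix A) (hK : IsK33 A x a) {u : W} (ha : ∀ j, u ≠ a j) :
    sideDeg A x u ≤ 2 := by
  by_contra! h
  simp only [sideDeg, Fin.sum_univ_three] at h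
  have h0 := hA.le_one (x 0) u
  have h1 := hA.le_one (x 1) u
  have h2 := hA.le_one (x 2) u
  obtain ⟨j, hj⟩ := hK.eq_of_adj hA (u := u) fun i => by
    fin_cases i <;> simp only [Fin.zero_eta, Fin.mk_one, Fin.reduceFinMk] <;> omega
  exact ha j hj

theorem cases_of (hA : IsSRGMatrix A) (hK : IsK33 A x a) (u : W) :
    (∃ i, u = x i) ∨ (∃ j, u = a j) ∨
      ((∀ i, u ≠ x i) ∧ (∀ j, u ≠ a j) ∧ k33Fun A x a u = sideDeg A x u + sideDeg A a u - 1 ∧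
        (sideDeg A x u = 0 ∨ sideDeg A a u = 0) ∧ 0 ≤ sideDeg A x u ∧ 0 ≤ sideDeg A a u ∧
        sideDeg A x u ≤ 2 ∧ sideDeg A a u ≤ 2) := by
  by_cases hx : ∃ i, u = x i
  · exact Or.inl hx
  by_cases ha : ∃ j, u = a j
  · exact Or.inr (Or.inl ha)
  push Not at hx ha
  exact Or.inr (Or.inr ⟨hx, ha, fun_of_ne hx ha, hK.sideDeg_mul hA u, sideDeg_nonneg hA x u,
    sideDeg_nonneg hA a u, hK.sideDeg_le hA ha, (hK.swap hA).sideDeg_le hA hx⟩)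

theorem isBalanced (hA : IsSRGMatrix A) (hK : IsK33 A x a) : IsBalanced A (k33Fun A x a) := by
  have hpair : ∀ u v, ∑ t, A u t * A v t * k33Fun A x a t =
      -3 * (k33Fun A x a u + k33Fun A x a v) * (1 - A u v) -
        if u = v then 9 * k33Fun A x a u else 0 := by
    intro u v
    have e : ∑ t, A u t * A v t * k33Fun A x a t =
        ∑ i, ∑ t, A u t * A v t * shifted A (x i) t +
        ∑ j, ∑ t, A u t * A v t * shifted A (a j) t - ∑ t, A u t * A v t := by
      simp only [k33Fun, mul_sub, mul_add, Finset.sum_sub_distrib, Finset.sum_add_distrib,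
        Finset.mul_sum, mul_one]
      rw [Finset.sum_comm, Finset.sum_comm (s := (univ : Finset (Fin 3)))]
      congr 2
      rw [Finset.sum_comm]
    rw [e, hA.sum_mul]
    simp only [hA.sum_mul_shifted, k33Fun, Fin.sum_univ_three]
    split_ifs <;> ring
  refine ⟨fun u => ?_, hpair, fun u => ?_⟩
  · rcases hK.cases_of hA u with ⟨i, rfl⟩ | ⟨j, rfl⟩ | ⟨-, -, h⟩
    · exact Or.inl (hK.fun_left hA i)
    · exact Or.inl (hK.fun_right hA j)
    · omega
  · have hz : ∀ z, k33Fun A x a z = -1 → ∑ t, A u t * k33Fun A x a t * shifted A z t =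
        -3 * (k33Fun A x a u - 1) + 3 * k33Fun A x a u * shifted A z u := by
      intro z hz
      have e : ∑ t, A u t * k33Fun A x a t * shifted A z t =
          ∑ t, A u t * A z t * k33Fun A x a t - 3 * (A u z * k33Fun A x a z) := by
        simp only [shifted, mul_sub, Finset.sum_sub_distrib, mul_ite, mul_zero,
          Finset.sum_ite_eq', Finset.mem_univ, if_true]
        congr 1
        · exact Finset.sum_congr rfl fun _ _ => by ring
        · ring
      rw [e, hpair, hz]
      simp only [shifted, hA.symm z u]
      split_ifs <;> ring
    have hL := hpair u u
    simp only [hA.sq, hA.loopless, if_true] at hL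
    have e : ∑ t, A u t * k33Fun A x a t ^ 2 =
        ∑ i, ∑ t, A u t * k33Fun A x a t * shifted A (x i) t +
        ∑ j, ∑ t, A u t * k33Fun A x a t * shifted A (a j) t - ∑ t, A u t * k33Fun A x a t := by
      have e1 : ∀ t, A u t * k33Fun A x a t ^ 2 =
        ∑ i, A u t * k33Fun A x a t * shifted A (x i) t +
        ∑ j, A u t * k33Fun A x a t * shifted A (a j) t - A u t * k33Fun A x a t := fun t => by
        rw [← Finset.mul_sum, ← Finset.mul_sum]
        have : k33Fun A x a t = ∑ i, shifted A (x i) t + ∑ j, shifted A (a j) t - 1 := rfl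
        linear_combination A u t * k33Fun A x a t * this
      simp only [e1, Finset.sum_sub_distrib, Finset.sum_add_distrib]
      congr 2 <;> rw [Finset.sum_comm]
    rw [e, hL]
    simp only [hz _ (hK.fun_left hA _), hz _ (hK.fun_right hA _), Finset.sum_add_distrib,
      ← Finset.mul_sum]
    have : k33Fun A x a u = ∑ i, shifted A (x i) u + ∑ j, shifted A (a j) u - 1 := rfl
    simp only [Finset.sum_const, Finset.card_univ, Fintype.card_fin, nsmul_eq_mul]
    push_cast
    linear_combination (-3 * k33Fun A x a u) * this

end IsK33

end

section

variable {W : Type*} [Fintype W] [DecidableEq W]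

/-- The vertices of `γ = -1` outside the `K₃,₃`. -/
def farSet (A : W → W → ℤ) (x a : Fin 3 → W) : Finset W :=
  univ.filter fun h => k33Fun A x a h = -1 ∧ sideDeg A x h = 0 ∧ sideDeg A a h = 0

/-- The sign on `γ = 1` telling to which side of the `K₃,₃` a vertex is adjacent. -/
def sideSign (A : W → W → ℤ) (x a : Fin 3 → W) (u : W) : ℤ :=
  if k33Fun A x a u = 1 then (if sideDeg A x u = 0 then 1 else -1) else 0

/-- For a function `σ` with values `±1` on the component union `C`, half of its transfer. -/
def halfTransfer (A : W → W → ℤ) (γ : W → ℤ) (C : Finset W) (k : ℕ) (σ : W → ℤ) (h : W) : ℤ :=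
  if γ h = -1 then ∑ t ∈ C, A h t * (if σ t = 1 then 1 else 0) - k else 0

/-- `σ` takes the values `±1` on `C` and vanishes elsewhere. -/
structure IsSigning (C : Finset W) (σ : W → ℤ) : Prop where
  mem : ∀ t ∈ C, σ t = 1 ∨ σ t = -1
  notMem : ∀ t, t ∉ C → σ t = 0

namespace IsSigning

variable {A : W → W → ℤ} {γ : W → ℤ} {C : Finset W} {σ : W → ℤ} {k : ℕ}

theorem sum_mul (hσ : IsSigning C σ) (f : W → ℤ) : ∑ t, f t * σ t = ∑ t ∈ C, f t * σ t :=
  (Finset.sum_subset (Finset.subset_univ _) fun t _ ht => by rw [hσ.notMem t ht, mul_zero]).symm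

theorem nbrSum_eq (hσ : IsSigning C σ) (u : W) : nbrSum A σ u =
    2 * ∑ t ∈ C, A u t * (if σ t = 1 then 1 else 0) - ∑ t ∈ C, A u t := by
  rw [nbrSum, hσ.sum_mul, Finset.mul_sum, ← Finset.sum_sub_distrib]
  refine Finset.sum_congr rfl fun t ht => ?_
  rcases hσ.mem t ht with e | e <;> simp [e]
  ring

theorem two_dvd_nbrSum_sub (hσ : IsSigning C σ) (u : W) :
    2 ∣ nbrSum A σ u - ∑ t ∈ C, A u t :=
  ⟨∑ t ∈ C, A u t * (if σ t = 1 then 1 else 0) - ∑ t ∈ C, A u t, by rw [hσ.nbrSum_eq]; ring⟩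

theorem sum_sq (hσ : IsSigning C σ) : ∑ t, σ t ^ 2 = C.card := by
  simp only [sq]
  rw [hσ.sum_mul, Finset.card_eq_sum_ones]
  push_cast
  refine Finset.sum_congr rfl fun t ht => ?_
  rcases hσ.mem t ht with e | e <;> simp [e]

theorem transfer_eq (hA : IsSRGMatrix A) (hγ : IsBalanced A γ) (hC : IsComponentUnion A γ C)
    (hk : C.card = 6 * k) (hσ : IsSigning C σ) (h : W) :
    transfer A γ σ h = 2 * halfTransfer A γ C k σ h := by
  by_cases c : γ h = -1
  · have h1 := hC.six_mul_sum hA hγ h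
    rw [if_neg fun d => by have := hC.eq_one h d; omega, c, hk] at h1
    simp only [transfer, halfTransfer, c, if_true, hσ.nbrSum_eq]
    push_cast at h1
    linarith
  · simp [transfer, halfTransfer, c]

theorem abs_halfTransfer_le (hA : IsSRGMatrix A) (hγ : IsBalanced A γ)
    (hC : IsComponentUnion A γ C) (hk : C.card = 6 * k) (h : W) :
    |halfTransfer A γ C k σ h| ≤ k := by
  by_cases c : γ h = -1
  · have h1 := hC.six_mul_sum hA hγ h
    rw [if_neg fun d => by have := hC.eq_one h d; omega, c, hk] at h1
    have h2 : 0 ≤ ∑ t ∈ C, A h t * (if σ t = 1 then 1 else 0) :=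
      Finset.sum_nonneg fun t _ => mul_nonneg (hA.nonneg _ _) (by split_ifs <;> norm_num)
    have h3 : ∑ t ∈ C, A h t * (if σ t = 1 then 1 else 0) ≤ ∑ t ∈ C, A h t :=
      Finset.sum_le_sum fun t _ => by
        have := hA.nonneg h t
        split_ifs <;> simp [this]
    simp only [halfTransfer, c, if_true]
    push_cast at h1
    rw [abs_le]
    constructor <;> linarith
  · simp [halfTransfer, c]

theorem isLocalEigen_halfTransfer (hA : IsSRGMatrix A) (hγ : IsBalanced A γ)
    (hC : IsComponentUnion A γ C) (hk : C.card = 6 * k) (hσ : IsSigning C σ)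
    (hL : IsLocalEigen A γ (-3) σ) :
    IsLocalEigen A (fun t => -γ t) (-3) (halfTransfer A γ C k σ) := by
  have h1 := hγ.isLocalEigen_transfer hA hL
  have h2 : transfer A γ σ = fun t => 2 * halfTransfer A γ C k σ t :=
    funext (hσ.transfer_eq hA hγ hC hk)
  rw [h2] at h1
  refine ⟨fun t ht => by simpa using h1.support t ht, fun t ht => ?_⟩
  have h3 := h1.nbrSum_eq t ht
  have h4 : nbrSum A (fun t => 2 * halfTransfer A γ C k σ t) t =
      2 * nbrSum A (halfTransfer A γ C k σ) t := by
    simp only [nbrSum, Finset.mul_sum]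
    exact Finset.sum_congr rfl fun _ _ => by ring
  rw [h4] at h3
  linarith

end IsSigning

theorem IsComponentUnion.isSigning_restrict {A : W → W → ℤ} {γ : W → ℤ} {C : Finset W}
    (hC : IsComponentUnion A γ C) {s : W → ℤ} (hs : ∀ t, γ t = 1 → s t = 1 ∨ s t = -1) :
    IsSigning C fun t => if t ∈ C then s t else 0 where
  mem t ht := by simpa [ht] using hs t (hC.eq_one t ht)
  notMem t ht := if_neg ht

namespace IsK33

variable {A : W → W → ℤ} {x a : Fin 3 → W}

theorem sideDeg_of_fun_eq_one (hA : IsSRGMatrix A) (hK : IsK33 A x a) {u : W}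
    (hu : k33Fun A x a u = 1) :
    (sideDeg A x u = 0 ∧ sideDeg A a u = 2 ∧ sideSign A x a u = 1) ∨
      (sideDeg A x u = 2 ∧ sideDeg A a u = 0 ∧ sideSign A x a u = -1) := by
  rcases hK.cases_of hA u with ⟨i, rfl⟩ | ⟨j, rfl⟩ | ⟨-, -, h1, h2, -⟩
  · rw [hK.fun_left hA] at hu; omega
  · rw [hK.fun_right hA] at hu; omega
  · rw [hu] at h1
    rcases h2 with h2 | h2
    · left
      exact ⟨h2, by omega, by simp [sideSign, hu, h2]⟩
    · right
      have : sideDeg A x u = 2 := by omega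
      exact ⟨this, h2, by simp [sideSign, hu, this]⟩

theorem sideSign_eq (hA : IsSRGMatrix A) (hK : IsK33 A x a) (u : W)
    (hu : k33Fun A x a u = 1) : sideSign A x a u = 1 ∨ sideSign A x a u = -1 := by
  rcases hK.sideDeg_of_fun_eq_one hA hu with h | h
  · exact Or.inl h.2.2
  · exact Or.inr h.2.2

theorem sideSign_swap (hA : IsSRGMatrix A) (hK : IsK33 A x a) (u : W) :
    sideSign A a x u = -sideSign A x a u := by
  by_cases hu : k33Fun A x a u = 1
  · have hu' : k33Fun A a x u = 1 := by rw [k33Fun_swap, hu]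
    rcases hK.sideDeg_of_fun_eq_one hA hu with h | h <;>
      rcases (hK.swap hA).sideDeg_of_fun_eq_one hA hu' with h' | h' <;> omega
  · simp [sideSign, hu, k33Fun_swap A a x]

theorem sideSign_of_adj_left (hA : IsSRGMatrix A) (hK : IsK33 A x a) {p : W} {i : Fin 3}
    (hp : k33Fun A x a p = 1) (h : A (x i) p = 1) : sideSign A x a p = -1 := by
  rcases hK.sideDeg_of_fun_eq_one hA hp with h' | h'
  · have := Finset.single_le_sum (f := fun i => A (x i) p) (fun i _ => hA.nonneg _ _)
      (Finset.mem_univ i)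
    have h2 := h'.1
    simp only [sideDeg] at h2
    omega
  · exact h'.2.2

theorem sideSign_of_adj_right (hA : IsSRGMatrix A) (hK : IsK33 A x a) {p : W} {j : Fin 3}
    (hp : k33Fun A x a p = 1) (h : A (a j) p = 1) : sideSign A x a p = 1 := by
  have := (hK.swap hA).sideSign_of_adj_left hA (by rwa [k33Fun_swap]) h
  have := hK.sideSign_swap hA p
  omega

theorem exists_common_of_sideDeg (hA : IsSRGMatrix A) {p q : W} (hp : sideDeg A x p = 2)
    (hq : sideDeg A x q = 2) : ∃ i, A (x i) p = 1 ∧ A (x i) q = 1 := by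
  by_contra! h
  have : ∀ i, A (x i) p + A (x i) q ≤ 1 := fun i => by
    have h1 := hA.le_one (x i) q
    rcases hA.zero_or_one (x i) p with c | c
    · omega
    · rcases hA.zero_or_one (x i) q with d | d
      · omega
      · exact absurd d (h i c)
  have h2 : ∑ i, (A (x i) p + A (x i) q) ≤ ∑ _i : Fin 3, 1 := Finset.sum_le_sum fun i _ => this i
  rw [Finset.sum_add_distrib] at h2
  simp only [sideDeg] at hp hq
  rw [hp, hq] at h2
  simp at h2

theorem sideSign_adj (hA : IsSRGMatrix A) (hK : IsK33 A x a) (p q : W)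
    (hp : k33Fun A x a p = 1) (hq : k33Fun A x a q = 1) (hpq : A p q = 1) :
    sideSign A x a q = -1 * sideSign A x a p := by
  have key : ∀ {y : Fin 3 → W}, sideDeg A y p = 2 → sideDeg A y q = 2 → False := by
    intro y h1 h2
    obtain ⟨i, hi, hj⟩ := exists_common_of_sideDeg hA h1 h2
    have := hA.triangle_free _ _ _ hi hpq
    omega
  rcases hK.sideDeg_of_fun_eq_one hA hp with h | h <;>
    rcases hK.sideDeg_of_fun_eq_one hA hq with h' | h'
  · exact (key h.2.1 h'.2.1).elim
  · omega
  · omega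
  · exact (key h.1 h'.1).elim

theorem isLocalEigen_sideSign (hA : IsSRGMatrix A) (hK : IsK33 A x a) :
    IsLocalEigen A (k33Fun A x a) (-3) (sideSign A x a) := by
  have := (hK.isBalanced hA).isLocalEigen_of_adj hA (φ := sideSign A x a) (e := -1)
    (fun t ht => if_neg ht) (hK.sideSign_adj hA)
  simpa using this

/-- A sum over `γ = -1` splits into the sum over the `K₃,₃` and the sum over the far vertices. -/
theorem sum_of_support (hA : IsSRGMatrix A) (hK : IsK33 A x a) {f : W → ℤ}
    (hf : ∀ t, k33Fun A x a t ≠ -1 → f t = 0) :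
    ∑ t, f t = ∑ t ∈ farSet A x a, f t + ∑ i, f (x i) + ∑ j, f (a j) := by
  have : ∀ t, f t = (if t ∈ farSet A x a then f t else 0) + ∑ i, (if t = x i then f t else 0)
      + ∑ j, (if t = a j then f t else 0) := by
    intro t
    rcases hK.cases_of hA t with ⟨i, rfl⟩ | ⟨j, rfl⟩ | ⟨h1, h2, h3, -, h4, h5, -⟩
    · have : x i ∉ farSet A x a := by simp [farSet, (hK.swap hA).sideDeg_right]
      simp [this, hK.ne hA, hK.inj_left.eq_iff]
    · have : a j ∉ farSet A x a := by simp [farSet, hK.sideDeg_right]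
      simp [this, fun i => (hK.ne hA i j).symm, hK.inj_right.eq_iff]
    · simp only [h1, h2, if_false, Finset.sum_const_zero, add_zero]
      split_ifs with h
      · rfl
      · refine hf t fun c => h ?_
        simp only [farSet, Finset.mem_filter, Finset.mem_univ, true_and]
        omega
  rw [Finset.sum_congr rfl fun t _ => this t]
  simp only [Finset.sum_add_distrib]
  rw [Finset.sum_comm (t := (univ : Finset (Fin 3))), Finset.sum_comm (t := (univ : Finset (Fin 3)))]
  simp

theorem isComponentUnion_farSet (hA : IsSRGMatrix A) (hK : IsK33 A x a) :
    IsComponentUnion A (fun t => -k33Fun A x a t) (farSet A x a) where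
  eq_one p hp := by
    simp only [farSet, Finset.mem_filter] at hp
    omega
  closed p hp q hq hpq := by
    simp only [farSet, Finset.mem_filter, Finset.mem_univ, true_and] at hp ⊢
    have key : ∀ {y : Fin 3 → W}, sideDeg A y p = 0 → ∀ i, q ≠ y i := by
      rintro y hy i rfl
      have := (Finset.sum_eq_zero_iff_of_nonneg fun i _ => hA.nonneg (y i) p).1 hy i
        (Finset.mem_univ i)
      rw [hA.symm] at this
      omega
    rcases hK.cases_of hA q with ⟨i, rfl⟩ | ⟨j, rfl⟩ | ⟨h1, h2, h3, -, h4, h5, -⟩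
    · exact absurd rfl (key hp.2.1 i)
    · exact absurd rfl (key hp.2.2 j)
    · omega

theorem card_farSet (hA : IsSRGMatrix A) (hK : IsK33 A x a) : (farSet A x a).card = 48 := by
  have h1 := hK.sum_of_support hA (f := fun t => if -k33Fun A x a t = 1 then 1 else 0)
    fun t ht => if_neg (by omega)
  rw [Finset.sum_boole, (hK.isBalanced hA).neg.card_filter_eq_one hA,
    Finset.sum_congr rfl fun t ht => if_pos ((hK.isComponentUnion_farSet hA).eq_one t ht)] at h1
  simp only [hK.fun_left hA, hK.fun_right hA] at h1
  norm_num at h1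
  omega

section component

variable {C : Finset W} {k : ℕ}

theorem isSigning (hA : IsSRGMatrix A) (hK : IsK33 A x a)
    (hC : IsComponentUnion A (k33Fun A x a) C) :
    IsSigning C fun t => if t ∈ C then sideSign A x a t else 0 :=
  hC.isSigning_restrict (hK.sideSign_eq hA)

theorem nbrSum_restrict_right (hA : IsSRGMatrix A) (hK : IsK33 A x a)
    (hC : IsComponentUnion A (k33Fun A x a) C) (hk : C.card = 6 * k) (j : Fin 3) :
    nbrSum A (fun t => if t ∈ C then sideSign A x a t else 0) (a j) = 2 * k := by
  have h1 := hC.six_mul_sum hA (hK.isBalanced hA) (a j)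
  rw [if_neg fun d => by have := hC.eq_one _ d; rw [hK.fun_right hA] at this; omega,
    hK.fun_right hA, hk] at h1
  have h2 : nbrSum A (fun t => if t ∈ C then sideSign A x a t else 0) (a j) =
      ∑ t ∈ C, A (a j) t := by
    simp only [nbrSum, mul_ite, mul_zero, Finset.sum_ite_mem, Finset.univ_inter]
    refine Finset.sum_congr rfl fun t ht => ?_
    rcases hA.zero_or_one (a j) t with c | c
    · simp [c]
    · rw [hK.sideSign_of_adj_right hA (hC.eq_one t ht) c, mul_one]
  push_cast at h1
  linarith

theorem nbrSum_restrict_left (hA : IsSRGMatrix A) (hK : IsK33 A x a)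
    (hC : IsComponentUnion A (k33Fun A x a) C) (hk : C.card = 6 * k) (i : Fin 3) :
    nbrSum A (fun t => if t ∈ C then sideSign A x a t else 0) (x i) = -(2 * k) := by
  have h := (hK.swap hA).nbrSum_restrict_right hA (C := C) (by rwa [k33Fun_swap]) hk i
  rw [← h]
  simp only [hK.sideSign_swap hA, nbrSum, ← Finset.sum_neg_distrib]
  exact Finset.sum_congr rfl fun t _ => by split_ifs <;> ring

theorem sum_sq_farSet (hA : IsSRGMatrix A) (hK : IsK33 A x a)
    (hC : IsComponentUnion A (k33Fun A x a) C) (hk : C.card = 6 * k) :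
    ∑ h ∈ farSet A x a, nbrSum A (fun t => if t ∈ C then sideSign A x a t else 0) h ^ 2 =
      24 * k * (9 - k) := by
  set σ : W → ℤ := fun t => if t ∈ C then sideSign A x a t else 0 with hσ
  have h1 := (hK.isBalanced hA).sum_sq_transfer hA (σ := σ)
    (hC.restrict hA (hK.isLocalEigen_sideSign hA))
  rw [(hK.isSigning hA hC).sum_sq, hk] at h1
  rw [hK.sum_of_support hA (fun t ht => by simp [transfer, ht])] at h1
  have h2 : ∀ t, k33Fun A x a t = -1 → transfer A (k33Fun A x a) σ t = nbrSum A σ t :=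
    fun t ht => if_pos ht
  rw [Finset.sum_congr rfl fun t ht => by
    rw [h2 t (by have := (hK.isComponentUnion_farSet hA).eq_one t ht; omega)]] at h1
  have h3 : ∀ i, transfer A (k33Fun A x a) σ (x i) = -(2 * k) := fun i => by
    rw [h2 _ (hK.fun_left hA i), hK.nbrSum_restrict_left hA hC hk]
  have h4 : ∀ j, transfer A (k33Fun A x a) σ (a j) = 2 * k := fun j => by
    rw [h2 _ (hK.fun_right hA j), hK.nbrSum_restrict_right hA hC hk]
  simp only [h3, h4] at h1
  simp only [Finset.sum_const, Finset.card_univ, Fintype.card_fin, nsmul_eq_mul] at h1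
  push_cast at h1
  linear_combination h1

theorem nbrSum_sideSign_farSet (hA : IsSRGMatrix A) (hK : IsK33 A x a) {h : W}
    (hh : h ∈ farSet A x a) : nbrSum A (sideSign A x a) h = 0 := by
  have h1 := hK.sum_sq_farSet hA (IsComponentUnion.univ_filter A _) (k := 9)
    ((hK.isBalanced hA).card_filter_eq_one hA)
  have h2 : (fun t => if t ∈ univ.filter fun p => k33Fun A x a p = 1 then sideSign A x a t else 0)
      = sideSign A x a := by
    ext t
    simp only [Finset.mem_filter, Finset.mem_univ, true_and, sideSign]
    split_ifs <;> rfl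
  rw [h2] at h1
  norm_num at h1
  rw [Finset.sum_eq_zero_iff_of_nonneg fun _ _ => sq_nonneg _] at h1
  exact pow_eq_zero_iff (two_ne_zero) |>.1 (h1 h hh)

end component

end IsK33

end

section

variable {W : Type*} [Fintype W] [DecidableEq W]

namespace IsK33

variable {A : W → W → ℤ} {x a : Fin 3 → W} {Φ C : Finset W} {j k : ℕ} {τ : W → ℤ}

theorem isLocalEigen_halfTransfer_neg (hA : IsSRGMatrix A) (hK : IsK33 A x a)
    (hΦ : IsComponentUnion A (fun t => -k33Fun A x a t) Φ) (hj : Φ.card = 6 * j)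
    (hs : IsSigning Φ τ) (hτ : IsLocalEigen A (fun t => -k33Fun A x a t) (-3) τ) :
    IsLocalEigen A (k33Fun A x a) (-3) (halfTransfer A (fun t => -k33Fun A x a t) Φ j τ) := by
  simpa using hs.isLocalEigen_halfTransfer hA (hK.isBalanced hA).neg hΦ hj hτ

theorem isLocalEigen_sideSign_mul (hA : IsSRGMatrix A) (hK : IsK33 A x a) {φ : W → ℤ}
    (hφ : IsLocalEigen A (k33Fun A x a) (-3) φ) :
    IsLocalEigen A (k33Fun A x a) 3 fun p => sideSign A x a p * φ p := by
  have := (hK.isBalanced hA).isLocalEigen_of_adj hA (φ := fun p => sideSign A x a p * φ p) (e := 1)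
    (fun t ht => by simp [hφ.support t ht]) fun p q hp hq hpq => by
      rw [hK.sideSign_adj hA p q hp hq hpq,
        (hK.isBalanced hA).localEigen_adj_neg hA hφ hp hq hpq]
      ring
  simpa using this

theorem two_mul_sum_mul_halfTransfer (hA : IsSRGMatrix A) (hK : IsK33 A x a)
    (hΦ : IsComponentUnion A (fun t => -k33Fun A x a t) Φ) (hj : Φ.card = 6 * j)
    (hs : IsSigning Φ τ) {σ : W → ℤ} (hσ : ∀ t, k33Fun A x a t ≠ 1 → σ t = 0) :
    2 * ∑ p, σ p * halfTransfer A (fun t => -k33Fun A x a t) Φ j τ p =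
      ∑ h ∈ Φ, nbrSum A σ h * τ h := by
  rw [← hs.sum_mul, hA.sum_nbrSum_mul, Finset.mul_sum]
  refine Finset.sum_congr rfl fun p _ => ?_
  have h1 := hs.transfer_eq hA (hK.isBalanced hA).neg hΦ hj p
  by_cases c : k33Fun A x a p = 1
  · simp only [transfer, c, if_true] at h1
    rw [h1]; ring
  · simp [hσ p c]

/-- Component unions among the far vertices have size divisible by `12`. -/
theorem even_of_subset_farSet (hA : IsSRGMatrix A) (hK : IsK33 A x a)
    (hΦ : IsComponentUnion A (fun t => -k33Fun A x a t) Φ) (hj : Φ.card = 6 * j)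
    (hs : IsSigning Φ τ) (hτ : IsLocalEigen A (fun t => -k33Fun A x a t) (-3) τ)
    (hsub : Φ ⊆ farSet A x a) : Even j := by
  have hγ := hK.isBalanced hA
  set e := halfTransfer A (fun t => -k33Fun A x a t) Φ j τ with he
  have heL := hK.isLocalEigen_halfTransfer_neg hA hΦ hj hs hτ
  have hm := hK.isLocalEigen_sideSign_mul hA heL
  rw [← he] at heL hm
  obtain ⟨w, hw⟩ := hγ.exists_eq_zero hA
  have h0 : ∑ p, sideSign A x a p * e p = 0 := by
    have := hK.two_mul_sum_mul_halfTransfer hA hΦ hj hs (σ := sideSign A x a)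
      (hK.isLocalEigen_sideSign hA).support
    have hz : ∑ h ∈ Φ, nbrSum A (sideSign A x a) h * τ h = 0 := Finset.sum_eq_zero fun h hh => by
      rw [hK.nbrSum_sideSign_farSet hA (hsub hh), zero_mul]
    rw [hz, ← he] at this
    linarith
  have h1 := hγ.nbrSum_localEigen hA hm w
  rw [h0, (hK.isLocalEigen_sideSign hA).support w (by omega)] at h1
  have h2 := hγ.neg.nbrSum_transfer hA hτ w
  rw [funext (hs.transfer_eq hA hγ.neg hΦ hj), ← he] at h2
  have h3 : e w = 0 := heL.support w (by omega)
  have hwΦ : w ∉ Φ := fun c => by have := hΦ.eq_one w c; omega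
  simp only [h3, hs.notMem w hwΦ] at h2
  have h4 : nbrSum A (fun t => 2 * e t) w = 2 * nbrSum A e w := by
    simp only [nbrSum, Finset.mul_sum]
    exact Finset.sum_congr rfl fun _ _ => by ring
  have h5 : (2 : ℤ) ∣ nbrSum A (fun p => sideSign A x a p * e p) w - nbrSum A e w := by
    simp only [nbrSum, ← Finset.sum_sub_distrib]
    refine Finset.dvd_sum fun t _ => ?_
    by_cases c : k33Fun A x a t = 1
    · rcases hK.sideSign_eq hA t c with d | d
      · simp [d]
      · exact ⟨-(A w t * e t), by rw [d]; ring⟩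
    · simp [heL.support t c]
  have h6 := hs.two_dvd_nbrSum_sub (A := A) w
  have h7 := hΦ.six_mul_sum hA hγ.neg w
  rw [if_neg hwΦ, hw, hj] at h7
  push_cast at h7
  rw [← Int.even_coe_nat, even_iff_two_dvd]
  omega

/-- On a minimal component union of odd size, local eigenvectors for `3` are constant. -/
theorem exists_const_of_minimal (hA : IsSRGMatrix A) (hK : IsK33 A x a)
    (hC : IsComponentUnion A (k33Fun A x a) C) (hk : C.card = 6 * k) (hodd : Odd k)
    (hmin : ∀ C' k', IsComponentUnion A (k33Fun A x a) C' → C'.card = 6 * k' → Odd k' → k ≤ k')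
    {φ : W → ℤ} (hφ : IsLocalEigen A (k33Fun A x a) 3 φ) : ∃ m, ∀ p ∈ C, φ p = m := by
  have hγ := hK.isBalanced hA
  have hkpos := hodd.pos
  obtain ⟨p, hp⟩ : C.Nonempty := Finset.card_pos.1 (by omega)
  refine ⟨φ p, ?_⟩
  have hC1 := hC.filter_eq hA hγ hφ (φ p)
  have hC2 := hC.filter_ne hA hγ hφ (φ p)
  have hcard := Finset.card_filter_add_card_filter_not (s := C) (fun t => φ t = φ p)
  obtain ⟨k1, hk1⟩ := hγ.six_dvd_card hA hC1
  obtain ⟨k2, hk2⟩ := hγ.six_dvd_card hA hC2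
  have hpos : 0 < (C.filter fun t => φ t = φ p).card :=
    Finset.card_pos.2 ⟨p, by simp [hp]⟩
  have hk2' : ¬ Odd k2 := fun h => by have := hmin _ _ hC2 hk2 h; omega
  have hk1' : Odd k1 := by
    rw [Nat.not_odd_iff_even, Nat.even_iff] at hk2'
    rw [Nat.odd_iff] at hodd ⊢
    omega
  have := hmin _ _ hC1 hk1 hk1'
  have hz : (C.filter fun t => ¬ φ t = φ p) = ∅ := Finset.card_eq_zero.1 (by omega)
  intro q hq
  by_contra c
  have : q ∈ C.filter fun t => ¬ φ t = φ p := by simp [hq, c]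
  rw [hz] at this
  simp at this

theorem exists_halfTransfer_eq (hA : IsSRGMatrix A) (hK : IsK33 A x a)
    (hC : IsComponentUnion A (k33Fun A x a) C) (hk : C.card = 6 * k) (hodd : Odd k)
    (hmin : ∀ C' k', IsComponentUnion A (k33Fun A x a) C' → C'.card = 6 * k' → Odd k' → k ≤ k')
    (hΦ : IsComponentUnion A (fun t => -k33Fun A x a t) Φ) (hj : Φ.card = 6 * j)
    (hs : IsSigning Φ τ) (hτ : IsLocalEigen A (fun t => -k33Fun A x a t) (-3) τ) (c : ℤ)
    (hc : ∀ h ∈ Φ, nbrSum A (fun t => if t ∈ C then sideSign A x a t else 0) h = 2 * (c * τ h)) :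
    ∃ m : ℤ, k * m = c * j ∧
      ∀ p ∈ C, halfTransfer A (fun t => -k33Fun A x a t) Φ j τ p = m * sideSign A x a p := by
  have heL := hK.isLocalEigen_halfTransfer_neg hA hΦ hj hs hτ
  set e := halfTransfer A (fun t => -k33Fun A x a t) Φ j τ with he
  obtain ⟨m, hm⟩ := hK.exists_const_of_minimal hA hC hk hodd hmin
    (hK.isLocalEigen_sideSign_mul hA heL)
  refine ⟨m, ?_, fun p hp => ?_⟩
  · have h1 := hK.two_mul_sum_mul_halfTransfer hA hΦ hj hs
      (σ := fun t => if t ∈ C then sideSign A x a t else 0)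
      fun t ht => if_neg fun d => ht (hC.eq_one t d)
    rw [← he] at h1
    simp only [ite_mul, zero_mul, Finset.sum_ite_mem, Finset.univ_inter] at h1
    rw [Finset.sum_congr rfl hm, Finset.sum_congr rfl fun h hh => show
      nbrSum A (fun t => if t ∈ C then sideSign A x a t else 0) h * τ h = 2 * c by
        rw [hc h hh]
        rcases hs.mem h hh with d | d <;> rw [d] <;> ring] at h1
    simp only [Finset.sum_const, nsmul_eq_mul, hk, hj] at h1
    push_cast at h1
    linarith
  · rw [← hm p hp]
    rcases hK.sideSign_eq hA p (hC.eq_one p hp) with d | d <;> rw [d] <;> ring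

/-- The far vertices at which half of the transfer has absolute value `c`. -/
def levelSet (A : W → W → ℤ) (x a : Fin 3 → W) (C : Finset W) (k c : ℕ) : Finset W :=
  (farSet A x a).filter fun h => (halfTransfer A (k33Fun A x a) C k
    (fun t => if t ∈ C then sideSign A x a t else 0) h).natAbs = c

/-- The signs of the transfer on a level set. -/
def levelSign (A : W → W → ℤ) (x a : Fin 3 → W) (C : Finset W) (k c : ℕ) (h : W) : ℤ :=
  if h ∈ levelSet A x a C k c then (halfTransfer A (k33Fun A x a) C k
    (fun t => if t ∈ C then sideSign A x a t else 0) h).sign else 0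

section level

variable {c : ℕ}

theorem isLocalEigen_half (hA : IsSRGMatrix A) (hK : IsK33 A x a)
    (hC : IsComponentUnion A (k33Fun A x a) C) (hk : C.card = 6 * k) :
    IsLocalEigen A (fun t => -k33Fun A x a t) (-3) (halfTransfer A (k33Fun A x a) C k
      fun t => if t ∈ C then sideSign A x a t else 0) :=
  (hK.isSigning hA hC).isLocalEigen_halfTransfer hA (hK.isBalanced hA) hC hk
    (hC.restrict hA (hK.isLocalEigen_sideSign hA))

theorem isComponentUnion_levelSet (hA : IsSRGMatrix A) (hK : IsK33 A x a)
    (hC : IsComponentUnion A (k33Fun A x a) C) (hk : C.card = 6 * k) :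
    IsComponentUnion A (fun t => -k33Fun A x a t) (levelSet A x a C k c) :=
  (hK.isComponentUnion_farSet hA).mono (Finset.filter_subset _ _) fun p hp q hq h1 h2 h3 => by
    rw [levelSet, Finset.mem_filter] at hp ⊢
    refine ⟨hq, ?_⟩
    rw [← hp.2, (hK.isBalanced hA).neg.localEigen_adj_neg hA (hK.isLocalEigen_half hA hC hk)
      h1 h2 h3, Int.natAbs_neg]

theorem isSigning_levelSign (hc : c ≠ 0) :
    IsSigning (levelSet A x a C k c) (levelSign A x a C k c) where
  mem t ht := by
    simp only [levelSign, ht, if_true]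
    rw [levelSet, Finset.mem_filter] at ht
    rcases lt_trichotomy (halfTransfer A (k33Fun A x a) C k
      (fun t => if t ∈ C then sideSign A x a t else 0) t) 0 with d | d | d
    · exact Or.inr (Int.sign_eq_neg_one_of_neg d)
    · rw [d] at ht
      simp only [Int.natAbs_zero] at ht
      exact absurd ht.2.symm hc
    · exact Or.inl (Int.sign_eq_one_of_pos d)
  notMem t ht := if_neg ht

theorem isLocalEigen_levelSign (hA : IsSRGMatrix A) (hK : IsK33 A x a)
    (hC : IsComponentUnion A (k33Fun A x a) C) (hk : C.card = 6 * k) :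
    IsLocalEigen A (fun t => -k33Fun A x a t) (-3) (levelSign A x a C k c) := by
  have h1 := hK.isLocalEigen_half hA hC hk
  refine (hK.isComponentUnion_levelSet hA hC hk).restrict hA ?_
  have := (hK.isBalanced hA).neg.isLocalEigen_of_adj hA (e := -1)
    (φ := fun h => (halfTransfer A (k33Fun A x a) C k
      (fun t => if t ∈ C then sideSign A x a t else 0) h).sign)
    (fun t ht => by rw [h1.support t ht, Int.sign_zero]) fun p q hp hq hpq => by
      rw [(hK.isBalanced hA).neg.localEigen_adj_neg hA h1 hp hq hpq, Int.sign_neg]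
      ring
  simpa using this

theorem half_eq_mul_levelSign {h : W} (hh : h ∈ levelSet A x a C k c) :
    halfTransfer A (k33Fun A x a) C k (fun t => if t ∈ C then sideSign A x a t else 0) h =
      c * levelSign A x a C k c h := by
  simp only [levelSign, hh, if_true]
  rw [levelSet, Finset.mem_filter] at hh
  rw [← hh.2, mul_comm, Int.sign_mul_natAbs]

theorem nbrSum_eq_two_mul_half (hA : IsSRGMatrix A) (hK : IsK33 A x a)
    (hC : IsComponentUnion A (k33Fun A x a) C) (hk : C.card = 6 * k) {h : W}
    (hh : k33Fun A x a h = -1) :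
    nbrSum A (fun t => if t ∈ C then sideSign A x a t else 0) h =
      2 * halfTransfer A (k33Fun A x a) C k (fun t => if t ∈ C then sideSign A x a t else 0) h := by
  rw [← (hK.isSigning hA hC).transfer_eq hA (hK.isBalanced hA) hC hk]
  exact (if_pos hh).symm

theorem fun_of_mem_farSet {h : W} (hh : h ∈ farSet A x a) : k33Fun A x a h = -1 := by
  rw [farSet, Finset.mem_filter] at hh
  exact hh.2.1

theorem level_card (hA : IsSRGMatrix A) (hK : IsK33 A x a)
    (hC : IsComponentUnion A (k33Fun A x a) C) (hk : C.card = 6 * k) (hodd : Odd k)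
    (hmin : ∀ C' k', IsComponentUnion A (k33Fun A x a) C' → C'.card = 6 * k' → Odd k' → k ≤ k')
    (hc : c ≠ 0) :
    ∃ j, (levelSet A x a C k c).card = 6 * j ∧ Even j ∧ j ≤ 8 ∧ ∃ m : ℤ, k * m = c * j ∧
      ∀ p ∈ C, halfTransfer A (fun t => -k33Fun A x a t) (levelSet A x a C k c) j
        (levelSign A x a C k c) p = m * sideSign A x a p := by
  have hΦ := hK.isComponentUnion_levelSet hA hC hk (c := c)
  obtain ⟨j, hj⟩ := (hK.isBalanced hA).neg.six_dvd_card hA hΦ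
  have hs := isSigning_levelSign (A := A) (x := x) (a := a) (C := C) (k := k) hc
  have hτ := hK.isLocalEigen_levelSign hA hC hk (c := c)
  have hsub : levelSet A x a C k c ⊆ farSet A x a := Finset.filter_subset _ _
  refine ⟨j, hj, hK.even_of_subset_farSet hA hΦ hj hs hτ hsub, ?_,
    hK.exists_halfTransfer_eq hA hC hk hodd hmin hΦ hj hs hτ c fun h hh => ?_⟩
  · have := Finset.card_le_card hsub
    rw [hK.card_farSet hA] at this
    omega
  · rw [hK.nbrSum_eq_two_mul_half hA hC hk (fun_of_mem_farSet (hsub hh)),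
      half_eq_mul_levelSign hh]

theorem sum_level (hA : IsSRGMatrix A) (hK : IsK33 A x a)
    (hC : IsComponentUnion A (k33Fun A x a) C) (hk : C.card = 6 * k) :
    ∑ c ∈ range (k + 1), ((levelSet A x a C k c).card : ℤ) * c ^ 2 = 6 * k * (9 - k) := by
  have h1 := hK.sum_sq_farSet hA hC hk
  rw [Finset.sum_congr rfl fun h hh => by
    rw [hK.nbrSum_eq_two_mul_half hA hC hk (fun_of_mem_farSet hh), mul_pow],
    ← Finset.mul_sum] at h1
  rw [← Finset.sum_fiberwise_of_maps_to (t := range (k + 1)) (g := fun h => (halfTransfer A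
    (k33Fun A x a) C k (fun t => if t ∈ C then sideSign A x a t else 0) h).natAbs)
    fun h _ => by
      have := abs_le.1 (IsSigning.abs_halfTransfer_le
        (σ := fun t => if t ∈ C then sideSign A x a t else 0) hA (hK.isBalanced hA) hC hk h)
      rw [Finset.mem_range]
      omega] at h1
  have e : ∀ c ∈ range (k + 1), ((levelSet A x a C k c).card : ℤ) * c ^ 2 =
      ∑ h ∈ (farSet A x a).filter (fun h => (halfTransfer A (k33Fun A x a) C k
        (fun t => if t ∈ C then sideSign A x a t else 0) h).natAbs = c), halfTransfer A
        (k33Fun A x a) C k (fun t => if t ∈ C then sideSign A x a t else 0) h ^ 2 := fun c _ => by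
    rw [← nsmul_eq_mul, ← Finset.sum_const, levelSet]
    exact Finset.sum_congr rfl fun h hh => by
      rw [← (Finset.mem_filter.1 hh).2, Int.natCast_natAbs, sq_abs]
  rw [Finset.sum_congr rfl e]
  linarith

/-- A minimal component union of odd size has `6` vertices, or `18` vertices with a very special
transfer. -/
theorem eq_one_or_three (hA : IsSRGMatrix A) (hK : IsK33 A x a)
    (hC : IsComponentUnion A (k33Fun A x a) C) (hk : C.card = 6 * k) (hodd : Odd k)
    (hmin : ∀ C' k', IsComponentUnion A (k33Fun A x a) C' → C'.card = 6 * k' → Odd k' → k ≤ k')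
    (hk9 : k < 9) :
    k = 1 ∨ (k = 3 ∧ (levelSet A x a C k 3).card = 12 ∧ levelSet A x a C k 1 = ∅ ∧
      levelSet A x a C k 2 = ∅) := by
  have hsum := hK.sum_level hA hC hk
  choose! j hj using fun c => hK.level_card hA hC hk hodd hmin (c := c)
  have hdvd : ∀ c, c ≠ 0 → k ∣ c * j c := fun c hc => by
    obtain ⟨-, -, -, m, hm, -⟩ := hj c hc
    exact Int.natCast_dvd_natCast.1 ⟨m, by push_cast; exact hm.symm⟩
  have heven : ∀ c, c ≠ 0 → 2 ∣ j c := fun c hc => even_iff_two_dvd.1 (hj c hc).2.1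
  have hle : ∀ c, c ≠ 0 → j c ≤ 8 := fun c hc => (hj c hc).2.2.1
  have hcard : ∀ c, c ≠ 0 → (levelSet A x a C k c).card = 6 * j c := fun c hc => (hj c hc).1
  clear hj
  have hkk : k = 1 ∨ k = 3 ∨ k = 5 ∨ k = 7 := by
    rw [Nat.odd_iff] at hodd
    omega
  clear hmin
  have d1 := hdvd 1 (by norm_num)
  have d2 := hdvd 2 (by norm_num)
  have d3 := hdvd 3 (by norm_num)
  have d4 := hdvd 4 (by norm_num)
  have d5 := hdvd 5 (by norm_num)
  have d6 := hdvd 6 (by norm_num)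
  have e1 := heven 1 (by norm_num)
  have e2 := heven 2 (by norm_num)
  have e3 := heven 3 (by norm_num)
  have e4 := heven 4 (by norm_num)
  have e5 := heven 5 (by norm_num)
  have e6 := heven 6 (by norm_num)
  have e7 := heven 7 (by norm_num)
  have l1 := hle 1 (by norm_num)
  have l2 := hle 2 (by norm_num)
  have l3 := hle 3 (by norm_num)
  have l4 := hle 4 (by norm_num)
  have l5 := hle 5 (by norm_num)
  have l6 := hle 6 (by norm_num)
  have l7 := hle 7 (by norm_num)
  rcases hkk with rfl | rfl | rfl | rfl
  · exact Or.inl rfl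
  · right
    simp only [Finset.sum_range_succ, Finset.sum_range_zero, hcard 1 (by norm_num),
      hcard 2 (by norm_num), hcard 3 (by norm_num)] at hsum
    push_cast at hsum
    rw [← Finset.card_eq_zero, ← Finset.card_eq_zero, hcard 1 (by norm_num),
      hcard 2 (by norm_num), hcard 3 (by norm_num)]
    omega
  · exfalso
    simp only [Finset.sum_range_succ, Finset.sum_range_zero, hcard 1 (by norm_num),
      hcard 2 (by norm_num), hcard 3 (by norm_num), hcard 4 (by norm_num),
      hcard 5 (by norm_num)] at hsum
    push_cast at hsum
    omega
  · exfalso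
    simp only [Finset.sum_range_succ, Finset.sum_range_zero, hcard 1 (by norm_num),
      hcard 2 (by norm_num), hcard 3 (by norm_num), hcard 4 (by norm_num),
      hcard 5 (by norm_num), hcard 6 (by norm_num), hcard 7 (by norm_num)] at hsum
    push_cast at hsum
    omega

end level

end IsK33

end

section

variable {W : Type*} [Fintype W] [DecidableEq W]

theorem IsSigning.two_mul_card_filter {C : Finset W} {σ : W → ℤ} (hσ : IsSigning C σ)
    (h0 : ∑ t, σ t = 0) : 2 * (C.filter fun t => σ t = 1).card = C.card := by
  have h1 : ∑ t, σ t = ∑ t ∈ C, σ t := by simpa using hσ.sum_mul fun _ => 1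
  have h2 : ∑ t ∈ C, σ t = ∑ t ∈ C, (2 * (if σ t = 1 then (1 : ℤ) else 0) - 1) :=
    Finset.sum_congr rfl fun t ht => by rcases hσ.mem t ht with c | c <;> simp [c]
  rw [Finset.sum_sub_distrib, ← Finset.mul_sum, Finset.sum_boole] at h2
  simp only [sum_const, nsmul_eq_mul, mul_one] at h2
  omega

namespace IsK33

variable {A : W → W → ℤ} {x a : Fin 3 → W} {C : Finset W} {k : ℕ}

theorem sideDeg_add_of_fun_eq_one (hA : IsSRGMatrix A) (hK : IsK33 A x a) {u : W}
    (hu : k33Fun A x a u = 1) : sideDeg A x u + sideDeg A a u = 2 := by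
  rcases hK.sideDeg_of_fun_eq_one hA hu with h | h <;> omega

/-- There is a minimal component union among those of odd size. -/
theorem exists_minimal (hA : IsSRGMatrix A) (hK : IsK33 A x a) :
    ∃ C k, IsComponentUnion A (k33Fun A x a) C ∧ C.card = 6 * k ∧ Odd k ∧ k < 9 ∧
      ∀ C' k', IsComponentUnion A (k33Fun A x a) C' → C'.card = 6 * k' → Odd k' → k ≤ k' := by
  classical
  have hγ := hK.isBalanced hA
  have hex : ∃ k C, IsComponentUnion A (k33Fun A x a) C ∧ C.card = 6 * k ∧ Odd k ∧ k < 9 := by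
    obtain ⟨C, k, h⟩ := hγ.exists_odd_componentUnion hA
      (η := fun t => 9 * (∑ i, (if t = x i then 1 else 0) + ∑ j, (if t = a j then 1 else 0)) -
        if -k33Fun A x a t = 1 then 1 else 0)
      (fun t ht => by
        have h1 : ∀ i, t ≠ x i := fun i c => ht (c ▸ hK.fun_left hA i)
        have h2 : ∀ j, t ≠ a j := fun j c => ht (c ▸ hK.fun_right hA j)
        have h3 : ¬ -k33Fun A x a t = 1 := by omega
        simp [h1, h2, h3])
      (fun c => by
        have := congrFun c (x 0)
        simp only [hK.fun_left hA, hK.inj_left.eq_iff] at this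
        simp [hK.ne hA] at this)
      (fun u hu => by
        have h1 := hγ.neg.two_mul_degree hA u
        have h2 := hK.sideDeg_add_of_fun_eq_one hA hu
        have h3 : ∀ y : Fin 3 → W, ∑ t, A u t * ∑ i, (if t = y i then (1 : ℤ) else 0) =
            sideDeg A y u := fun y => by
          simp only [Finset.mul_sum]
          rw [Finset.sum_comm]
          simp [sideDeg, hA.symm u]
        have h4 : nbrSum A (fun t => 9 * (∑ i, (if t = x i then (1 : ℤ) else 0) +
            ∑ j, (if t = a j then 1 else 0)) - if -k33Fun A x a t = 1 then 1 else 0) u =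
            9 * (∑ t, A u t * ∑ i, (if t = x i then (1 : ℤ) else 0) +
              ∑ t, A u t * ∑ i, (if t = a i then (1 : ℤ) else 0)) -
            ∑ t, A u t * (if -k33Fun A x a t = 1 then 1 else 0) := by
          rw [← Finset.sum_add_distrib, Finset.mul_sum, ← Finset.sum_sub_distrib]
          exact Finset.sum_congr rfl fun _ _ => by ring
        rw [h4, h3, h3]
        rw [hu] at h1
        linarith)
    exact ⟨k, C, h⟩
  obtain ⟨C, h1, h2, h3, h4⟩ := Nat.find_spec hex
  refine ⟨C, Nat.find hex, h1, h2, h3, h4, fun C' k' g1 g2 g3 => ?_⟩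
  by_cases g : k' < 9
  · exact Nat.find_min' hex ⟨C', g1, g2, g3, g⟩
  · omega

theorem adj_eq_zero_of_mem_farSet (hA : IsSRGMatrix A) {h : W} (hh : h ∈ farSet A x a) (i : Fin 3) :
    A (x i) h = 0 ∧ A (a i) h = 0 := by
  rw [farSet, mem_filter] at hh
  obtain ⟨-, -, h1, h2⟩ := hh
  exact ⟨(Finset.sum_eq_zero_iff_of_nonneg fun i _ => hA.nonneg _ _).1 h1 i (mem_univ i),
    (Finset.sum_eq_zero_iff_of_nonneg fun i _ => hA.nonneg _ _).1 h2 i (mem_univ i)⟩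

/-- Two nonadjacent far vertices have a common neighbour adjacent to exactly one `x i`. -/
theorem exists_common_of_farSet (hA : IsSRGMatrix A) (hK : IsK33 A x a) {f g : W} (hfg : f ≠ g)
    (hadj : A f g = 0) (hf : f ∈ farSet A x a) (hg : g ∈ farSet A x a) :
    ∃ w, A f w = 1 ∧ A g w = 1 ∧ k33Fun A x a w = 0 ∧ sideDeg A x w = 1 ∧ sideDeg A a w = 0 := by
  have hne : ∀ h ∈ farSet A x a, ∀ i, x i ≠ h := fun h hh i c => by
    have := (adj_eq_zero_of_mem_farSet hA hh 0).2
    rw [← c, hA.symm, hK.adj] at this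
    omega
  have h1 : ∑ t, A f t * A g t * sideDeg A x t = 9 := by
    simp only [sideDeg, Finset.mul_sum]
    rw [Finset.sum_comm]
    have : ∀ i ∈ (univ : Finset (Fin 3)), ∑ t, A f t * A g t * A (x i) t = 3 := fun i _ => by
      rw [hA.sum_mul_mul hfg hadj, if_neg (hne f hf i), if_neg (hne g hg i), hA.symm f, hA.symm g,
        (adj_eq_zero_of_mem_farSet hA hf i).1, (adj_eq_zero_of_mem_farSet hA hg i).1]
      norm_num
    rw [Finset.sum_congr rfl this]
    norm_num
  by_contra! hcon
  have h2 : (2 : ℤ) ∣ ∑ t, A f t * A g t * sideDeg A x t := Finset.dvd_sum fun t _ => by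
    rcases hA.zero_or_one f t with c1 | c1
    · simp [c1]
    rcases hA.zero_or_one g t with c2 | c2
    · simp [c2]
    have := hcon t c1 c2
    rcases hK.cases_of hA t with ⟨i, rfl⟩ | ⟨j, rfl⟩ | ⟨-, -, e, e1, e2, e3, e4, e5⟩
    · simp [hK.sideDeg_left hA]
    · rw [hA.symm, (adj_eq_zero_of_mem_farSet hA hf j).2] at c1
      omega
    · refine Dvd.dvd.mul_left ?_ _
      omega
  rw [h1] at h2
  omega

theorem transfer_eq_six_mul (hA : IsSRGMatrix A) (hK : IsK33 A x a)
    (hC : IsComponentUnion A (k33Fun A x a) C) (hk : C.card = 6 * 3)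
    (h1 : levelSet A x a C 3 1 = ∅) (h2 : levelSet A x a C 3 2 = ∅) {h : W}
    (hh : h ∈ farSet A x a) :
    nbrSum A (fun t => if t ∈ C then sideSign A x a t else 0) h =
      6 * levelSign A x a C 3 3 h := by
  rw [hK.nbrSum_eq_two_mul_half hA hC hk (fun_of_mem_farSet hh)]
  have hle := abs_le.1 (IsSigning.abs_halfTransfer_le
        (σ := fun t => if t ∈ C then sideSign A x a t else 0) hA (hK.isBalanced hA) hC hk h)
  by_cases h3 : h ∈ levelSet A x a C 3 3
  · rw [half_eq_mul_levelSign h3]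
    push_cast
    ring
  · rw [(isSigning_levelSign (A := A) (x := x) (a := a) (C := C) (k := 3) (c := 3)
      (by norm_num)).notMem h h3]
    have g1 : h ∉ levelSet A x a C 3 1 := by simp [h1]
    have g2 : h ∉ levelSet A x a C 3 2 := by simp [h2]
    simp only [levelSet, mem_filter, hh, true_and] at g1 g2 h3
    omega

/-- Two far vertices with the same positive sign have a common non-neighbour in `C` of positive
sign. -/
theorem exists_common_nonadj (hA : IsSRGMatrix A) (hK : IsK33 A x a)
    (hC : IsComponentUnion A (k33Fun A x a) C) (hk : C.card = 6 * 3)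
    (h12 : (levelSet A x a C 3 3).card = 12)
    (h1 : levelSet A x a C 3 1 = ∅) (h2 : levelSet A x a C 3 2 = ∅) {f g : W} (hfg : f ≠ g)
    (hf : f ∈ levelSet A x a C 3 3) (hg : g ∈ levelSet A x a C 3 3)
    (hf1 : levelSign A x a C 3 3 f = 1) (hg1 : levelSign A x a C 3 3 g = 1) :
    ∃ p ∈ C, sideSign A x a p = 1 ∧ A p f = 0 ∧ A p g = 0 := by
  have hγ := hK.isBalanced hA
  set Φ := levelSet A x a C 3 3 with hΦdef
  set τ := levelSign A x a C 3 3 with hτdef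
  set σ : W → ℤ := fun t => if t ∈ C then sideSign A x a t else 0 with hσdef
  have hΦ : IsComponentUnion A (fun t => -k33Fun A x a t) Φ :=
    hK.isComponentUnion_levelSet hA hC hk
  have hs : IsSigning Φ τ := isSigning_levelSign (by norm_num)
  have hτ : IsLocalEigen A (fun t => -k33Fun A x a t) (-3) τ := hK.isLocalEigen_levelSign hA hC hk
  have hsC : IsSigning C σ := hK.isSigning hA hC
  have hσ : IsLocalEigen A (k33Fun A x a) (-3) σ := hC.restrict hA (hK.isLocalEigen_sideSign hA)
  have hsub : Φ ⊆ farSet A x a := Finset.filter_subset _ _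
  have hadj : A f g = 0 := by
    rcases hA.zero_or_one f g with c | c
    · exact c
    · have := hγ.neg.localEigen_adj_neg hA hτ (hΦ.eq_one f hf) (hΦ.eq_one g hg) c
      omega
  obtain ⟨w, hfw, hgw, hw, hx, ha⟩ := hK.exists_common_of_farSet hA hfg hadj (hsub hf) (hsub hg)
  have e1 := hγ.nbrSum_transfer hA hσ w
  have hwC : w ∉ C := fun c => by have := hC.eq_one w c; omega
  have hwΦ : w ∉ Φ := fun c => by have := hΦ.eq_one w c; omega
  have e2 : transfer A (k33Fun A x a) σ w = 0 := if_neg (by omega)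
  rw [e2, hsC.notMem w hwC] at e1
  have e3 : nbrSum A (transfer A (k33Fun A x a) σ) w = 6 * nbrSum A τ w - 6 := by
    rw [nbrSum, hK.sum_of_support hA fun t ht => by simp [transfer, ht]]
    have f1 : ∑ t ∈ farSet A x a, A w t * transfer A (k33Fun A x a) σ t = 6 * nbrSum A τ w := by
      rw [nbrSum, hs.sum_mul, Finset.mul_sum, ← Finset.sum_subset hsub fun t ht htn => ?_]
      · refine Finset.sum_congr rfl fun t ht => ?_
        rw [transfer, if_pos (fun_of_mem_farSet (hsub ht)),
          hK.transfer_eq_six_mul hA hC hk h1 h2 (hsub ht)]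
        ring
      · rw [transfer, if_pos (fun_of_mem_farSet ht), hK.transfer_eq_six_mul hA hC hk h1 h2 ht,
          ← hτdef, hs.notMem t htn]
        ring
    have f2 : ∑ i, A w (x i) * transfer A (k33Fun A x a) σ (x i) = -6 := by
      have : ∀ i ∈ (univ : Finset (Fin 3)), A w (x i) * transfer A (k33Fun A x a) σ (x i) =
          A (x i) w * (-6) := fun i _ => by
        rw [transfer, if_pos (hK.fun_left hA i), hK.nbrSum_restrict_left hA hC hk, hA.symm w]
        norm_num
      rw [Finset.sum_congr rfl this, ← Finset.sum_mul]
      change sideDeg A x w * (-6) = -6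
      rw [hx]; norm_num
    have f3 : ∑ i, A w (a i) * transfer A (k33Fun A x a) σ (a i) = 0 := by
      have : ∀ i ∈ (univ : Finset (Fin 3)), A w (a i) * transfer A (k33Fun A x a) σ (a i) =
          A (a i) w * 6 := fun i _ => by
        rw [transfer, if_pos (hK.fun_right hA i), hK.nbrSum_restrict_right hA hC hk, hA.symm w]
        norm_num
      rw [Finset.sum_congr rfl this, ← Finset.sum_mul]
      change sideDeg A a w * 6 = 0
      rw [ha]; norm_num
    rw [f1, f2, f3]
    ring
  have e4 := hs.nbrSum_eq (A := A) w
  have e5 := hΦ.six_mul_sum hA hγ.neg w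
  have e6 := hC.six_mul_sum hA hγ w
  rw [if_neg hwΦ, h12, hw] at e5
  rw [if_neg hwC, hk, hw] at e6
  have e7 : 2 ≤ ∑ t ∈ Φ, A w t * (if τ t = 1 then 1 else 0) := by
    calc (2 : ℤ) = ∑ t ∈ {f, g}, A w t * (if τ t = 1 then 1 else 0) := by
          rw [Finset.sum_pair hfg, hf1, hg1, hA.symm w, hA.symm w, hfw, hgw]
          norm_num
      _ ≤ _ := Finset.sum_le_sum_of_subset_of_nonneg
          (by intro t ht; simp only [mem_insert, mem_singleton] at ht; rcases ht with rfl | rfl <;>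
                assumption)
          fun t _ _ => mul_nonneg (hA.nonneg _ _) (by split_ifs <;> norm_num)
  have e8 : ∑ t ∈ Φ, A w t * (if τ t = 1 then 1 else 0) ≤ ∑ t ∈ Φ, A w t :=
    Finset.sum_le_sum fun t _ => by
      have := hA.nonneg w t
      split_ifs <;> simp [this]
  have e9 := hsC.nbrSum_eq (A := A) w
  have e10 : ∑ t ∈ C, A w t * (if σ t = 1 then 1 else 0) ≠ 0 := by
    push_cast at e5 e6
    omega
  obtain ⟨p, hp, hne⟩ := Finset.exists_ne_zero_of_sum_ne_zero e10
  have hp1 : σ p = 1 := by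
    by_contra c
    simp [c] at hne
  have hwp : A p w = 1 := by
    rcases hA.zero_or_one w p with c | c
    · simp [c] at hne
    · rw [hA.symm]; exact c
  refine ⟨p, hp, by simpa [hσdef, hp] using hp1, ?_, ?_⟩
  · exact hA.triangle_free p w f hwp (by rw [hA.symm]; exact hfw)
  · exact hA.triangle_free p w g hwp (by rw [hA.symm]; exact hgw)

theorem false_of_three (hA : IsSRGMatrix A) (hK : IsK33 A x a)
    (hC : IsComponentUnion A (k33Fun A x a) C) (hk : C.card = 6 * 3)
    (hmin : ∀ C' k', IsComponentUnion A (k33Fun A x a) C' → C'.card = 6 * k' → Odd k' → 3 ≤ k')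
    (h12 : (levelSet A x a C 3 3).card = 12)
    (h1 : levelSet A x a C 3 1 = ∅) (h2 : levelSet A x a C 3 2 = ∅) : False := by
  have hγ := hK.isBalanced hA
  obtain ⟨j, hj, -, -, m, hm, hp⟩ := hK.level_card hA hC hk (by decide) hmin (c := 3) (by norm_num)
  have hs : IsSigning (levelSet A x a C 3 3) (levelSign A x a C 3 3) :=
    isSigning_levelSign (by norm_num)
  have hτ : IsLocalEigen A (fun t => -k33Fun A x a t) (-3) (levelSign A x a C 3 3) :=
    hK.isLocalEigen_levelSign hA hC hk
  have hσ : IsLocalEigen A (k33Fun A x a) (-3) fun t => if t ∈ C then sideSign A x a t else 0 :=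
    hC.restrict hA (hK.isLocalEigen_sideSign hA)
  have hΦc := hs.two_mul_card_filter (hγ.neg.sum_localEigen_neg hA hτ)
  have hCc := (hK.isSigning hA hC).two_mul_card_filter (hγ.sum_localEigen_neg hA hσ)
  set Φ := (levelSet A x a C 3 3).filter fun t => levelSign A x a C 3 3 t = 1 with hΦ
  set P := C.filter fun t => (if t ∈ C then sideSign A x a t else 0) = 1 with hP
  have hj2 : j = 2 := by omega
  have hm2 : m = 2 := by push_cast at hm; omega
  have key : Φ.offDiag ⊆ P.biUnion fun p => (Φ.filter fun f => A p f = 0).offDiag := by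
    rintro ⟨f, g⟩ hfg
    simp only [mem_offDiag, hΦ, mem_filter] at hfg
    obtain ⟨p, hp, hp1, hpf, hpg⟩ := hK.exists_common_nonadj hA hC hk h12 h1 h2 hfg.2.2
      hfg.1.1 hfg.2.1.1 hfg.1.2 hfg.2.1.2
    simp only [mem_biUnion, mem_offDiag, hP, mem_filter, hΦ]
    exact ⟨p, ⟨hp, by simp [hp, hp1]⟩, ⟨hfg.1, hpf⟩, ⟨hfg.2.1, hpg⟩, hfg.2.2⟩
  have hle := (Finset.card_le_card key).trans (Finset.card_biUnion_le_card_mul P _ 2 fun p hpP => ?_)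
  · rw [Finset.offDiag_card] at hle
    have h6 : Φ.card = 6 := by omega
    rw [h6] at hle
    omega
  · have hpC : p ∈ C := (Finset.mem_filter.1 hpP).1
    have hs1 : sideSign A x a p = 1 := by simpa [hpC] using (Finset.mem_filter.1 hpP).2
    have e := hp p hpC
    rw [halfTransfer, if_pos (by rw [hC.eq_one p hpC]), hs1, hm2, hj2] at e
    have e1 : ∑ t ∈ levelSet A x a C 3 3, A p t * (if levelSign A x a C 3 3 t = 1 then 1 else 0) =
        ∑ t ∈ Φ, A p t := by
      simp only [mul_ite, mul_one, mul_zero, hΦ, Finset.sum_filter]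
    have e2 : ∑ t ∈ Φ, A p t = ∑ t ∈ Φ, (1 - if A p t = 0 then (1 : ℤ) else 0) :=
      Finset.sum_congr rfl fun t _ => by rcases hA.zero_or_one p t with c | c <;> simp [c]
    rw [Finset.sum_sub_distrib, Finset.sum_boole] at e2
    simp only [sum_const, nsmul_eq_mul, mul_one] at e2
    have h3 : (Φ.filter fun f => A p f = 0).card = 2 := by
      push_cast at e
      omega
    rw [Finset.offDiag_card, h3]

/-- There is a component union with `6` vertices. -/
theorem exists_card_six (hA : IsSRGMatrix A) (hK : IsK33 A x a) :
    ∃ C, IsComponentUnion A (k33Fun A x a) C ∧ C.card = 6 := by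
  obtain ⟨C, k, hC, hk, hodd, hk9, hmin⟩ := hK.exists_minimal hA
  rcases hK.eq_one_or_three hA hC hk hodd hmin hk9 with rfl | ⟨rfl, h12, h1, h2⟩
  · exact ⟨C, hC, by omega⟩
  · exact (hK.false_of_three hA hC hk hmin h12 h1 h2).elim

end IsK33

end

section

variable {W : Type*} [Fintype W] [DecidableEq W]

/-- The `K₃,₃` on `p`, `q` is a partner of the `K₃,₃` on `x`, `a`: each `p i` is adjacent to the
`x j` with `j ≠ i`, and each `q i` to the `a j` with `j ≠ i`. -/
structure IsPartner (A : W → W → ℤ) (x a p q : Fin 3 → W) : Prop where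
  left_self : ∀ i, A (p i) (x i) = 0
  left : ∀ i j, i ≠ j → A (p i) (x j) = 1
  right_self : ∀ i, A (q i) (a i) = 0
  right : ∀ i j, i ≠ j → A (q i) (a j) = 1
  adj : ∀ i j, A (p i) (q j) = 1

namespace IsK33

variable {A : W → W → ℤ} {x a : Fin 3 → W} {C : Finset W}

theorem exists_mem_left (hA : IsSRGMatrix A) (hK : IsK33 A x a)
    (hC : IsComponentUnion A (k33Fun A x a) C) (hk : C.card = 6) (i : Fin 3) :
    ∃ p ∈ C, sideSign A x a p = -1 ∧ A p (x i) = 0 ∧ ∀ j, i ≠ j → A p (x j) = 1 := by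
  have hγ := hK.isBalanced hA
  have hσ : IsLocalEigen A (k33Fun A x a) (-3) fun t => if t ∈ C then sideSign A x a t else 0 :=
    hC.restrict hA (hK.isLocalEigen_sideSign hA)
  have hc := (hK.isSigning hA hC).two_mul_card_filter (hγ.sum_localEigen_neg hA hσ)
  have hsgn : ∀ t ∈ C, sideSign A x a t = 1 ∨ sideSign A x a t = -1 := fun t ht =>
    hK.sideSign_eq hA t (hC.eq_one t ht)
  have hxC : x i ∉ C := fun c => by have := hC.eq_one _ c; have := hK.fun_left hA i; omega
  have e1 := hC.six_mul_sum hA hγ (x i)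
  rw [if_neg hxC, hk, hK.fun_left hA] at e1
  have hex : ∃ p ∈ C, sideSign A x a p = -1 ∧ A (x i) p = 0 := by
    by_contra! hcon
    have e2 : ∑ t ∈ C, A (x i) t ≥
        ∑ t ∈ C, (1 - if (if t ∈ C then sideSign A x a t else 0) = 1 then (1 : ℤ) else 0) :=
      Finset.sum_le_sum fun t ht => by
        have h0 := hA.nonneg (x i) t
        rcases hsgn t ht with c | c
        · simp [ht, c, h0]
        · rcases hA.zero_or_one (x i) t with d | d
          · exact absurd d (hcon t ht c)
          · simp [ht, c, d]
    rw [Finset.sum_sub_distrib, Finset.sum_boole] at e2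
    simp only [sum_const, nsmul_eq_mul, mul_one] at e2
    omega
  obtain ⟨p, hp, hs, h0⟩ := hex
  have hd : sideDeg A x p = 2 := by
    rcases hK.sideDeg_of_fun_eq_one hA (hC.eq_one p hp) with h | h <;> omega
  refine ⟨p, hp, hs, by rw [hA.symm]; exact h0, fun j hj => ?_⟩
  rw [hA.symm]
  rw [sideDeg, Fin.sum_univ_three] at hd
  have h1 := hA.le_one (x 0) p
  have h2 := hA.le_one (x 1) p
  have h3 := hA.le_one (x 2) p
  fin_cases i <;> fin_cases j <;> simp at hj h0 ⊢ <;> omega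

theorem adj_of_mem (hA : IsSRGMatrix A) (hK : IsK33 A x a)
    (hC : IsComponentUnion A (k33Fun A x a) C) (hk : C.card = 6) {p q : W} (hp : p ∈ C)
    (hq : q ∈ C) (hps : sideSign A x a p = -1) (hqs : sideSign A x a q = 1) : A p q = 1 := by
  have hγ := hK.isBalanced hA
  have hσ : IsLocalEigen A (k33Fun A x a) (-3) fun t => if t ∈ C then sideSign A x a t else 0 :=
    hC.restrict hA (hK.isLocalEigen_sideSign hA)
  have hc := (hK.isSigning hA hC).two_mul_card_filter (hγ.sum_localEigen_neg hA hσ)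
  have e1 := hC.six_mul_sum hA hγ p
  rw [if_pos hp, hC.eq_one p hp] at e1
  have e2 : ∑ t ∈ C, ((if (if t ∈ C then sideSign A x a t else 0) = 1 then (1 : ℤ) else 0) -
      A p t) = 0 := by
    rw [Finset.sum_sub_distrib, Finset.sum_boole]
    omega
  have e3 := (Finset.sum_eq_zero_iff_of_nonneg fun t ht => ?_).1 e2 q hq
  · simp only [hq, hqs, if_true] at e3
    omega
  · have := hA.le_one p t
    rcases hK.sideSign_eq hA t (hC.eq_one t ht) with c | c
    · simp [ht, c, this]
    · rcases hA.zero_or_one p t with d | d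
      · simp [ht, c, d]
      · have := hK.sideSign_adj hA p t (hC.eq_one p hp) (hC.eq_one t ht) d
        omega

theorem exists_isPartner (hA : IsSRGMatrix A) (hK : IsK33 A x a) :
    ∃ p q, IsPartner A x a p q := by
  obtain ⟨C, hC, hk⟩ := hK.exists_card_six hA
  choose p hpC hps hp0 hp1 using hK.exists_mem_left hA hC hk
  choose q hqC hqs hq0 hq1 using (hK.swap hA).exists_mem_left hA (by rwa [k33Fun_swap]) hk
  exact ⟨p, q, hp0, hp1, hq0, hq1, fun i j => hK.adj_of_mem hA hC hk (hpC i) (hqC j) (hps i)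
    (by have := hqs j; rw [hK.sideSign_swap hA] at this; omega)⟩

end IsK33

namespace IsPartner

variable {A : W → W → ℤ} {x a p q p' q' : Fin 3 → W}

theorem swap (hA : IsSRGMatrix A) (h : IsPartner A x a p q) : IsPartner A a x q p where
  left_self := h.right_self
  left := h.right
  right_self := h.left_self
  right := h.left
  adj i j := by rw [hA.symm]; exact h.adj j i

theorem injective_left (h : IsPartner A x a p q) : Function.Injective p := fun i j hij => by
  by_contra c
  have h1 := h.left i j c
  rw [hij, h.left_self] at h1
  omega

theorem isK33 (hA : IsSRGMatrix A) (h : IsPartner A x a p q) : IsK33 A p q :=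
  ⟨h.injective_left, (h.swap hA).injective_left, h.adj⟩

theorem sideDeg_left (hA : IsSRGMatrix A) (h : IsPartner A x a p q) (i : Fin 3) :
    sideDeg A x (p i) = 2 := by
  have h0 := h.left_self i
  have h1 := h.left i
  simp only [sideDeg, hA.symm _ (p i), Fin.sum_univ_three]
  fin_cases i
  · have := h1 1 (by decide); have := h1 2 (by decide); simp at *; omega
  · have := h1 0 (by decide); have := h1 2 (by decide); simp at *; omega
  · have := h1 0 (by decide); have := h1 1 (by decide); simp at *; omega

theorem fun_left (hA : IsSRGMatrix A) (hK : IsK33 A x a) (h : IsPartner A x a p q) (i : Fin 3) :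
    k33Fun A x a (p i) = 1 ∧ sideDeg A a (p i) = 0 := by
  have h2 := h.sideDeg_left hA i
  rcases hK.cases_of hA (p i) with ⟨j, c⟩ | ⟨j, c⟩ | ⟨-, -, e1, e2, -⟩
  · rw [c, hK.sideDeg_left hA] at h2
    omega
  · rw [c, hK.sideDeg_right] at h2
    omega
  · omega

theorem fun_right (hA : IsSRGMatrix A) (hK : IsK33 A x a) (h : IsPartner A x a p q) (i : Fin 3) :
    k33Fun A x a (q i) = 1 ∧ sideDeg A x (q i) = 0 := by
  rw [k33Fun_swap]
  exact (h.swap hA).fun_left hA (hK.swap hA) i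

theorem sideDeg_add (hA : IsSRGMatrix A) (hK : IsK33 A x a) (h : IsPartner A x a p q) (u : W) :
    sideDeg A p u + sideDeg A q u = 3 * (∑ i, (if u = p i then 1 else 0) +
      ∑ i, (if u = q i then 1 else 0)) + 1 - k33Fun A x a u := by
  have hP := h.isK33 hA
  set φ : W → ℤ := fun u => ∑ i, (if u = p i then 1 else 0) + ∑ i, (if u = q i then 1 else 0)
    with hφ
  have hsum : ∀ f : W → ℤ, ∑ t, f t * φ t = ∑ i, f (p i) + ∑ i, f (q i) := fun f => by
    simp only [hφ, mul_add, Finset.sum_add_distrib, Finset.mul_sum]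
    rw [Finset.sum_comm, Finset.sum_comm (s := univ) (t := (univ : Finset (Fin 3)))
      (f := fun t i => f t * if t = q i then 1 else 0)]
    simp
  have hn : ∀ u, nbrSum A φ u = sideDeg A p u + sideDeg A q u := fun u => by
    rw [nbrSum, hsum]
    simp [sideDeg, hA.symm u]
  have h1 : ∀ t, k33Fun A x a t ≠ 1 → φ t = 0 := fun t ht => by
    have c1 : ∀ i, t ≠ p i := fun i c => ht (c ▸ (h.fun_left hA hK i).1)
    have c2 : ∀ i, t ≠ q i := fun i c => ht (c ▸ (h.fun_right hA hK i).1)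
    simp [hφ, c1, c2]
  have hp : ∀ i, φ (p i) = 1 := fun i => by
    simp [hφ, hP.inj_left.eq_iff, hP.ne hA, Finset.filter_eq]
  have hq : ∀ i, φ (q i) = 1 := fun i => by
    simp [hφ, hP.inj_right.eq_iff, fun j => (hP.ne hA j i).symm, Finset.filter_eq]
  have h2 : ∑ t, φ t * (3 * φ t - nbrSum A φ t) = 0 := by
    simp only [mul_comm (φ _), hsum, hp, hq, hn, hP.sideDeg_left hA, hP.sideDeg_right,
      (hP.swap hA).sideDeg_left hA, (hP.swap hA).sideDeg_right]
    norm_num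
  have h3 := (hK.isBalanced hA).nbrSum_of_sum_eq_zero hA h1 h2 u
  have h4 : ∑ t, φ t = 6 := by
    have := hsum fun _ => 1
    simpa using this
  rw [h4, hn] at h3
  change _ = 3 * φ u + 1 - _
  linarith

theorem exists_eq_of_adj (hA : IsSRGMatrix A) (hK : IsK33 A x a) (h : IsPartner A x a p q)
    {u : W} (hu : k33Fun A x a u = 1) (hadj : (∃ i, A (p i) u = 1) ∨ ∃ i, A (q i) u = 1) :
    (∃ i, u = p i) ∨ ∃ i, u = q i := by
  by_contra! hcon
  have h1 := h.sideDeg_add hA hK u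
  have h2 : ∀ (y : Fin 3 → W) i, A (y i) u ≤ sideDeg A y u := fun y i =>
    Finset.single_le_sum (f := fun i => A (y i) u) (fun i _ => hA.nonneg _ _) (mem_univ i)
  have h3 := IsK33.sideDeg_nonneg hA p u
  have h4 := IsK33.sideDeg_nonneg hA q u
  simp only [hcon.1, hcon.2, if_false, sum_const_zero, hu] at h1
  rcases hadj with ⟨i, hi⟩ | ⟨i, hi⟩
  · have := h2 p i
    omega
  · have := h2 q i
    omega

theorem eq_of_adj (hA : IsSRGMatrix A) (hK : IsK33 A x a) (h : IsPartner A x a p q)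
    (h' : IsPartner A x a p' q') {i j : Fin 3} (hadj : A (p i) (q' j) = 1) : p i = p' i := by
  rcases h'.exists_eq_of_adj hA hK (h.fun_left hA hK i).1
    (Or.inr ⟨j, by rw [hA.symm]; exact hadj⟩) with ⟨l, hl⟩ | ⟨l, hl⟩
  · have h1 := h.left_self i
    by_cases c : l = i
    · rw [hl, c]
    · rw [hl, h'.left l i c] at h1
      omega
  · have h1 := h.sideDeg_left hA i
    rw [hl, (h'.fun_right hA hK l).2] at h1
    omega

theorem unique (hA : IsSRGMatrix A) (hK : IsK33 A x a) (h : IsPartner A x a p q)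
    (h' : IsPartner A x a p' q') (z : Fin 3) : p z = p' z := by
  have hγ := hK.isBalanced hA
  have hP := h.isK33 hA
  have hP' := h'.isK33 hA
  by_contra hne
  have hnadj : ∀ i j, A (p i) (q' j) = 0 := fun i j => by
    rcases hA.zero_or_one (p i) (q' j) with c | c
    · exact c
    · have h1 : p i = p' i := h.eq_of_adj hA hK h' c
      have h2 : q 0 = q' 0 := (h.swap hA).eq_of_adj hA (hK.swap hA) (h'.swap hA) (i := 0)
        (j := i) (by rw [← h1, hA.symm]; exact h.adj i 0)
      exact absurd (h.eq_of_adj hA hK h' (i := z) (j := 0) (by rw [← h2]; exact h.adj z 0)) hne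
  have hpq : ∀ i j, q' j ≠ p i := fun i j c => by
    have h1 := h.sideDeg_left hA i
    rw [← c, (h'.fun_right hA hK j).2] at h1
    omega
  have h01 : p 0 ≠ p 1 := fun c => by have := hP.inj_left c; simp at this
  have hsum : ∑ t, A (p 0) t * A (p 1) t * sideDeg A q' t = 9 := by
    simp only [sideDeg, Finset.mul_sum]
    rw [Finset.sum_comm]
    have : ∀ j ∈ (univ : Finset (Fin 3)), ∑ t, A (p 0) t * A (p 1) t * A (q' j) t = 3 :=
      fun j _ => by
        rw [hA.sum_mul_mul h01 (hP.nonadj hA 0 1), if_neg (hpq 0 j), if_neg (hpq 1 j), hnadj,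
          hnadj]
        norm_num
    rw [Finset.sum_congr rfl this]
    norm_num
  have hzero : ∀ t, A (p 0) t = 1 → A (p 1) t = 1 → k33Fun A x a t ≠ 0 := fun t t0 t1 ht => by
    have s1 := hγ.sum_pair (p 0) (p 1)
    have s2 := hA.sum_mul (p 0) (p 1)
    rw [if_neg h01, hP.nonadj hA 0 1, (h.fun_left hA hK 0).1, (h.fun_left hA hK 1).1] at s1
    rw [if_neg h01, hP.nonadj hA 0 1] at s2
    have s3 : ∑ t ∈ univ.image q, A (p 0) t * A (p 1) t * (k33Fun A x a t ^ 2 + k33Fun A x a t) =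
        6 := by
      rw [Finset.sum_image fun i _ j _ hij => hP.inj_right hij]
      simp [h.adj, (h.fun_right hA hK _).1]
    have s4 : ∑ t ∈ univ.image q, A (p 0) t * A (p 1) t * (k33Fun A x a t ^ 2 + k33Fun A x a t) ≤
        ∑ t, A (p 0) t * A (p 1) t * (k33Fun A x a t ^ 2 + k33Fun A x a t) :=
      Finset.sum_le_sum_of_subset_of_nonneg (Finset.subset_univ _) fun t _ _ =>
        mul_nonneg (mul_nonneg (hA.nonneg _ _) (hA.nonneg _ _)) (by
          rcases hγ.values t with c | c | c <;> simp [c])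
    have s5 : ∑ t, A (p 0) t * A (p 1) t * (1 - k33Fun A x a t ^ 2) =
        ∑ t, A (p 0) t * A (p 1) t + ∑ t, A (p 0) t * A (p 1) t * k33Fun A x a t -
        ∑ t, A (p 0) t * A (p 1) t * (k33Fun A x a t ^ 2 + k33Fun A x a t) := by
      rw [← Finset.sum_add_distrib, ← Finset.sum_sub_distrib]
      exact Finset.sum_congr rfl fun _ _ => by ring
    have s6 := Finset.single_le_sum (s := univ)
      (f := fun t => A (p 0) t * A (p 1) t * (1 - k33Fun A x a t ^ 2))
      (fun t _ => mul_nonneg (mul_nonneg (hA.nonneg _ _) (hA.nonneg _ _)) (by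
          rcases hγ.values t with c | c | c <;> simp [c])) (mem_univ t)
    simp only [t0, t1, ht] at s6
    norm_num at s1 s2 s6
    omega
  have hdvd : (2 : ℤ) ∣ ∑ t, A (p 0) t * A (p 1) t * sideDeg A q' t := Finset.dvd_sum fun t _ => by
    rcases hA.zero_or_one (p 0) t with c0 | c0
    · simp [c0]
    rcases hA.zero_or_one (p 1) t with c1 | c1
    · simp [c1]
    refine Dvd.dvd.mul_left ?_ _
    have h1 := h'.sideDeg_add hA hK t
    rcases hγ.values t with c | c | c
    · have d1 : ∀ i, t ≠ p' i := fun i d => by have := (h'.fun_left hA hK i).1; rw [← d] at this; omega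
      have d2 : ∀ i, t ≠ q' i := fun i d => by
        have := (h'.fun_right hA hK i).1
        rw [← d] at this
        omega
      simp only [d1, d2, if_false, sum_const_zero, c] at h1
      rcases hP'.sideDeg_mul hA t with e | e <;> omega
    · exact absurd c (hzero t c0 c1)
    · suffices hs : sideDeg A q' t = 0 by simp [hs]
      refine Finset.sum_eq_zero fun j _ => ?_
      rcases hA.zero_or_one (q' j) t with d | d
      · exact d
      exfalso
      rcases h.exists_eq_of_adj hA hK c (Or.inl ⟨0, c0⟩) with ⟨l, rfl⟩ | ⟨l, rfl⟩
      · rw [hP.nonadj hA] at c0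
        omega
      · rcases h'.exists_eq_of_adj hA hK c (Or.inr ⟨j, d⟩) with ⟨m, hm⟩ | ⟨m, hm⟩
        · have g1 := h'.sideDeg_left hA m
          rw [← hm, (h.fun_right hA hK l).2] at g1
          omega
        · rw [hm, (hP'.swap hA).nonadj hA] at d
          omega
  rw [hsum] at hdvd
  omega

end IsPartner

end

section

variable {W : Type*} [Fintype W] [DecidableEq W]

/-- The vertices `a, b, c, d` are common neighbours of `x` and `y`, any three of which have a
common neighbour, and `x'`, `y'` are adjacent to these four common neighbours and to one of `x`
and `y`. -/
structure IsQuad (A : W → W → ℤ) (x y a b c d : W) : Prop where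
  adj : ∀ t ∈ [a, b, c, d], A x t = 1 ∧ A y t = 1
  nodup : [a, b, c, d].Nodup
  exists_adj : ∃ x' y' ta tb tc td : W, A x' x = 0 ∧ A x' y = 1 ∧ A y' x = 1 ∧ A y' y = 0 ∧
    (∀ t ∈ [ta, tb, tc, td], A x' t = 1 ∧ A y' t = 1) ∧
    (A ta b = 1 ∧ A ta c = 1 ∧ A ta d = 1) ∧ (A tb a = 1 ∧ A tb c = 1 ∧ A tb d = 1) ∧
    (A tc a = 1 ∧ A tc b = 1 ∧ A tc d = 1) ∧ (A td a = 1 ∧ A td b = 1 ∧ A td c = 1)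

variable {A : W → W → ℤ} {x y : W}

theorem isK33_of_adj {z a b c : W} (hxy : x ≠ y) (hzx : z ≠ x) (hzy : z ≠ y)
    (hab : a ≠ b) (hac : a ≠ c) (hbc : b ≠ c) (h1 : A x a = 1 ∧ A x b = 1 ∧ A x c = 1)
    (h2 : A y a = 1 ∧ A y b = 1 ∧ A y c = 1) (h3 : A z a = 1 ∧ A z b = 1 ∧ A z c = 1) :
    IsK33 A ![x, y, z] ![a, b, c] where
  inj_left i j h := by
    fin_cases i <;> fin_cases j <;> simp_all [hxy.symm, hzx.symm, hzy.symm]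
  inj_right i j h := by
    fin_cases i <;> fin_cases j <;> simp_all [hab.symm, hac.symm, hbc.symm]
  adj i j := by
    fin_cases i <;> fin_cases j <;> simp [h1, h2, h3]

/-- A vertex adjacent to three common neighbours of `x` and `y` is not adjacent to a fourth. -/
theorem adj_eq_zero_of_adj (hA : IsSRGMatrix A) {z a b c d : W} (hxy : x ≠ y) (hzx : z ≠ x)
    (hzy : z ≠ y) (hab : a ≠ b) (hac : a ≠ c) (hbc : b ≠ c) (had : a ≠ d) (hbd : b ≠ d)
    (hcd : c ≠ d) (h1 : A x a = 1 ∧ A x b = 1 ∧ A x c = 1 ∧ A x d = 1)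
    (h2 : A y a = 1 ∧ A y b = 1 ∧ A y c = 1 ∧ A y d = 1)
    (h3 : A z a = 1 ∧ A z b = 1 ∧ A z c = 1) : A z d = 0 := by
  have hK := isK33_of_adj hxy hzx hzy hab hac hbc ⟨h1.1, h1.2.1, h1.2.2.1⟩
    ⟨h2.1, h2.2.1, h2.2.2.1⟩ h3
  rcases hA.zero_or_one z d with e | e
  · exact e
  · obtain ⟨j, hj⟩ := hK.eq_of_adj hA (u := d) fun i => by fin_cases i <;> simp [h1, h2, e]
    fin_cases j <;> simp at hj <;> simp_all

namespace IsQuad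

variable {a b c d : W}

theorem rotate (h : IsQuad A x y a b c d) : IsQuad A x y a c d b := by
  obtain ⟨h1, h2, x', y', ta, tb, tc, td, e1, e2, e3, e4, e5, ⟨a1, a2, a3⟩, ⟨b1, b2, b3⟩,
    ⟨c1, c2, c3⟩, ⟨d1, d2, d3⟩⟩ := h
  simp only [List.mem_cons, List.not_mem_nil, or_false, forall_eq_or_imp, forall_eq] at h1 e5
  refine ⟨by simp [h1], ?_, x', y', ta, tc, td, tb, e1, e2, e3, e4, by simp [e5], ⟨a2, a3, a1⟩,
    ⟨c1, c3, c2⟩, ⟨d1, d3, d2⟩, ⟨b1, b2, b3⟩⟩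
  simp only [List.nodup_cons, List.mem_cons, List.not_mem_nil, or_false, not_or, not_false_eq_true,
    List.nodup_nil, and_true] at h2 ⊢
  exact ⟨⟨h2.1.2.1, h2.1.2.2, h2.1.1⟩, ⟨h2.2.2, Ne.symm h2.2.1.1⟩, Ne.symm h2.2.1.2⟩

theorem unique (hA : IsSRGMatrix A) (hxy : x ≠ y) {d' : W} (h : IsQuad A x y a b c d)
    (h' : IsQuad A x y a b c d') : d = d' := by
  have key : ∀ d, IsQuad A x y a b c d → ∃ z p q, (A a z = 1 ∧ A b z = 1 ∧ A c z = 1) ∧ z ≠ x ∧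
      z ≠ y ∧ IsK33 A ![x, y, z] ![a, b, c] ∧
      IsPartner A ![x, y, z] ![a, b, c] p q ∧ p 2 = d := fun d h => by
    obtain ⟨h1, h2, x', y', ta, tb, tc, td, e1, e2, e3, e4, e5, ⟨a1, a2, a3⟩, ⟨b1, b2, b3⟩,
      ⟨c1, c2, c3⟩, ⟨d1, d2, d3⟩⟩ := h
    simp only [List.mem_cons, List.not_mem_nil, or_false, forall_eq_or_imp, forall_eq] at h1 e5
    obtain ⟨⟨xa, ya⟩, ⟨xb, yb⟩, ⟨xc, yc⟩, xd, yd⟩ := h1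
    simp only [List.nodup_cons, List.mem_cons, List.not_mem_nil, or_false, not_or,
      not_false_eq_true, List.nodup_nil, and_true] at h2
    obtain ⟨⟨ab, ac, ad⟩, ⟨bc, bd⟩, cd⟩ := h2
    have hne : ∀ t, A x' t = 1 ∧ A y' t = 1 → t ≠ x ∧ t ≠ y := fun t ht =>
      ⟨fun c => by have := ht.1; rw [c, e1] at this; omega,
        fun c => by have := ht.2; rw [c, e4] at this; omega⟩
    obtain ⟨fa, fb, fc, fd⟩ := e5
    rw [← ne_eq] at ab ac ad bc bd cd
    refine ⟨td, ![x', y', d], ![ta, tb, tc], ⟨by rw [hA.symm, d1], by rw [hA.symm, d2],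
      by rw [hA.symm, d3]⟩, (hne _ fd).1, (hne _ fd).2,
      isK33_of_adj hxy (hne _ fd).1 (hne _ fd).2 ab ac bc ⟨xa, xb, xc⟩ ⟨ya, yb, yc⟩
        ⟨d1, d2, d3⟩, ?_, rfl⟩
    have na : A ta a = 0 := adj_eq_zero_of_adj hA hxy (hne _ fa).1 (hne _ fa).2 bc bd cd ab.symm
      ac.symm ad.symm ⟨xb, xc, xd, xa⟩ ⟨yb, yc, yd, ya⟩ ⟨a1, a2, a3⟩
    have nb : A tb b = 0 := adj_eq_zero_of_adj hA hxy (hne _ fb).1 (hne _ fb).2 ac ad cd ab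
      bc.symm bd.symm ⟨xa, xc, xd, xb⟩ ⟨ya, yc, yd, yb⟩ ⟨b1, b2, b3⟩
    have nc : A tc c = 0 := adj_eq_zero_of_adj hA hxy (hne _ fc).1 (hne _ fc).2 ab ad bd ac
      bc cd.symm ⟨xa, xb, xd, xc⟩ ⟨ya, yb, yd, yc⟩ ⟨c1, c2, c3⟩
    have nd : A td d = 0 := adj_eq_zero_of_adj hA hxy (hne _ fd).1 (hne _ fd).2 ab ac bc ad
      bd cd ⟨xa, xb, xc, xd⟩ ⟨ya, yb, yc, yd⟩ ⟨d1, d2, d3⟩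
    refine ⟨fun i => ?_, fun i j hij => ?_, fun i => ?_, fun i j hij => ?_, fun i j => ?_⟩
    · fin_cases i <;> simp [e1, e4, hA.symm d, nd]
    · fin_cases i <;> fin_cases j <;> simp [e2, e3, fd, hA.symm d, xd, yd] at hij ⊢
    · fin_cases i <;> simp [na, nb, nc]
    · fin_cases i <;> fin_cases j <;> simp [a1, a2, b1, b2, c1, c2] at hij ⊢
    · fin_cases i <;> fin_cases j <;> simp [fa, fb, fc, hA.symm d, a3, b3, c3]
  obtain ⟨z, p, q, hz, hzx, hzy, hK, hP, rfl⟩ := key d h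
  obtain ⟨z', p', q', hz', hzx', hzy', hK', hP', rfl⟩ := key d' h'
  obtain ⟨i, hi⟩ := (hK.swap hA).eq_of_adj hA (u := z') fun i => by fin_cases i <;> simp [hz']
  have hzz : z' = z := by
    fin_cases i
    · exact absurd hi hzx'
    · exact absurd hi hzy'
    · exact hi
  subst hzz
  exact hP.unique hA hK hP' 2

end IsQuad

theorem exists_isQuad (hA : IsSRGMatrix A) (hxy : x ≠ y) {a b c : W}
    (ha : A x a = 1 ∧ A y a = 1) (hb : A x b = 1 ∧ A y b = 1) (hc : A x c = 1 ∧ A y c = 1)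
    (hab : a ≠ b) (hac : a ≠ c) (hbc : b ≠ c) : ∃ d, IsQuad A x y a b c d := by
  have nadj : ∀ s t, A x s = 1 → A x t = 1 → A s t = 0 := fun s t hs ht =>
    hA.triangle_free s x t (by rw [hA.symm, hs]) ht
  have e1 := hA.sum_mul_mul hab (nadj a b ha.1 hb.1) c
  rw [if_neg hac.symm, if_neg hbc.symm, nadj a c ha.1 hc.1, nadj b c hb.1 hc.1] at e1
  obtain ⟨z, hz, hzx, hzy⟩ : ∃ z, A a z * A b z * A c z ≠ 0 ∧ z ≠ x ∧ z ≠ y := by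
    by_contra! hcon
    have : ∑ t, A a t * A b t * A c t ≤ ∑ t ∈ {x, y}, A a t * A b t * A c t := by
      rw [← Finset.sum_subset (Finset.subset_univ ({x, y} : Finset W)) fun t _ ht => ?_]
      simp only [mem_insert, mem_singleton, not_or] at ht
      by_contra d
      exact ht.2 (hcon t d ht.1)
    rw [Finset.sum_pair hxy] at this
    simp only [hA.symm _ x, hA.symm _ y, ha, hb, hc] at this
    omega
  have hza : A z a = 1 ∧ A z b = 1 ∧ A z c = 1 := by
    simp only [hA.symm z]
    refine ⟨?_, ?_, ?_⟩
    · rcases hA.zero_or_one a z with d | d <;> simp_all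
    · rcases hA.zero_or_one b z with d | d <;> simp_all
    · rcases hA.zero_or_one c z with d | d <;> simp_all
  have hK := isK33_of_adj hxy hzx hzy hab hac hbc ⟨ha.1, hb.1, hc.1⟩ ⟨ha.2, hb.2, hc.2⟩ hza
  obtain ⟨p, q, hP⟩ := hK.exists_isPartner hA
  have hl := hP.left_self
  have hr := hP.right_self
  have l01 := hP.left 0 1 (by decide)
  have l02 := hP.left 0 2 (by decide)
  have l10 := hP.left 1 0 (by decide)
  have l12 := hP.left 1 2 (by decide)
  have l20 := hP.left 2 0 (by decide)
  have l21 := hP.left 2 1 (by decide)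
  have r01 := hP.right 0 1 (by decide)
  have r02 := hP.right 0 2 (by decide)
  have r10 := hP.right 1 0 (by decide)
  have r12 := hP.right 1 2 (by decide)
  have r20 := hP.right 2 0 (by decide)
  have r21 := hP.right 2 1 (by decide)
  have l00 := hP.left_self 0
  have l11 := hP.left_self 1
  have l22 := hP.left_self 2
  have hd := hP.adj 2
  have hpq : ∀ i j, A (q j) (p i) = 1 := fun i j => by rw [hA.symm, hP.adj]
  simp only [Matrix.cons_val_zero, Matrix.cons_val_one, Matrix.cons_val] at *
  have hne : ∀ t, A z t = 1 → t ≠ p 2 := fun t ht c => by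
    rw [c, hA.symm, l22] at ht
    omega
  refine ⟨p 2, ?_, ?_, p 0, p 1, q 0, q 1, q 2, z, l00, l01, l10, l11, ?_, ⟨r01, r02, hpq _ _⟩,
    ⟨r10, r12, hpq _ _⟩, ⟨r20, r21, hpq _ _⟩, hza⟩
  · simp [hA.symm x, hA.symm y, l20, l21]
    simp only [hA.symm _ x, hA.symm _ y, ha, hb, hc, and_self]
  · simp [hab, hac, hbc, hne a hza.1, hne b hza.2.1, hne c hza.2.2]
  · simp [hP.adj, l02, l12]

/-- There is no strongly regular graph with parameters `(324, 57, 0, 12)`. -/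
theorem IsSRGMatrix.false (hA : IsSRGMatrix A) : False := by
  have hxy : ∃ x y, x ≠ y ∧ A x y = 0 := by
    have : Nonempty W := Fintype.card_pos_iff.1 (by rw [hA.card]; norm_num)
    obtain ⟨x⟩ := this
    by_contra! hcon
    have h1 := hA.sum_row x
    have h2 : ∑ t, A x t ≥ ∑ t, (1 - if t = x then 1 else 0) := Finset.sum_le_sum fun t _ => by
      rcases hA.zero_or_one x t with c | c
      · have : t = x := by
          by_contra d
          exact hcon x t (Ne.symm d) c
        simp [this, hA.loopless]
      · rw [c]; split_ifs <;> norm_num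
    rw [Finset.sum_sub_distrib, hA.sum_const] at h2
    simp at h2
    omega
  obtain ⟨x, y, hne, hxy⟩ := hxy
  have hadj : ∀ t, A x t * A y t = if A x t = 1 ∧ A y t = 1 then 1 else 0 := fun t => by
    rcases hA.zero_or_one x t with c | c <;> rcases hA.zero_or_one y t with d | d <;> simp [c, d]
  have hcard : (univ.filter fun t => A x t = 1 ∧ A y t = 1).card = 12 := by
    have h1 := hA.sum_mul x y
    simp only [hadj, if_neg hne, hxy, Finset.sum_boole] at h1
    push_cast at h1
    omega
  set S := univ.filter fun t => A x t = 1 ∧ A y t = 1 with hS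
  obtain ⟨a, ha⟩ : S.Nonempty := Finset.card_pos.1 (by omega)
  have hmem : ∀ t, t ∈ S ↔ A x t = 1 ∧ A y t = 1 := fun t => by simp [hS]
  have hex : ∀ b c, b ∈ S.erase a → c ∈ S.erase a → b ≠ c → ∃ d, IsQuad A x y a b c d :=
    fun b c hb hc hbc => exists_isQuad hA hne ((hmem a).1 ha)
      ((hmem b).1 (Finset.mem_of_mem_erase hb)) ((hmem c).1 (Finset.mem_of_mem_erase hc))
      (Finset.ne_of_mem_erase hb).symm (Finset.ne_of_mem_erase hc).symm hbc
  choose! g hg using hex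
  let T := {s : W × W // s ∈ (S.erase a).offDiag}
  have hT : ∀ s : T, s.1.1 ∈ S.erase a ∧ s.1.2 ∈ S.erase a ∧ s.1.1 ≠ s.1.2 := fun s => by
    simpa only [mem_offDiag] using s.2
  have hgT : ∀ s : T, IsQuad A x y a s.1.1 s.1.2 (g s.1.1 s.1.2) := fun s =>
    hg _ _ (hT s).1 (hT s).2.1 (hT s).2.2
  let f : Function.End T := fun s => ⟨(s.1.2, g s.1.1 s.1.2), by
    have h := hgT s
    have h1 := h.adj (g s.1.1 s.1.2) (by simp)
    have h2 := h.nodup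
    simp only [List.nodup_cons, List.mem_cons, List.not_mem_nil, or_false, not_or,
      not_false_eq_true, List.nodup_nil, and_true] at h2
    simp only [mem_offDiag, mem_erase, hmem]
    exact ⟨⟨(Finset.ne_of_mem_erase (hT s).2.1), (hmem _).1 (Finset.mem_of_mem_erase (hT s).2.1)⟩,
      ⟨Ne.symm h2.1.2.2, h1⟩, h2.2.2⟩⟩
  have hf1 : ∀ s : T, g s.1.2 (g s.1.1 s.1.2) = s.1.1 := fun s =>
    (hgT (f s)).unique hA hne (hgT s).rotate
  have hf3 : f ^ 3 ^ 1 = 1 := by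
    funext s
    have h1 := hf1 s
    have h2 : g (g s.1.1 s.1.2) (g s.1.2 (g s.1.1 s.1.2)) = s.1.2 := hf1 (f s)
    have e : (f ^ 3 ^ 1) s = f (f (f s)) := rfl
    rw [e]
    refine Subtype.ext (Prod.ext ?_ ?_)
    · exact h1
    · exact h2
  classical
  have hmod := Equiv.Perm.card_fixedPoints_modEq (p := 3) hf3
  have h0 : Fintype.card (Function.fixedPoints f) = 0 := by
    rw [Fintype.card_eq_zero_iff]
    refine ⟨fun ⟨s, hs⟩ => (hT s).2.2 ?_⟩
    have := congrArg (fun s : T => s.1.1) (show f s = s from hs)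
    exact this.symm
  have h110 : Fintype.card T = 110 := by
    rw [Fintype.card_coe, Finset.offDiag_card, Finset.card_erase_of_mem ha, hcard]
  rw [h0, h110] at hmod
  exact absurd hmod (by decide)

end

section

variable {V : Type*} [Fintype V] [DecidableEq V]

/-- `B` is the adjacency matrix of a strongly regular graph with parameters `(266, 45, 0, 9)`. -/
structure IsSubSRGMatrix (B : V → V → ℤ) : Prop where
  symm : ∀ u v, B u v = B v u
  zero_or_one : ∀ u v, B u v = 0 ∨ B u v = 1
  loopless : ∀ u, B u u = 0
  sum_mul : ∀ u v, ∑ t, B u t * B v t = 9 - 9 * B u v + if u = v then 36 else 0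
  card : Fintype.card V = 266

/-- `c` is the indicator function of a coclique of size `56`. -/
structure IsCocliqueFun (B : V → V → ℤ) (c : V → ℤ) : Prop where
  zero_or_one : ∀ x, c x = 0 ∨ c x = 1
  sum_eq : ∑ x, c x = 56
  eq_zero : ∀ x y, c x = 1 → c y = 1 → B x y = 0

namespace IsSubSRGMatrix

variable {B : V → V → ℤ}

theorem nonneg (hB : IsSubSRGMatrix B) (u v : V) : 0 ≤ B u v := by
  rcases hB.zero_or_one u v with h | h <;> omega

theorem sum_const (hB : IsSubSRGMatrix B) (c : ℤ) : ∑ _t : V, c = 266 * c := by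
  simp [hB.card]

theorem sum_row (hB : IsSubSRGMatrix B) (u : V) : ∑ t, B u t = 45 := by
  have h := hB.sum_mul u u
  rw [if_pos rfl, hB.loopless] at h
  rw [← sub_eq_zero] at h ⊢
  rw [← h]
  have : ∀ t ∈ univ, B u t = B u t * B u t := fun t _ => by
    rcases hB.zero_or_one u t with h | h <;> simp [h]
  rw [Finset.sum_congr rfl this]
  norm_num

theorem sum_nbrSum (hB : IsSubSRGMatrix B) (φ : V → ℤ) :
    ∑ t, nbrSum B φ t = 45 * ∑ t, φ t := by
  simp only [nbrSum]
  rw [Finset.sum_comm, Finset.mul_sum]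
  refine Finset.sum_congr rfl fun t _ => ?_
  rw [← Finset.sum_mul, ← hB.sum_row t]
  simp only [hB.symm t]

theorem sum_sq_nbrSum (hB : IsSubSRGMatrix B) (φ : V → ℤ) :
    ∑ t, nbrSum B φ t ^ 2 = 9 * (∑ t, φ t) ^ 2 - 9 * ∑ t, φ t * nbrSum B φ t +
      36 * ∑ t, φ t ^ 2 := by
  have h1 : ∑ t, nbrSum B φ t ^ 2 = ∑ s, ∑ t, φ s * φ t * ∑ x, B s x * B t x := by
    simp only [nbrSum, sq, Finset.sum_mul_sum]
    simp only [Finset.mul_sum]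
    rw [Finset.sum_comm]
    refine Finset.sum_congr rfl fun s _ => ?_
    rw [Finset.sum_comm]
    refine Finset.sum_congr rfl fun t _ => Finset.sum_congr rfl fun x _ => ?_
    rw [hB.symm s, hB.symm t]
    ring
  have h2 : ∀ s, ∑ t, φ s * φ t * ∑ x, B s x * B t x =
      9 * (φ s * ∑ t, φ t) - 9 * (φ s * nbrSum B φ s) + 36 * φ s ^ 2 := fun s => by
    simp only [hB.sum_mul, mul_add, Finset.sum_add_distrib, mul_ite, mul_zero,
      Finset.sum_ite_eq, mem_univ, if_true, nbrSum, Finset.mul_sum, ← Finset.sum_sub_distrib]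
    congr 1
    · exact Finset.sum_congr rfl fun _ _ => by ring
    · ring
  rw [h1, Finset.sum_congr rfl fun s _ => h2 s, Finset.sum_add_distrib, Finset.sum_sub_distrib,
    ← Finset.mul_sum, ← Finset.mul_sum, ← Finset.mul_sum, ← Finset.sum_mul]
  ring

end IsSubSRGMatrix

namespace IsCocliqueFun

variable {B : V → V → ℤ} {c c' : V → ℤ}

theorem sq (hc : IsCocliqueFun B c) (x : V) : c x * c x = c x := by
  rcases hc.zero_or_one x with h | h <;> simp [h]

theorem mul_nbrSum (hc : IsCocliqueFun B c) (x : V) : c x * nbrSum B c x = 0 := by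
  rw [nbrSum, Finset.mul_sum]
  refine Finset.sum_eq_zero fun t _ => ?_
  rcases hc.zero_or_one x with h | h
  · simp [h]
  rcases hc.zero_or_one t with h' | h'
  · simp [h']
  simp [hc.eq_zero x t h h']

/-- Each vertex outside a coclique of size `56` has `12` neighbours inside. -/
theorem nbrSum_eq (hB : IsSubSRGMatrix B) (hc : IsCocliqueFun B c) (x : V) :
    nbrSum B c x = 12 * (1 - c x) := by
  have h0 : ∑ x, (nbrSum B c x - 12 * (1 - c x)) ^ 2 = 0 := by
    have e : ∀ x ∈ univ, (nbrSum B c x - 12 * (1 - c x)) ^ 2 =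
        nbrSum B c x ^ 2 - 24 * nbrSum B c x + 144 - 144 * c x := fun x _ => by
      linear_combination 24 * hc.mul_nbrSum x + 144 * hc.sq x
    rw [Finset.sum_congr rfl e, Finset.sum_sub_distrib, Finset.sum_add_distrib,
      Finset.sum_sub_distrib, hB.sum_const, ← Finset.mul_sum, ← Finset.mul_sum, hB.sum_nbrSum,
      hB.sum_sq_nbrSum]
    simp only [hc.mul_nbrSum, pow_two (c _), hc.sq, hc.sum_eq, sum_const_zero]
    norm_num
  have h1 := (Finset.sum_eq_zero_iff_of_nonneg fun x _ => sq_nonneg _).1 h0 x (mem_univ x)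
  have h2 := pow_eq_zero_iff (two_ne_zero) |>.1 h1
  linarith

/-- Two different cocliques of size `56` meet in at most `11` vertices. -/
theorem sum_mul_le (hB : IsSubSRGMatrix B) (hc : IsCocliqueFun B c) (hc' : IsCocliqueFun B c')
    (hne : c ≠ c') : ∑ x, c x * c' x ≤ 11 := by
  set d : V → ℤ := fun x => c x * c' x with hd
  set w : V → ℤ := fun x => (1 - c x) * (1 - c' x) with hw
  have n1 : ∀ x, 0 ≤ c x ∧ c x ≤ 1 := fun x => by rcases hc.zero_or_one x with h | h <;> omega
  have n2 : ∀ x, 0 ≤ c' x ∧ c' x ≤ 1 := fun x => by rcases hc'.zero_or_one x with h | h <;> omega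
  have hdn : ∀ x, 0 ≤ nbrSum B d x := fun x => Finset.sum_nonneg fun t _ =>
    mul_nonneg (hB.nonneg _ _) (mul_nonneg (n1 t).1 (n2 t).1)
  have hdc : ∀ x, nbrSum B d x ≤ nbrSum B c x := fun x => Finset.sum_le_sum fun t _ =>
    mul_le_mul_of_nonneg_left (mul_le_of_le_one_right (n1 t).1 (n2 t).2) (hB.nonneg _ _)
  have hdc' : ∀ x, nbrSum B d x ≤ nbrSum B c' x := fun x => Finset.sum_le_sum fun t _ =>
    mul_le_mul_of_nonneg_left (mul_le_of_le_one_left (n2 t).1 (n1 t).2) (hB.nonneg _ _)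
  have hmul : ∀ x, nbrSum B d x * w x = nbrSum B d x := fun x => by
    have h1 := hdc x
    have h2 := hdc' x
    have h3 := hdn x
    rw [hc.nbrSum_eq hB] at h1
    rw [hc'.nbrSum_eq hB] at h2
    rcases hc.zero_or_one x with h | h
    · rcases hc'.zero_or_one x with h' | h'
      · simp [hw, h, h']
      · have : nbrSum B d x = 0 := by rw [h'] at h2; omega
        simp [this]
    · have : nbrSum B d x = 0 := by rw [h] at h1; omega
      simp [this]
  have hdd : ∀ x, d x * nbrSum B d x = 0 := fun x => by
    have h1 := hmul x
    have h2 : d x * w x = 0 := by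
      simp only [hd, hw]
      linear_combination (1 - c' x) * (-c' x) * hc.sq x
    rw [← h1]
    linear_combination nbrSum B d x * h2
  have hd2 : ∀ x, d x ^ 2 = d x := fun x => by
    simp only [hd]
    linear_combination c' x ^ 2 * hc.sq x + c x * hc'.sq x
  have hw2 : ∀ x, w x ^ 2 = w x := fun x => by
    simp only [hw]
    rcases hc.zero_or_one x with h | h <;> rcases hc'.zero_or_one x with h' | h' <;> simp [h, h']
  have hws : ∑ x, w x = 154 + ∑ x, d x := by
    have e : ∀ x ∈ univ, w x = 1 - c x - c' x + d x := fun x _ => by simp only [hw, hd]; ring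
    rw [Finset.sum_congr rfl e, Finset.sum_add_distrib, Finset.sum_sub_distrib,
      Finset.sum_sub_distrib, hc.sum_eq, hc'.sum_eq, hB.sum_const]
    ring
  have hcs := Finset.sum_mul_sq_le_sq_mul_sq univ (nbrSum B d) w
  simp only [hmul, hw2, hws, hB.sum_nbrSum, hB.sum_sq_nbrSum, hdd, hd2, sum_const_zero] at hcs
  have hd0 : 0 ≤ ∑ x, d x := Finset.sum_nonneg fun x _ => mul_nonneg (n1 x).1 (n2 x).1
  have e1 : ∑ x, c x * (1 - c' x) = 56 - ∑ x, d x := by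
    rw [← hc.sum_eq, ← Finset.sum_sub_distrib]
    exact Finset.sum_congr rfl fun x _ => by simp only [hd]; ring
  have e2 : ∑ x, c' x * (1 - c x) = 56 - ∑ x, d x := by
    rw [← hc'.sum_eq, ← Finset.sum_sub_distrib]
    exact Finset.sum_congr rfl fun x _ => by simp only [hd]; ring
  have p1 : ∀ x ∈ univ, 0 ≤ c x * (1 - c' x) := fun x _ =>
    mul_nonneg (n1 x).1 (by linarith [(n2 x).2])
  have p2 : ∀ x ∈ univ, 0 ≤ c' x * (1 - c x) := fun x _ =>
    mul_nonneg (n2 x).1 (by linarith [(n1 x).2])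
  have hlt : ∑ x, d x ≤ 55 := by
    by_contra hcon
    have := Finset.sum_nonneg p1
    have z1 := (Finset.sum_eq_zero_iff_of_nonneg p1).1 (by omega)
    have z2 := (Finset.sum_eq_zero_iff_of_nonneg p2).1 (by omega)
    refine hne (funext fun x => ?_)
    linarith [z1 x (mem_univ x), z2 x (mem_univ x), mul_comm (c x) (c' x)]
  by_contra hcon
  generalize ∑ x, d x = i at *
  have h12 : 12 ≤ i := by omega
  have h3 : 225 * i ≤ (i + 4) * (154 + i) := by
    have : (9 * i) * (225 * i) ≤ (9 * i) * ((i + 4) * (154 + i)) := by nlinarith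
    exact le_of_mul_le_mul_left this (by omega)
  nlinarith [mul_nonneg (sub_nonneg.2 h12) (sub_nonneg.2 hlt)]

end IsCocliqueFun

section family

variable {B : V → V → ℤ} {ι : Type*} [Fintype ι] [DecidableEq ι] {c : ι → V → ℤ}

theorem sum_sq_sum (c : ι → V → ℤ) :
    ∑ x, (∑ i, c i x) ^ 2 = ∑ i, ∑ j, ∑ x, c i x * c j x := by
  simp only [sq, Finset.sum_mul_sum]
  rw [Finset.sum_comm]
  exact Finset.sum_congr rfl fun i _ => Finset.sum_comm

/-- In a family of `57` cocliques of size `56`, any two meet in `11` vertices. -/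
theorem sum_mul_eq (hB : IsSubSRGMatrix B) (hc : ∀ i, IsCocliqueFun B (c i))
    (hinj : Function.Injective c) (hι : Fintype.card ι = 57) (i j : ι) :
    ∑ x, c i x * c j x = 11 + if i = j then 45 else 0 := by
  have h1 : ∑ x, ∑ i, c i x = 3192 := by
    rw [Finset.sum_comm]
    simp [(hc _).sum_eq, hι]
  have h2 : ∀ i j, ∑ x, c i x * c j x ≤ 11 + if i = j then 45 else 0 := fun i j => by
    split_ifs with h
    · subst h
      simp [(hc _).sq, (hc _).sum_eq]
    · simpa using (hc i).sum_mul_le hB (hc j) fun e => h (hinj e)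
  have h3 : ∑ i : ι, ∑ j : ι, ((11 : ℤ) + if i = j then 45 else 0) = 38304 := by
    simp [Finset.sum_add_distrib, hι]
  have h4 : 0 ≤ ∑ x, (∑ i, c i x - 12) ^ 2 := Finset.sum_nonneg fun _ _ => sq_nonneg _
  have h5 : ∑ x, (∑ i, c i x - 12) ^ 2 = ∑ x, (∑ i, c i x) ^ 2 - 38304 := by
    have e : ∀ x ∈ univ, (∑ i, c i x - 12) ^ 2 = (∑ i, c i x) ^ 2 - 24 * ∑ i, c i x + 144 :=
      fun x _ => by ring
    rw [Finset.sum_congr rfl e, Finset.sum_add_distrib, Finset.sum_sub_distrib, hB.sum_const,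
      ← Finset.mul_sum, h1]
    ring
  rw [h5, sum_sq_sum] at h4
  have h6 : ∑ i, ∑ j, (11 + (if i = j then 45 else 0) - ∑ x, c i x * c j x) = 0 := by
    refine le_antisymm ?_ (Finset.sum_nonneg fun i _ => Finset.sum_nonneg fun j _ => ?_)
    · simp only [Finset.sum_sub_distrib, h3]
      linarith
    · linarith [h2 i j]
  have h7 := (Finset.sum_eq_zero_iff_of_nonneg fun i _ => Finset.sum_nonneg fun j _ => by
    linarith [h2 i j]).1 h6 i (mem_univ i)
  have h8 := (Finset.sum_eq_zero_iff_of_nonneg fun j _ => by linarith [h2 i j]).1 h7 j (mem_univ j)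
  linarith

theorem sum_index_eq (hB : IsSubSRGMatrix B) (hc : ∀ i, IsCocliqueFun B (c i))
    (hinj : Function.Injective c) (hι : Fintype.card ι = 57) (x : V) : ∑ i, c i x = 12 := by
  have h1 : ∑ x, ∑ i, c i x = 3192 := by
    rw [Finset.sum_comm]
    simp [(hc _).sum_eq, hι]
  have h3 : ∑ i : ι, ∑ j : ι, ((11 : ℤ) + if i = j then 45 else 0) = 38304 := by
    simp [Finset.sum_add_distrib, hι]
  have h5 : ∑ x, (∑ i, c i x - 12) ^ 2 = 0 := by
    have e : ∀ x ∈ univ, (∑ i, c i x - 12) ^ 2 = (∑ i, c i x) ^ 2 - 24 * ∑ i, c i x + 144 :=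
      fun x _ => by ring
    rw [Finset.sum_congr rfl e, Finset.sum_add_distrib, Finset.sum_sub_distrib, hB.sum_const,
      ← Finset.mul_sum, h1, sum_sq_sum]
    simp only [sum_mul_eq hB hc hinj hι, h3]
    norm_num
  have h6 := (Finset.sum_eq_zero_iff_of_nonneg fun x _ => sq_nonneg _).1 h5 x (mem_univ x)
  linarith [pow_eq_zero_iff two_ne_zero |>.1 h6]

/-- Two vertices lie in `12`, `3` or `0` common cocliques of the family. -/
theorem sum_index_mul_eq (hB : IsSubSRGMatrix B) (hc : ∀ i, IsCocliqueFun B (c i))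
    (hinj : Function.Injective c) (hι : Fintype.card ι = 57) (x y : V) :
    ∑ i, c i x * c i y = 3 * (1 - B x y) + if x = y then 9 else 0 := by
  have hsq : ∑ x, ∑ y, (∑ i, c i x * c i y) ^ 2 = 564984 := by
    have e : ∀ x y, (∑ i, c i x * c i y) ^ 2 = ∑ i, ∑ j, (c i x * c j x) * (c i y * c j y) :=
      fun x y => by
        rw [sq, Finset.sum_mul_sum]
        exact Finset.sum_congr rfl fun _ _ => Finset.sum_congr rfl fun _ _ => by ring
    have e2 : ∑ x, ∑ y, ∑ i, ∑ j, (c i x * c j x) * (c i y * c j y) =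
        ∑ i, ∑ j, (∑ x, c i x * c j x) * ∑ y, c i y * c j y := by
      simp only [Finset.sum_mul_sum]
      rw [Finset.sum_congr rfl fun x _ => Finset.sum_comm, Finset.sum_comm]
      refine Finset.sum_congr rfl fun i _ => ?_
      rw [Finset.sum_congr rfl fun x _ => Finset.sum_comm, Finset.sum_comm]
    simp only [e, e2, sum_mul_eq hB hc hinj hι]
    have e3 : ∀ i j : ι, ((11 : ℤ) + if i = j then 45 else 0) * (11 + if i = j then 45 else 0) =
        121 + if i = j then 3015 else 0 := fun i j => by split_ifs <;> norm_num
    simp [e3, Finset.sum_add_distrib, hι]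
  have hN : ∑ x, ∑ y, ∑ i, c i x * c i y = 178752 := by
    rw [Finset.sum_congr rfl fun x _ => Finset.sum_comm, Finset.sum_comm]
    simp [← Finset.mul_sum, ← Finset.sum_mul, (hc _).sum_eq, hι]
  have hNB : ∀ x y, (∑ i, c i x * c i y) * B x y = 0 := fun x y => by
    rw [Finset.sum_mul]
    refine Finset.sum_eq_zero fun i _ => ?_
    rcases (hc i).zero_or_one x with h | h
    · simp [h]
    rcases (hc i).zero_or_one y with h' | h'
    · simp [h']
    simp [(hc i).eq_zero x y h h']
  have hdiag : ∀ x, ∑ i, c i x * c i x = 12 := fun x => by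
    simp only [(hc _).sq, sum_index_eq hB hc hinj hι]
  have h0 : ∑ x, ∑ y, (∑ i, c i x * c i y - (3 * (1 - B x y) + if x = y then 9 else 0)) ^ 2 =
      0 := by
    have e : ∀ x y, (∑ i, c i x * c i y - (3 * (1 - B x y) + if x = y then 9 else 0)) ^ 2 =
        (∑ i, c i x * c i y) ^ 2 - 6 * ∑ i, c i x * c i y + 9 - 9 * B x y -
          if x = y then 81 else 0 := fun x y => by
      have hb : B x y * B x y = B x y := by
        rcases hB.zero_or_one x y with h | h <;> simp [h]
      split_ifs with h
      · subst h
        rw [hdiag, hB.loopless]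
        norm_num
      · linear_combination 6 * hNB x y + 9 * hb
    simp only [e, Finset.sum_sub_distrib, Finset.sum_add_distrib, hsq, ← Finset.mul_sum, hN,
      hB.sum_row, hB.sum_const, Finset.sum_ite_eq, mem_univ, if_true]
    norm_num
  have h1 := (Finset.sum_eq_zero_iff_of_nonneg fun x _ => Finset.sum_nonneg fun y _ =>
    sq_nonneg _).1 h0 x (mem_univ x)
  have h2 := (Finset.sum_eq_zero_iff_of_nonneg fun y _ => sq_nonneg _).1 h1 y (mem_univ y)
  linarith [pow_eq_zero_iff two_ne_zero |>.1 h2]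

/-- The matrix obtained by adding the cocliques of a family and one further vertex, adjacent to
all the cocliques. -/
def extendedMatrix (B : V → V → ℤ) (c : ι → V → ℤ) : V ⊕ ι ⊕ Unit → V ⊕ ι ⊕ Unit → ℤ
  | .inl x, .inl y => B x y
  | .inl x, .inr (.inl i) => c i x
  | .inr (.inl i), .inl x => c i x
  | .inr (.inl _), .inr (.inr _) => 1
  | .inr (.inr _), .inr (.inl _) => 1
  | _, _ => 0

theorem isSRGMatrix_of_sum_mul {W : Type*} [Fintype W] [DecidableEq W] {A : W → W → ℤ}
    (h1 : ∀ u v, A u v = A v u) (h2 : ∀ u v, A u v = 0 ∨ A u v = 1) (h3 : ∀ u, A u u = 0)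
    (h4 : ∀ u v, ∑ t, A u t * A v t = 12 - 12 * A u v + if u = v then 45 else 0)
    (h5 : Fintype.card W = 324) : IsSRGMatrix A where
  symm := h1
  zero_or_one := h2
  loopless := h3
  sum_mul := h4
  card := h5
  triangle_free u v w huv hvw := by
    rcases h2 u w with h | h
    · exact h
    have hne : u ≠ w := fun e => by rw [e, h3] at h; omega
    have e := h4 u w
    rw [h, if_neg hne] at e
    have e1 := Finset.single_le_sum (s := univ) (f := fun t => A u t * A w t) (fun t _ => by
      rcases h2 u t with a | a <;> rcases h2 w t with b | b <;> simp [a, b]) (mem_univ v)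
    simp only [huv, h1 w v, hvw] at e1
    omega

theorem isSRGMatrix_extendedMatrix (hB : IsSubSRGMatrix B) (hc : ∀ i, IsCocliqueFun B (c i))
    (hinj : Function.Injective c) (hι : Fintype.card ι = 57) :
    IsSRGMatrix (extendedMatrix B c) := by
  have hn : ∀ i x, ∑ t, B x t * c i t = 12 * (1 - c i x) := fun i x => (hc i).nbrSum_eq hB x
  have hn' : ∀ i x, ∑ t, c i t * B x t = 12 * (1 - c i x) := fun i x => by
    simp only [mul_comm (c i _), hn]
  refine isSRGMatrix_of_sum_mul ?_ ?_ ?_ ?_ ?_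
  · rintro (x | i | _) (y | j | _) <;> first | rfl | exact hB.symm _ _
  · rintro (x | i | _) (y | j | _) <;>
      simp [extendedMatrix, hB.zero_or_one, (hc _).zero_or_one]
  · rintro (x | i | _) <;> simp [extendedMatrix, hB.loopless]
  · rintro (x | i | _) (y | j | _)
    · simp only [Fintype.sum_sum_type, extendedMatrix, hB.sum_mul,
        sum_index_mul_eq hB hc hinj hι, Sum.inl.injEq]
      split_ifs <;> simp <;> ring
    · simp [extendedMatrix, hn]; ring
    · simp [extendedMatrix, sum_index_eq hB hc hinj hι]
    · simp [extendedMatrix, hn']; ring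
    · simp [extendedMatrix, sum_mul_eq hB hc hinj hι]
      split_ifs <;> norm_num
    · simp [extendedMatrix]
    · simp [extendedMatrix, sum_index_eq hB hc hinj hι]
    · simp [extendedMatrix]
    · simp [extendedMatrix, hι]
  · simp [hB.card, hι]

end family

theorem isSubSRGMatrix_of_isSRGWith {G : SimpleGraph V} [DecidableRel G.Adj]
    (h : G.IsSRGWith 266 45 0 9) : IsSubSRGMatrix fun u v => if G.Adj u v then (1 : ℤ) else 0 where
  symm u v := by simp only [G.adj_comm]
  zero_or_one u v := by split_ifs <;> simp
  loopless u := by simp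
  card := h.card
  sum_mul u v := by
    have e : ∀ t, ((if G.Adj u t then (1 : ℤ) else 0) * if G.Adj v t then 1 else 0) =
        if G.Adj u t ∧ G.Adj v t then 1 else 0 := fun t => by
      by_cases h1 : G.Adj u t <;> by_cases h2 : G.Adj v t <;> simp [h1, h2]
    simp only [e, Finset.sum_boole]
    have e2 : (univ.filter fun t => G.Adj u t ∧ G.Adj v t).card =
        Fintype.card (G.commonNeighbors u v) := by
      rw [← Set.toFinset_card]
      congr 1
      ext t
      simp [SimpleGraph.mem_commonNeighbors]
    by_cases huv : u = v
    · subst huv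
      have := h.regular u
      simp only [and_self, if_true, SimpleGraph.irrefl, if_false]
      rw [← SimpleGraph.card_neighborFinset_eq_degree, SimpleGraph.neighborFinset_eq_filter] at this
      rw [this]
      norm_num
    · rw [e2]
      by_cases hadj : G.Adj u v
      · rw [h.of_adj u v hadj]
        simp [hadj, huv]
      · rw [h.of_not_adj huv hadj]
        simp [hadj, huv]

end

end SRG324

theorem srg_266_45_0_9_at_most_56_delsarte_cocliques {V : Type*} [Fintype V] [DecidableEq V]
    (G : SimpleGraph V) [DecidableRel G.Adj] (hsrg : G.IsSRGWith 266 45 0 9) :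
    {Y : Finset V | IsCoclique G Y ∧ Y.card = 56}.ncard ≤ 56 := by
  classical
  by_contra! hcon
  have hfin : {Y : Finset V | IsCoclique G Y ∧ Y.card = 56}.Finite := Set.toFinite _
  rw [Set.ncard_eq_toFinset_card _ hfin] at hcon
  obtain ⟨T, hT, hcard⟩ := Finset.exists_subset_card_eq (n := 57) hcon
  have hmem : ∀ Y : T, IsCoclique G Y.1 ∧ Y.1.card = 56 := fun Y => by
    simpa using hT Y.2
  have hB := SRG324.isSubSRGMatrix_of_isSRGWith hsrg
  refine (SRG324.isSRGMatrix_extendedMatrix (ι := T)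
    (c := fun Y x => if x ∈ Y.1 then 1 else 0) hB (fun Y => ⟨fun x => ?_, ?_, fun x y hx hy => ?_⟩)
    (fun Y Z h => ?_) (by simpa using hcard)).false
  · split_ifs <;> simp
  · simp [(hmem Y).2]
  · have hx' : x ∈ Y.1 := by by_contra d; simp [d] at hx
    have hy' : y ∈ Y.1 := by by_contra d; simp [d] at hy
    exact if_neg ((hmem Y).1 x hx' y hy')
  · ext x
    have := congrFun h x
    by_cases h1 : x ∈ Y.1 <;> by_cases h2 : x ∈ Z.1 <;> simp [h1, h2] at this ⊢
end

section
/- Let Γ be a primitive strongly regular graph with eigenvalues k, e⁺, e⁻ (multiplicity m⁻ of e⁻) satisfying v·e⁻ = m⁻(e⁻ − k), and suppose Γ possesses m⁻ + 1 distinct Delsarte cocliques. Then c := (1 − e⁺)e⁺/((e⁺)² + e⁻) is a nonnegative integer and e⁺ + 1 divides 2c + 4. -/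
/-- `Y` is a Delsarte coclique: an independent set whose size equals
`v * e⁻ / (e⁻ - k)`, i.e. meeting Hoffman's ratio bound with equality. -/
def IsDelsarteCoclique {V : Type*} (G : SimpleGraph V) (v k : ℕ) (eN : ℤ)
    (Y : Finset V) : Prop :=
  IsCoclique G Y ∧ (Y.card : ℤ) * (eN - (k : ℤ)) = (v : ℤ) * eN

/-- The number of neighbours of `p` in `S`, as an integer. -/
def nbrCount {V : Type*} (G : SimpleGraph V) [DecidableRel G.Adj] (p : V) (S : Finset V) : ℤ :=
  ∑ y ∈ S, if G.Adj p y then 1 else 0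

section Counting

variable {V : Type*} {G : SimpleGraph V} [DecidableRel G.Adj]

theorem nbrCount_eq_card_filter (p : V) (S : Finset V) :
    nbrCount G p S = ((S.filter (G.Adj p)).card : ℤ) := by
  simp [nbrCount]

theorem nbrCount_eq_zero {p : V} {S : Finset V} (h : ∀ y ∈ S, ¬ G.Adj p y) :
    nbrCount G p S = 0 :=
  Finset.sum_eq_zero fun y hy => if_neg (h y hy)

theorem IsCoclique.nbrCount_eq_zero {Y : Finset V} (hY : IsCoclique G Y) {p : V} (hp : p ∈ Y) :
    nbrCount G p Y = 0 :=
  _root_.nbrCount_eq_zero fun y hy => hY p hp y hy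

theorem nbrCount_eq_of_subset {p : V} {S T : Finset V} (hST : S ⊆ T)
    (h : ∀ y ∈ T, y ∉ S → ¬ G.Adj p y) : nbrCount G p S = nbrCount G p T :=
  Finset.sum_subset hST fun y hy hyS => if_neg (h y hy hyS)

theorem nbrCount_inter_add_sdiff [DecidableEq V] (p : V) (S T : Finset V) :
    nbrCount G p (S ∩ T) + nbrCount G p (S \ T) = nbrCount G p S :=
  Finset.sum_inter_add_sum_sdiff S T _

theorem sum_nbrCount_comm (S T : Finset V) :
    ∑ p ∈ S, nbrCount G p T = ∑ p ∈ T, nbrCount G p S := by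
  unfold nbrCount
  rw [Finset.sum_comm]
  simp only [G.adj_comm]

variable [Fintype V] {v k l m : ℕ}

theorem SimpleGraph.IsSRGWith.nbrCount_univ (h : G.IsSRGWith v k l m) (p : V) :
    nbrCount G p Finset.univ = k := by
  rw [nbrCount_eq_card_filter, ← h.regular p, ← G.card_neighborFinset_eq_degree,
    G.neighborFinset_eq_filter]

theorem SimpleGraph.IsSRGWith.sum_nbrCount (h : G.IsSRGWith v k l m) (T : Finset V) :
    ∑ q, nbrCount G q T = T.card * k := by
  rw [sum_nbrCount_comm]
  simp [h.nbrCount_univ]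

variable [DecidableEq V]

theorem SimpleGraph.IsSRGWith.sum_adj_mul_adj (h : G.IsSRGWith v k l m) (p q : V) :
    (∑ x, (if G.Adj x p then 1 else 0) * (if G.Adj x q then 1 else 0) : ℤ) =
      if p = q then (k : ℤ) else if G.Adj p q then (l : ℤ) else m := by
  have key : (∑ x, (if G.Adj x p then 1 else 0) * (if G.Adj x q then 1 else 0) : ℤ) =
      ((Finset.univ.filter fun x => G.Adj p x ∧ G.Adj q x).card : ℤ) := by
    simp [← ite_and, G.adj_comm _ p, G.adj_comm _ q, and_comm]
  rw [key]
  split_ifs with h1 h2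
  · subst h1
    simp only [and_self]
    rw [← h.nbrCount_univ p, nbrCount_eq_card_filter]
  · rw [← h.of_adj p q h2, Fintype.card_of_subtype]
    simp [SimpleGraph.mem_commonNeighbors]
  · rw [← h.of_not_adj h1 h2, Fintype.card_of_subtype]
    simp [SimpleGraph.mem_commonNeighbors]

theorem SimpleGraph.IsSRGWith.sum_nbrCount_sq (h : G.IsSRGWith v k l m) {T : Finset V}
    (hT : IsCoclique G T) :
    ∑ q, nbrCount G q T ^ 2 = T.card * (k + (T.card - 1) * m) := by
  have h1 : ∑ q, nbrCount G q T ^ 2 = ∑ y ∈ T, ∑ z ∈ T,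
      ∑ q, ((if G.Adj q y then 1 else 0) * (if G.Adj q z then 1 else 0) : ℤ) := by
    simp only [nbrCount, sq, Finset.sum_mul_sum]
    rw [Finset.sum_comm]
    exact Finset.sum_congr rfl fun y _ => Finset.sum_comm
  have h2 : ∀ y ∈ T, ∑ z ∈ T,
      ∑ q, ((if G.Adj q y then 1 else 0) * (if G.Adj q z then 1 else 0) : ℤ) =
        k + (T.card - 1) * m := by
    intro y hy
    have h3 : ∀ z ∈ T,
        ∑ q, ((if G.Adj q y then 1 else 0) * (if G.Adj q z then 1 else 0) : ℤ) =
          m + if y = z then (k - m : ℤ) else 0 := by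
      intro z hz
      rw [h.sum_adj_mul_adj, if_neg (hT y hy z hz)]
      split_ifs <;> ring
    rw [Finset.sum_congr rfl h3, Finset.sum_add_distrib, Finset.sum_ite_eq, if_pos hy]
    simp
    ring
  rw [h1, Finset.sum_congr rfl h2]
  simp

theorem SimpleGraph.IsSRGWith.sum_nbrCount_mul_adj (h : G.IsSRGWith v k l m) {T : Finset V}
    {p : V} (hT : ∀ y ∈ T, G.Adj p y) :
    ∑ q, nbrCount G q T * (if G.Adj p q then 1 else 0) = T.card * l := by
  have h1 : ∑ q, nbrCount G q T * (if G.Adj p q then 1 else 0) = ∑ y ∈ T,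
      ∑ q, ((if G.Adj q y then 1 else 0) * (if G.Adj q p then 1 else 0) : ℤ) := by
    simp only [nbrCount, Finset.sum_mul, G.adj_comm p]
    exact Finset.sum_comm
  have h2 : ∀ y ∈ T,
      ∑ q, ((if G.Adj q y then 1 else 0) * (if G.Adj q p then 1 else 0) : ℤ) = l := by
    intro y hy
    rw [h.sum_adj_mul_adj, if_neg (hT y hy).ne', if_pos (hT y hy).symm]
  rw [h1, Finset.sum_congr rfl h2]
  simp

theorem SimpleGraph.IsSRGWith.param_eq_int (h : G.IsSRGWith v k l m) (p : V) :
    (k : ℤ) * (k - l - 1) = (v - k - 1) * m := by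
  have h1 : ∀ q, nbrCount G q (Finset.univ.filter (G.Adj p)) =
      m + (if p = q then (k - m : ℤ) else 0) + (l - m) * (if G.Adj p q then 1 else 0) := by
    intro q
    have h2 : nbrCount G q (Finset.univ.filter (G.Adj p)) =
        ∑ x, ((if G.Adj x p then 1 else 0) * (if G.Adj x q then 1 else 0) : ℤ) := by
      rw [nbrCount, Finset.sum_filter]
      refine Finset.sum_congr rfl fun x _ => ?_
      simp only [G.adj_comm p, G.adj_comm q, ite_mul, one_mul, zero_mul]
    rw [h2, h.sum_adj_mul_adj]
    split_ifs with h3 h4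
    · exact absurd (h3 ▸ h4) (G.irrefl)
    all_goals ring
  have h3 := h.sum_nbrCount (Finset.univ.filter (G.Adj p))
  rw [Finset.sum_congr rfl fun q _ => h1 q, ← nbrCount_eq_card_filter, h.nbrCount_univ,
    Finset.sum_add_distrib, Finset.sum_add_distrib, ← Finset.mul_sum, Finset.sum_ite_eq] at h3
  have h4 := h.nbrCount_univ p
  unfold nbrCount at h4
  rw [h4] at h3
  simp only [Finset.sum_const, Finset.card_univ, h.card, nsmul_eq_mul, Finset.mem_univ,
    if_true] at h3
  linear_combination -h3

theorem sum_compl_eq_sum_univ {f : V → ℤ} {Y : Finset V} (hf : ∀ p ∈ Y, f p = 0) :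
    ∑ p ∈ Yᶜ, f p = ∑ p, f p := by
  rw [← Finset.sum_compl_add_sum Y f, Finset.sum_eq_zero hf, add_zero]

/-- A coclique of order `n` in which the variance of the number of neighbours vanishes meets
every outside neighbourhood in the same number `s` of vertices. -/
theorem SimpleGraph.IsSRGWith.nbrCount_eq_of_notMem (h : G.IsSRGWith v k l m) {Y : Finset V}
    (hY : IsCoclique G Y) {n s : ℤ} (hn : (Y.card : ℤ) = n)
    (hvar : n * (k + (n - 1) * m) - 2 * s * (n * k) + s ^ 2 * (v - n) = 0)
    {p : V} (hp : p ∉ Y) : nbrCount G p Y = s := by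
  have hcard : ((Yᶜ).card : ℤ) = v - n := by
    rw [Finset.card_compl, h.card, Nat.cast_sub (h.card ▸ Y.card_le_univ), hn]
  have hsum : ∑ q ∈ Yᶜ, (nbrCount G q Y - s) ^ 2 = 0 := by
    have e : ∀ q, (nbrCount G q Y - s) ^ 2 =
        nbrCount G q Y ^ 2 - 2 * s * nbrCount G q Y + s ^ 2 := fun q => by ring
    simp only [e, Finset.sum_add_distrib, Finset.sum_sub_distrib, ← Finset.mul_sum]
    rw [sum_compl_eq_sum_univ fun q hq => by rw [hY.nbrCount_eq_zero hq]; rfl,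
      sum_compl_eq_sum_univ fun q hq => hY.nbrCount_eq_zero hq,
      h.sum_nbrCount_sq hY, h.sum_nbrCount, Finset.sum_const, nsmul_eq_mul, hcard, hn]
    linarith
  have := (Finset.sum_eq_zero_iff_of_nonneg fun q _ => sq_nonneg _).1 hsum p
    (Finset.mem_compl.2 hp)
  linarith [pow_eq_zero_iff (two_ne_zero) |>.1 this]

/-- For a vertex `p` outside the coclique `Y`, the number of common neighbours in `Y` of `p` and
an outside vertex `q` depends only on whether `p`, `q` are equal, adjacent or non-adjacent. -/
theorem SimpleGraph.IsSRGWith.nbrCount_filter_adj (h : G.IsSRGWith v k l m) {Y : Finset V}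
    (hY : IsCoclique G Y) {n s r : ℤ} (hn : (Y.card : ℤ) = n)
    (hs : ∀ p ∉ Y, nbrCount G p Y = s)
    (hvar : s * (k + (s - 1) * m) - 2 * (s - r ^ 2) * (s * k) + 2 * r * (s * l) +
      (s - r ^ 2) ^ 2 * (v - n) + (r ^ 2 - 2 * (s - r ^ 2) * r) * (k - s) = r ^ 4)
    {p q : V} (hp : p ∉ Y) (hq : q ∉ Y) :
    nbrCount G q (Y.filter (G.Adj p)) =
      (s - r ^ 2) - r * (if G.Adj p q then 1 else 0) + (if p = q then r ^ 2 else 0) := by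
  set T := Y.filter (G.Adj p) with hTdef
  have hTY : T ⊆ Y := Finset.filter_subset _ _
  have hTs : (T.card : ℤ) = s := by rw [← nbrCount_eq_card_filter, hs p hp]
  have hT : IsCoclique G T := fun x hx y hy => hY x (hTY hx) y (hTY hy)
  have hTp : ∀ y ∈ T, G.Adj p y := fun y hy => (Finset.mem_filter.1 hy).2
  have hT0 : ∀ q ∈ Y, nbrCount G q T = 0 := fun q hq =>
    _root_.nbrCount_eq_zero fun y hy => hY q hq y (hTY hy)
  have hTpp : nbrCount G p T = s := by
    rw [nbrCount_eq_card_filter, Finset.filter_true_of_mem hTp, hTs]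
  have hcard : ((Yᶜ).card : ℤ) = v - n := by
    rw [Finset.card_compl, h.card, Nat.cast_sub (h.card ▸ Y.card_le_univ), hn]
  have hadj : ∑ q ∈ Yᶜ, (if G.Adj p q then 1 else 0 : ℤ) = k - s := by
    have := Finset.sum_compl_add_sum Y fun q => (if G.Adj p q then 1 else 0 : ℤ)
    have h1 := hs p hp
    have h2 := h.nbrCount_univ p
    unfold nbrCount at h1 h2
    linarith
  let g : V → ℤ := fun q =>
    nbrCount G q T - (s - r ^ 2) + r * (if G.Adj p q then 1 else 0)
  have hsum : ∑ q ∈ Yᶜ, g q ^ 2 = r ^ 4 := by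
    have e : ∀ q, g q ^ 2 = nbrCount G q T ^ 2 - 2 * (s - r ^ 2) * nbrCount G q T +
        2 * r * (nbrCount G q T * (if G.Adj p q then 1 else 0)) + (s - r ^ 2) ^ 2 +
        (r ^ 2 - 2 * (s - r ^ 2) * r) * (if G.Adj p q then 1 else 0) := fun q => by
      simp only [g]
      split_ifs <;> ring
    simp only [e, Finset.sum_add_distrib, Finset.sum_sub_distrib, ← Finset.mul_sum]
    rw [sum_compl_eq_sum_univ fun q hq => by rw [hT0 q hq]; rfl,
      sum_compl_eq_sum_univ hT0,
      sum_compl_eq_sum_univ fun q hq => by rw [hT0 q hq, zero_mul],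
      h.sum_nbrCount_sq hT, h.sum_nbrCount, h.sum_nbrCount_mul_adj hTp, hadj,
      Finset.sum_const, nsmul_eq_mul, hcard, hTs]
    linarith
  have hgp : g p = r ^ 2 := by simp [g, hTpp]
  by_cases hpq : p = q
  · subst hpq
    simp [hTpp]
  · rw [← Finset.add_sum_erase _ _ (Finset.mem_compl.2 hp), hgp] at hsum
    have hz : ∑ q ∈ Yᶜ.erase p, g q ^ 2 = 0 := by linarith
    have h0 := (Finset.sum_eq_zero_iff_of_nonneg fun q _ => sq_nonneg _).1 hz q
      (Finset.mem_erase.2 ⟨Ne.symm hpq, Finset.mem_compl.2 hq⟩)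
    have h1 : g q = 0 := pow_eq_zero_iff (two_ne_zero) |>.1 h0
    simp only [g] at h1
    rw [if_neg hpq]
    linarith

end Counting

section Intersections

variable {V : Type*} {G : SimpleGraph V} [DecidableRel G.Adj] [DecidableEq V]

/-- The local counting properties shared by all Delsarte cocliques of the graph. -/
structure IsLocallyBalanced (G : SimpleGraph V) [DecidableRel G.Adj] (n s r : ℤ)
    (Y : Finset V) : Prop where
  coclique : IsCoclique G Y
  card_eq : (Y.card : ℤ) = n
  nbrCount_eq : ∀ p ∉ Y, nbrCount G p Y = s
  nbrCount_filter : ∀ p ∉ Y, ∀ q ∉ Y, nbrCount G q (Y.filter (G.Adj p)) =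
    (s - r ^ 2) - r * (if G.Adj p q then 1 else 0) + (if p = q then r ^ 2 else 0)

variable {n s r : ℤ} {Y Z W : Finset V}

theorem IsLocallyBalanced.sum_sdiff (hY : IsLocallyBalanced G n s r Y)
    (hZ : IsLocallyBalanced G n s r Z) {p : V} (hp : p ∉ Y) :
    s * nbrCount G p (Y \ Z) =
      (n - (Y ∩ Z).card) * (s - r ^ 2) - r * nbrCount G p (Z \ Y) +
        (if p ∈ Z then r ^ 2 else 0) := by
  have hcard : ((Z \ Y).card : ℤ) = n - (Y ∩ Z).card := by
    have := Finset.card_sdiff_add_card_inter Z Y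
    rw [Finset.inter_comm] at this
    rw [← hZ.card_eq, ← this]
    push_cast
    ring
  have h1 : ∑ q ∈ Z \ Y, nbrCount G q (Y.filter (G.Adj p)) =
      (n - (Y ∩ Z).card) * (s - r ^ 2) - r * nbrCount G p (Z \ Y) +
        (if p ∈ Z then r ^ 2 else 0) := by
    rw [Finset.sum_congr rfl fun q hq => hY.nbrCount_filter p hp q (Finset.mem_sdiff.1 hq).2]
    rw [Finset.sum_add_distrib, Finset.sum_sub_distrib, ← Finset.mul_sum, Finset.sum_ite_eq,
      Finset.sum_const, nsmul_eq_mul, hcard]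
    simp [nbrCount, hp]
  have h2 : ∀ y ∈ Y.filter (G.Adj p), nbrCount G y (Z \ Y) = if y ∈ Z then 0 else s := by
    intro y hy
    have hyY := (Finset.mem_filter.1 hy).1
    have hyZ : nbrCount G y (Z \ Y) = nbrCount G y Z :=
      nbrCount_eq_of_subset Finset.sdiff_subset fun z hz hzn =>
        hY.coclique y hyY z (by simpa [hz] using hzn)
    rw [hyZ]
    split_ifs with hmem
    · exact hZ.coclique.nbrCount_eq_zero hmem
    · exact hZ.nbrCount_eq y hmem
  rw [← h1, sum_nbrCount_comm, Finset.sum_congr rfl h2, nbrCount, Finset.mul_sum,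
    Finset.sum_filter, ← Finset.sum_sdiff (Finset.sdiff_subset (s := Y) (t := Z))]
  rw [Finset.sum_eq_zero (s := Y \ (Y \ Z)) (by
    intro y hy
    have : y ∈ Z := by
      simp only [Finset.mem_sdiff, not_and, not_not] at hy
      exact hy.2 hy.1
    simp [this]), zero_add]
  refine Finset.sum_congr rfl fun y hy => ?_
  simp [(Finset.mem_sdiff.1 hy).2]

theorem IsLocallyBalanced.card_inter (hY : IsLocallyBalanced G n s r Y)
    (hZ : IsLocallyBalanced G n s r Z) (hYZ : Y ≠ Z) :
    (n - (Y ∩ Z).card) * (s - r ^ 2) = s ^ 2 - r ^ 2 := by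
  obtain ⟨p, hpZ, hpY⟩ : ∃ p ∈ Z, p ∉ Y := by
    by_contra! hsub
    refine hYZ (Finset.eq_of_subset_of_card_le hsub ?_).symm
    exact_mod_cast (hY.card_eq.trans hZ.card_eq.symm).le
  have h := hY.sum_sdiff hZ hpY
  have h1 : nbrCount G p (Y \ Z) = s := by
    rw [← hY.nbrCount_eq p hpY]
    exact nbrCount_eq_of_subset Finset.sdiff_subset fun z hz hzn =>
      hZ.coclique p hpZ z (by simpa [hz] using hzn)
  have h2 : nbrCount G p (Z \ Y) = 0 :=
    nbrCount_eq_zero fun z hz => hZ.coclique p hpZ z (Finset.mem_sdiff.1 hz).1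
  rw [h1, h2, if_pos hpZ] at h
  linarith

theorem IsLocallyBalanced.nbrCount_inter (hY : IsLocallyBalanced G n s r Y)
    (hZ : IsLocallyBalanced G n s r Z) (hYZ : Y ≠ Z) (hsr : 0 < s + r) {p : V}
    (hpY : p ∉ Y) (hpZ : p ∉ Z) : nbrCount G p (Y ∩ Z) = r := by
  have h := hY.sum_sdiff hZ hpY
  have hc := hY.card_inter hZ hYZ
  have h1 := nbrCount_inter_add_sdiff (G := G) p Y Z
  have h2 := nbrCount_inter_add_sdiff (G := G) p Z Y
  rw [Finset.inter_comm] at h2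
  rw [hY.nbrCount_eq p hpY] at h1
  rw [hZ.nbrCount_eq p hpZ] at h2
  rw [if_neg hpZ, hc] at h
  have : (s + r) * (nbrCount G p (Y ∩ Z) - r) = 0 := by
    linear_combination -h + s * h1 + r * h2
  rcases mul_eq_zero.1 this with h0 | h0 <;> linarith

theorem IsLocallyBalanced.card_inter_inter (hY : IsLocallyBalanced G n s r Y)
    (hZ : IsLocallyBalanced G n s r Z) (hW : IsLocallyBalanced G n s r W)
    (hYZ : Y ≠ Z) (hsr : 0 < s + r) :
    (((Y ∩ Z).card : ℤ) - (Y ∩ Z ∩ W).card) * s =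
      r * (n - (Y ∩ W).card - (Z ∩ W).card + (Y ∩ Z ∩ W).card) := by
  have hS : (((Y ∩ Z) \ W).card : ℤ) = (Y ∩ Z).card - (Y ∩ Z ∩ W).card := by
    rw [← Finset.card_sdiff_add_card_inter (Y ∩ Z) W]
    push_cast
    ring
  have hU : ((W \ (Y ∪ Z)).card : ℤ) =
      n - (Y ∩ W).card - (Z ∩ W).card + (Y ∩ Z ∩ W).card := by
    have h1 := Finset.card_sdiff_add_card_inter W (Y ∪ Z)
    have h2 := Finset.card_union_add_card_inter (Y ∩ W) (Z ∩ W)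
    rw [← Finset.union_inter_distrib_right, ← Finset.inter_inter_distrib_right,
      Finset.inter_comm _ W] at h2
    rw [← hW.card_eq]
    omega
  have h1 : ∀ y ∈ (Y ∩ Z) \ W, nbrCount G y (W \ (Y ∪ Z)) = s := by
    intro y hy
    simp only [Finset.mem_sdiff, Finset.mem_inter] at hy
    rw [← hW.nbrCount_eq y hy.2]
    refine nbrCount_eq_of_subset Finset.sdiff_subset fun z hz hzn => ?_
    have : z ∈ Y ∨ z ∈ Z := by
      by_contra hcon
      exact hzn (Finset.mem_sdiff.2 ⟨hz, by simpa using hcon⟩)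
    rcases this with h | h
    · exact hY.coclique y hy.1.1 z h
    · exact hZ.coclique y hy.1.2 z h
  have h2 : ∀ p ∈ W \ (Y ∪ Z), nbrCount G p ((Y ∩ Z) \ W) = r := by
    intro p hp
    simp only [Finset.mem_sdiff, Finset.mem_union, not_or] at hp
    rw [← hY.nbrCount_inter hZ hYZ hsr hp.2.1 hp.2.2]
    refine nbrCount_eq_of_subset Finset.sdiff_subset fun z hz hzn => ?_
    exact hW.coclique p hp.1 z (by
      by_contra hcon
      exact hzn (Finset.mem_sdiff.2 ⟨hz, hcon⟩))
  have h3 := sum_nbrCount_comm (G := G) ((Y ∩ Z) \ W) (W \ (Y ∪ Z))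
  rw [Finset.sum_congr rfl h1, Finset.sum_congr rfl h2] at h3
  simp only [Finset.sum_const, nsmul_eq_mul] at h3
  rw [hS, hU] at h3
  linarith

end Intersections

theorem SimpleGraph.Connected.eq_or_adj_of_isSRGWith_zero {V : Type*} [Fintype V]
    [DecidableEq V] {G : SimpleGraph V} [DecidableRel G.Adj] {v k l : ℕ} (hc : G.Connected)
    (h : G.IsSRGWith v k l 0) (x y : V) : x = y ∨ G.Adj x y := by
  obtain ⟨w⟩ := hc.preconnected x y
  induction w with
  | nil => exact Or.inl rfl
  | @cons a b c hab _ ih =>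
    rcases ih with rfl | hbc
    · exact Or.inr hab
    · by_contra! hcon
      have := h.of_not_adj hcon.1 hcon.2
      rw [Fintype.card_eq_zero_iff] at this
      exact this.false ⟨b, (SimpleGraph.mem_commonNeighbors G).2 ⟨hab, hbc.symm⟩⟩

theorem SimpleGraph.Connected.exists_ne_not_adj {V : Type*} [Nontrivial V]
    {G : SimpleGraph V} (hc : Gᶜ.Connected) (x : V) : ∃ y, x ≠ y ∧ ¬ G.Adj x y := by
  obtain ⟨y, hy⟩ := hc.preconnected.exists_adj_of_nontrivial x
  exact ⟨y, by simpa using hy⟩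

/-- The parameter identities forced by equality of the ratio and inertia bounds. -/
theorem srg_ratio_eq_inertia_params {v k l m n r s : ℤ} (hs : 0 < s) (hk : 0 < k)
    (hm : 0 < m) (hv : 0 < v) (hlm : r - s = l - m) (hkm : k - m = r * s)
    (hparam : k * (k - l - 1) = (v - k - 1) * m)
    (hmult : n * (m * (r + s)) = (v - 1) * (m * (r + s)) - (s - 1) * k * (k + s))
    (hbound : v * s = n * (k + s)) :
    k * (r + 1) = s * (s + r) ∧ n * m = s * (k - r) ∧ v * m = (k - r) * (k + s) := by
  have hvm : v * m = (k - r) * (k + s) := by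
    have : l = r - s + m := by linarith
    subst this
    have : m = k - r * s := by linarith
    subst this
    linarith
  have hks : k + s ≠ 0 := by positivity
  have hnm : n * m = s * (k - r) := by
    apply mul_right_cancel₀ hks
    linear_combination s * hvm - m * hbound
  have hkr : k - r ≠ 0 := by
    intro h0
    rw [h0, zero_mul] at hvm
    exact (mul_pos hv hm).ne' hvm
  refine ⟨?_, hnm, hvm⟩
  apply mul_right_cancel₀ hkr
  have hm' : m = k - r * s := by linarith
  linear_combination (-1 : ℤ) * hmult + (r + s) * hnm - (r + s) * hvm + (r + s) * hm'

theorem srg_coclique_variance {v k m n r s : ℤ} (hkm : k - m = r * s)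
    (hnm : n * m = s * (k - r)) (hbound : v * s = n * (k + s)) :
    n * (k + (n - 1) * m) - 2 * s * (n * k) + s ^ 2 * (v - n) = 0 := by
  linear_combination s * hbound + n * hnm + n * hkm

theorem srg_common_neighbor_variance {v k l m n r s : ℤ} (hs : 0 < s) (hr : 0 ≤ r)
    (hlm : r - s = l - m) (hk : k * (r + 1) = s * (s + r))
    (hm : m * (r + 1) = s * (s - r ^ 2))
    (hn : n * (s - r ^ 2) = s ^ 2 + r * s - r ^ 2 - r) (hbound : v * s = n * (k + s)) :
    s * (k + (s - 1) * m) - 2 * (s - r ^ 2) * (s * k) + 2 * r * (s * l) +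
      (s - r ^ 2) ^ 2 * (v - n) + (r ^ 2 - 2 * (s - r ^ 2) * r) * (k - s) = r ^ 4 := by
  have h0 : s * (r + 1) ≠ 0 := by positivity
  have hl : l * (r + 1) = s * (s - r ^ 2) + (r - s) * (r + 1) := by
    linear_combination hm - (r + 1) * hlm
  apply mul_left_cancel₀ h0
  linear_combination (s ^ 2 - 2 * (s - r ^ 2) * s ^ 2 + (r ^ 2 - 2 * (s - r ^ 2) * r) * s +
    (s - r ^ 2) ^ 2 * n) * hk + (s ^ 2 * (s - 1)) * hm + 2 * r * s ^ 2 * hl +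
    (s - r ^ 2) ^ 2 * (r + 1) * hbound + (s - r ^ 2) * s * (s + r) * hn

theorem add_one_dvd_two_mul_add_four {v k n r s c : ℤ} (hs : 0 < s) (hq : 0 < s - r ^ 2)
    (hc0 : 0 ≤ c) (hk : k * (r + 1) = s * (s + r))
    (hn : n * (s - r ^ 2) = s ^ 2 + r * s - r ^ 2 - r) (hbound : v * s = n * (k + s))
    (hc : c * (s - r ^ 2) = r * (r - 1)) : r + 1 ∣ 2 * c + 4 := by
  have hv : v * (r + 1) = n * (s + 2 * r + 1) := by
    apply mul_right_cancel₀ hs.ne'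
    linear_combination (r + 1) * hbound + n * hk
  have hvn : v * (r + 1) * (c + 1) = n * (n + 1) := by
    apply mul_right_cancel₀ hq.ne'
    linear_combination v * (r + 1) * hc + (s - r) * hv - n * hn
  have hcn : c * n = c + 2 - 3 * (r + 1) * (c + 1) + (r + 1) ^ 2 * (c + 1) ^ 2 := by
    apply mul_right_cancel₀ (pow_pos hq 2).ne'
    linear_combination (n * (s - r ^ 2) - (s - r ^ 2) + 3 * (r + 1) * (s - r ^ 2) -
      (r + 1) ^ 2 * (c * (s - r ^ 2) + 2 * (s - r ^ 2) + r * (r - 1))) * hc + r * (r - 1) * hn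
  have hprod : v * (r + 1) * c ^ 2 =
      (c + 2 - 3 * (r + 1) * (c + 1) + (r + 1) ^ 2 * (c + 1) ^ 2) *
        (2 - 3 * (r + 1) + (r + 1) ^ 2 * (c + 1)) := by
    apply mul_right_cancel₀ (by positivity : c + 1 ≠ 0)
    linear_combination c ^ 2 * hvn + (c * n + c + (c + 2 - 3 * (r + 1) * (c + 1) +
      (r + 1) ^ 2 * (c + 1) ^ 2)) * hcn
  refine ⟨v * c ^ 2 - ((-3 + (r + 1) * (c + 1)) * (c + 2 - 3 * (r + 1) * (c + 1) +
    (r + 1) ^ 2 * (c + 1) ^ 2) + 2 * (-3 * (c + 1) + (r + 1) * (c + 1) ^ 2)), ?_⟩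
  linear_combination -hprod

theorem srg_max_delsarte_cocliques_divisibility
    {V : Type*} [Fintype V] [DecidableEq V] (G : SimpleGraph V) [DecidableRel G.Adj]
    (v k l m : ℕ) (eP eN : ℤ) (mN : ℕ)
    (hsrg : G.IsSRGWith v k l m)
    (hconn : G.Connected) (hconnCompl : Gᶜ.Connected)
    (heP : 0 ≤ eP) (heN : eN < 0)
    (hProot : eP ^ 2 - ((l : ℤ) - (m : ℤ)) * eP - ((k : ℤ) - (m : ℤ)) = 0)
    (hNroot : eN ^ 2 - ((l : ℤ) - (m : ℤ)) * eN - ((k : ℤ) - (m : ℤ)) = 0)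
    (hmult : (mN : ℚ) = (v : ℚ) - 1 -
      ((eN : ℚ) + 1) * (k : ℚ) * ((k : ℚ) - (eN : ℚ)) / ((m : ℚ) * ((eN : ℚ) - (eP : ℚ))))
    (hbound : (v : ℤ) * eN = (mN : ℤ) * (eN - (k : ℤ)))
    (Y : Fin (mN + 1) → Finset V) (hinj : Function.Injective Y)
    (hdel : ∀ i, IsDelsarteCoclique G v k eN (Y i)) :
    ∃ c : ℕ, ((c : ℚ) = (1 - (eP : ℚ)) * (eP : ℚ) / ((eP : ℚ) ^ 2 + (eN : ℚ))) ∧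
      (eP + 1) ∣ (2 * (c : ℤ) + 4) := by
  obtain ⟨s, rfl⟩ : ∃ s : ℤ, eN = -s := ⟨-eN, by ring⟩
  have hs : 0 < s := by linarith
  have hsum : eP - s = l - m := by
    have hne : eP + s ≠ 0 := by positivity
    apply mul_left_cancel₀ hne
    linear_combination hProot - hNroot
  have hkm : (k : ℤ) - m = eP * s := by
    linear_combination (-1 : ℤ) * hProot + eP * hsum
  have := hconn.nonempty
  have hv0 : 0 < v := hsrg.card ▸ Fintype.card_pos
  have hlt : k + 1 ≤ v := by
    obtain ⟨x⟩ := hconn.nonempty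
    rw [← hsrg.regular x, ← hsrg.card]
    exact G.degree_lt_card_verts x
  have hparam : (k : ℤ) * (k - l - 1) = (v - k - 1) * m :=
    hsrg.param_eq_int hconn.nonempty.some
  have hk : 0 < (k : ℤ) := by
    by_contra hk
    have hk0 : (k : ℤ) = 0 := by linarith [Int.natCast_nonneg k]
    have h1 : 0 ≤ eP * s := by positivity
    have hm0 : (m : ℤ) = 0 := by linarith [Int.natCast_nonneg m]
    have h2 : eP * s = 0 := by linarith
    have h3 : eP = 0 := (mul_eq_zero.1 h2).resolve_right hs.ne'
    linarith [Int.natCast_nonneg l]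
  have : Nontrivial V := by
    rw [← Fintype.one_lt_card_iff_nontrivial, hsrg.card]
    omega
  obtain ⟨x, y, hxy, hadj⟩ : ∃ x y : V, x ≠ y ∧ ¬ G.Adj x y := by
    obtain ⟨x⟩ := hconn.nonempty
    exact ⟨x, hconnCompl.exists_ne_not_adj x⟩
  have hm : 0 < (m : ℤ) := by
    rw [Int.natCast_pos, Nat.pos_iff_ne_zero]
    rintro rfl
    exact (hconn.eq_or_adj_of_isSRGWith_zero hsrg x y).elim hxy hadj
  have hv2 : (k : ℤ) + 2 ≤ v := by
    have h1 : (insert x (insert y (G.neighborFinset x))).card ≤ v :=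
      hsrg.card ▸ Finset.card_le_univ _
    rw [Finset.card_insert_of_notMem (by simp [hxy]),
      Finset.card_insert_of_notMem (by simpa using hadj), G.card_neighborFinset_eq_degree,
      hsrg.regular x] at h1
    omega
  have hbound' : (v : ℤ) * s = mN * (k + s) := by linear_combination (-1 : ℤ) * hbound
  have hmult' : (mN : ℤ) * (m * (eP + s)) =
      (v - 1) * (m * (eP + s)) - (s - 1) * k * (k + s) := by
    have hmQ : (m : ℚ) ≠ 0 := by exact_mod_cast hm.ne'
    have hne : (-s - eP : ℚ) ≠ 0 := by
      have : (0 : ℚ) < s + eP := by exact_mod_cast (by linarith : 0 < s + eP)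
      linarith
    push_cast at hmult
    field_simp at hmult
    have : (mN : ℚ) * (m * (eP + s)) =
        (v - 1) * (m * (eP + s)) - (s - 1) * k * (k + s) := by
      linear_combination (-1 : ℚ) * hmult
    exact_mod_cast this
  obtain ⟨hK, hnm, -⟩ := srg_ratio_eq_inertia_params hs hk hm (by exact_mod_cast hv0) hsum hkm
    hparam hmult' hbound'
  have hM : (m : ℤ) * (eP + 1) = s * (s - eP ^ 2) := by
    linear_combination hK - (eP + 1) * hkm
  have hq : 0 < s - eP ^ 2 := by
    have : 0 < s * (s - eP ^ 2) := hM ▸ by positivity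
    exact pos_of_mul_pos_right this hs.le
  have hN : (mN : ℤ) * (s - eP ^ 2) = s ^ 2 + eP * s - eP ^ 2 - eP := by
    apply mul_left_cancel₀ hs.ne'
    linear_combination (eP + 1) * hnm + s * hK - mN * hM
  have hs1 : 1 < s := by
    by_contra hs1
    obtain rfl : s = 1 := by linarith
    have hk1 : (k : ℤ) = 1 := mul_right_cancel₀ (by positivity : eP + 1 ≠ 0) (by linarith)
    have heP0 : eP = 0 := by nlinarith
    subst heP0
    have hmN : (mN : ℤ) = 1 := by linarith
    rw [hmN, hk1] at hbound'
    linarith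
  have hmN2 : 2 ≤ mN := by
    have h1 : 0 < ((mN : ℤ) - 1) * (s - eP ^ 2) := by
      have : ((mN : ℤ) - 1) * (s - eP ^ 2) = (s - 1) * (s + eP) := by linear_combination hN
      rw [this]
      exact mul_pos (by linarith) (by linarith)
    have := pos_of_mul_pos_left h1 hq.le
    omega
  have hbal : ∀ i, IsLocallyBalanced G mN s eP (Y i) := by
    intro i
    have hcard : ((Y i).card : ℤ) = mN := by
      have hne : (-s - k : ℤ) ≠ 0 := by linarith
      exact mul_right_cancel₀ hne ((hdel i).2.trans hbound)
    have hnb : ∀ p ∉ Y i, nbrCount G p (Y i) = s := fun p hp =>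
      hsrg.nbrCount_eq_of_notMem (hdel i).1 hcard
        (srg_coclique_variance hkm hnm hbound') hp
    exact ⟨(hdel i).1, hcard, hnb, fun p hp q hq' => hsrg.nbrCount_filter_adj (hdel i).1 hcard hnb
      (srg_common_neighbor_variance hs heP hsum hK hM hN hbound') hp hq'⟩
  have hYne : ∀ a b (ha : a < mN + 1) (hb : b < mN + 1), a ≠ b → Y ⟨a, ha⟩ ≠ Y ⟨b, hb⟩ :=
    fun a b ha hb hab h => hab (Fin.mk.inj (hinj h))
  have h01 := hYne 0 1 (by omega) (by omega) (by omega)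
  have h02 := hYne 0 2 (by omega) (by omega) (by omega)
  have h12 := hYne 1 2 (by omega) (by omega) (by omega)
  generalize hA : Y ⟨0, _⟩ = A at h01 h02
  generalize hB : Y ⟨1, _⟩ = B at h01 h12
  generalize hC : Y ⟨2, _⟩ = C at h02 h12
  have hbA := hA ▸ hbal _
  have hbB := hB ▸ hbal _
  have hbC := hC ▸ hbal _
  have hsr : 0 < s + eP := by linarith
  have hc : ((A ∩ B ∩ C).card : ℤ) * (s - eP ^ 2) = eP * (eP - 1) := by
    apply mul_right_cancel₀ hsr.ne'
    linear_combination (eP ^ 2 - s) * hbA.card_inter_inter hbB hbC h01 hsr -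
      s * hbA.card_inter hbB h01 - eP * hbA.card_inter hbC h02 - eP * hbB.card_inter hbC h12 +
      (s + eP) * hN
  refine ⟨(A ∩ B ∩ C).card, ?_,
    add_one_dvd_two_mul_add_four hs hq (Int.natCast_nonneg _) hK hN hbound' hc⟩
  have hqQ : (eP : ℚ) ^ 2 + ((-s : ℤ) : ℚ) ≠ 0 := by
    exact_mod_cast (by linarith : eP ^ 2 + -s ≠ 0)
  rw [eq_div_iff hqQ]
  have hcQ : (((A ∩ B ∩ C).card : ℚ)) * (s - eP ^ 2) = eP * (eP - 1) := by exact_mod_cast hc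
  push_cast
  linear_combination (-1 : ℚ) * hcQ
end
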